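/- arXiv:2201.06184 — 2 statements merged into one kernel-verified Lean document; each statement's English description precedes it below -/
import Mathlib

section
/- The Riemann hypothesis holds if and only if ∫_2^x (θ(t) − t) dt < 0 for every real x > 2. -/
open MeasureTheory Filter

/-- `theta x = ∑_{p ≤ x} log p`, the Chebyshev theta function. -/
noncomputable def theta (x : ℝ) : ℝ :=
  ∑ p ∈ Finset.filter Nat.Prime (Finset.range (⌊x⌋₊ + 1)), Real.log p


namespace RHT
open Set Complex Topology

/-- Convergence of the Mellin type integral. -/
def IntAt (N : ℝ → ℝ) (σ : ℝ) : Prop :=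
  IntegrableOn (fun x : ℝ => N x * x ^ (-(σ + 1))) (Ioi 1)

/-- Mellin type transform. -/
noncomputable def T (N : ℝ → ℝ) (s : ℂ) : ℂ :=
  ∫ x in Ioi (1:ℝ), (N x : ℂ) * (x : ℂ) ^ (-(s + 1))

lemma IntAt.aesm {N : ℝ → ℝ} {σ : ℝ} (h : IntAt N σ) :
    AEStronglyMeasurable N (volume.restrict (Ioi 1)) := by
  have h1 := h.aestronglyMeasurable
  have h2 : AEStronglyMeasurable (fun x : ℝ => x ^ (σ + 1)) (volume.restrict (Ioi 1)) := by
    apply ContinuousOn.aestronglyMeasurable _ measurableSet_Ioi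
    intro x hx
    exact (Real.continuousAt_rpow_const _ _ (Or.inl (by simp at hx; linarith))).continuousWithinAt
  refine (h1.mul h2).congr ?_
  filter_upwards [ae_restrict_mem measurableSet_Ioi] with x hx
  simp only [mem_Ioi] at hx
  simp only [Pi.mul_apply]
  rw [mul_assoc, ← Real.rpow_add (by linarith)]
  simp

lemma norm_cpow_eq {x : ℝ} (hx : 1 < x) (s : ℂ) :
    ‖(x : ℂ) ^ (-(s + 1))‖ = x ^ (-(s.re + 1)) := by
  rw [Complex.norm_cpow_eq_rpow_re_of_pos (by linarith)]
  simp

lemma aesm_cpow (s : ℂ) : AEStronglyMeasurable (fun x : ℝ => (x : ℂ) ^ (-(s + 1)))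
    (volume.restrict (Ioi 1)) := by
  apply ContinuousOn.aestronglyMeasurable _ measurableSet_Ioi
  intro x hx
  simp only [mem_Ioi] at hx
  exact (Complex.continuousAt_ofReal_cpow_const _ _ (Or.inr (by linarith))).continuousWithinAt

lemma IntAt.mono {N : ℝ → ℝ} {σ τ : ℝ} (h : IntAt N σ) (hτ : σ ≤ τ) : IntAt N τ := by
  refine Integrable.mono h ?_ ?_
  · refine h.aesm.mul ?_
    apply ContinuousOn.aestronglyMeasurable _ measurableSet_Ioi
    intro x hx
    exact (Real.continuousAt_rpow_const _ _ (Or.inl (by simp at hx; linarith))).continuousWithinAt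
  · filter_upwards [ae_restrict_mem measurableSet_Ioi] with x hx
    simp only [mem_Ioi] at hx
    rw [norm_mul, norm_mul]
    gcongr 1
    rw [Real.norm_of_nonneg (by positivity), Real.norm_of_nonneg (by positivity)]
    exact Real.rpow_le_rpow_of_exponent_le hx.le (by linarith)

lemma IntAt.integrable {N : ℝ → ℝ} {s : ℂ} (h : IntAt N s.re) :
    IntegrableOn (fun x : ℝ => (N x : ℂ) * (x : ℂ) ^ (-(s + 1))) (Ioi 1) := by
  refine Integrable.mono h ?_ ?_
  · exact (continuous_ofReal.comp_aestronglyMeasurable h.aesm).mul (aesm_cpow s)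
  · filter_upwards [ae_restrict_mem measurableSet_Ioi] with x hx
    simp only [mem_Ioi] at hx
    rw [norm_mul, norm_mul, norm_cpow_eq hx, Complex.norm_real,
      Real.norm_of_nonneg (r := x ^ (-(s.re + 1))) (by positivity)]

lemma T_hasSum {N : ℝ → ℝ} {c w : ℂ} {r : ℝ} (h : IntAt N (c.re - r)) (hw : ‖w‖ ≤ r) :
    HasSum (fun k : ℕ => ∫ x in Ioi (1:ℝ),
      (N x : ℂ) * (x : ℂ) ^ (-(c + 1)) * ((-w * Real.log x) ^ k / (k.factorial : ℂ)))
      (T N (c + w)) := by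
  have hr : 0 ≤ r := (norm_nonneg _).trans hw
  unfold T
  have hexp : ∀ x : ℝ, 1 < x → HasSum (fun k : ℕ => |N x| * x ^ (-(c.re + 1)) * ((r * Real.log x) ^ k / (k.factorial : ℝ)))
      (|N x| * x ^ (-((c.re - r) + 1))) := by
    intro x hx
    have h1 := (NormedSpace.expSeries_div_hasSum_exp (𝔸 := ℝ) (r * Real.log x)).mul_left (|N x| * x ^ (-(c.re + 1)))
    rw [← Real.exp_eq_exp_ℝ] at h1
    suffices e : |N x| * x ^ (-((c.re - r) + 1)) = |N x| * x ^ (-(c.re + 1)) * Real.exp (r * Real.log x) by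
      rw [e]; exact h1
    rw [mul_assoc]
    congr 1
    rw [mul_comm r, Real.exp_mul, Real.exp_log (by linarith), ← Real.rpow_add (by linarith)]
    congr 1
    ring
  refine hasSum_integral_of_dominated_convergence
    (fun k x => |N x| * x ^ (-(c.re + 1)) * ((r * Real.log x) ^ k / (k.factorial : ℝ))) ?_ ?_ ?_ ?_ ?_
  · intro k
    refine ((continuous_ofReal.comp_aestronglyMeasurable h.aesm).mul (aesm_cpow c)).mul ?_
    refine Measurable.aestronglyMeasurable ?_
    fun_prop
  · intro k
    filter_upwards [ae_restrict_mem measurableSet_Ioi] with x hx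
    simp only [mem_Ioi] at hx
    have hl : 0 ≤ Real.log x := Real.log_nonneg hx.le
    rw [norm_mul, norm_mul, norm_cpow_eq hx, Complex.norm_real, Real.norm_eq_abs]
    simp only [norm_div, norm_pow, norm_mul, norm_neg, Complex.norm_real, Complex.norm_natCast]
    rw [Real.norm_of_nonneg hl]
    gcongr
  · filter_upwards [ae_restrict_mem measurableSet_Ioi] with x hx
    exact (hexp x hx).summable
  · refine (h.abs).congr ?_
    filter_upwards [ae_restrict_mem measurableSet_Ioi] with x hx
    rw [(hexp x hx).tsum_eq, abs_mul]
    congr 1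
    simp only [mem_Ioi] at hx
    rw [abs_of_nonneg (by positivity)]
  · filter_upwards [ae_restrict_mem measurableSet_Ioi] with x hx
    simp only [mem_Ioi] at hx
    have h1 := (NormedSpace.expSeries_div_hasSum_exp (𝔸 := ℂ) (-w * Real.log x)).mul_left ((N x : ℂ) * (x : ℂ) ^ (-(c + 1)))
    rw [← Complex.exp_eq_exp_ℂ] at h1
    suffices e : (N x : ℂ) * (x : ℂ) ^ (-(c + w + 1)) = (N x : ℂ) * (x : ℂ) ^ (-(c + 1)) * cexp (-w * Real.log x) by
      rw [e]; exact h1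
    rw [mul_assoc]
    congr 1
    have hx0 : (x : ℂ) ≠ 0 := by exact_mod_cast (by linarith : x ≠ 0)
    rw [Complex.cpow_def_of_ne_zero hx0, Complex.cpow_def_of_ne_zero hx0, ← Complex.exp_add,
      Complex.ofReal_log (by linarith)]
    congr 1
    ring

/-- Taylor coefficients -/
noncomputable def tc (N : ℝ → ℝ) (c : ℂ) (k : ℕ) : ℂ := ∫ x in Ioi (1:ℝ),
      (N x : ℂ) * (x : ℂ) ^ (-(c + 1)) * ((-Real.log x) ^ k / (k.factorial : ℂ))

lemma T_hasSum' {N : ℝ → ℝ} {c w : ℂ} {r : ℝ} (h : IntAt N (c.re - r)) (hw : ‖w‖ ≤ r) :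
    HasSum (fun k : ℕ => w ^ k * tc N c k) (T N (c + w)) := by
  convert T_hasSum h hw using 2 with k
  unfold tc
  rw [← integral_const_mul]
  congr 1
  ext x
  rw [neg_mul, ← mul_neg, mul_pow]
  ring

lemma T_fps {N : ℝ → ℝ} {c : ℂ} {r : ℝ} (hr : 0 < r) (h : IntAt N (c.re - r)) :
    HasFPowerSeriesOnBall (T N) (FormalMultilinearSeries.ofScalars ℂ (tc N c)) c (ENNReal.ofReal r) where
  r_le := by
    refine FormalMultilinearSeries.le_radius_of_summable _ ?_
    have := (T_hasSum' (w := (r:ℂ)) h (by simp [abs_of_pos hr])).summable.norm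
    refine this.congr ?_
    intro k
    rw [FormalMultilinearSeries.ofScalars_norm]
    simp [abs_of_pos hr, mul_comm, hr.le]
  r_pos := by simpa using hr
  hasSum := by
    intro y hy
    have hy' : ‖y‖ ≤ r := by
      rw [Metric.mem_eball, edist_zero_right] at hy
      rw [← ofReal_norm, ENNReal.ofReal_lt_ofReal_iff hr] at hy
      exact hy.le
    have e : (fun k : ℕ => (FormalMultilinearSeries.ofScalars ℂ (tc N c) k) fun _ => y) =
        fun k : ℕ => y ^ k * tc N c k := by
      ext k
      rw [FormalMultilinearSeries.ofScalars_apply_eq]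
      simp [mul_comm]
    rw [e]
    exact T_hasSum' h hy'

lemma T_diff {N : ℝ → ℝ} {a : ℝ} (h : ∀ σ, a < σ → IntAt N σ) :
    DifferentiableOn ℂ (T N) {s | a < s.re} := by
  intro s hs
  simp only [mem_ofPred_eq] at hs
  have := T_fps (N := N) (c := s) (r := (s.re - a)/2) (by linarith) (h _ (by linarith))
  exact this.analyticAt.differentiableAt.differentiableWithinAt

end RHT


namespace RHT
open Set Complex Topology

lemma landau_core {N : ℝ → ℝ} (hN : ∀ x, 1 < x → 0 ≤ N x) {c r₀ R R' : ℝ} (hr₀ : 0 < r₀)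
    (h : IntAt N (c - r₀)) {F : ℂ → ℂ} (hF : DifferentiableOn ℂ F (Metric.closedBall (c:ℂ) R))
    (hFT : F =ᶠ[𝓝 (c:ℂ)] T N) (hR' : 0 ≤ R') (hRR : R' < R) : IntAt N (c - R') := by
  have hRpos : 0 < R := by linarith
  have hp := T_fps (N := N) (c := (c:ℂ)) hr₀ (by simpa using h)
  lift R to NNReal using hRpos.le
  have hq := hF.hasFPowerSeriesOnBall (by exact_mod_cast hRpos)
  have heq := HasFPowerSeriesAt.eq_formalMultilinearSeries_of_eventually hq.hasFPowerSeriesAt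
    hp.hasFPowerSeriesAt hFT
  rw [heq] at hq
  have hs := (hq.hasSum (y := ((-R' : ℝ) : ℂ)) (by
    rw [Metric.mem_eball, edist_zero_right, ← ofReal_norm, Complex.norm_real, norm_neg,
      Real.norm_of_nonneg hR']
    rw [← ENNReal.ofReal_coe_nnreal]
    exact (ENNReal.ofReal_lt_ofReal_iff hRpos).2 hRR)).summable
  set g : ℕ → ℝ → ℝ := fun k x => N x * x ^ (-(c + 1)) * ((R' * Real.log x) ^ k / (k.factorial : ℝ)) with hg
  have hg0 : ∀ k x, 1 < x → 0 ≤ g k x := by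
    intro k x hx
    have := hN x hx
    have := Real.log_nonneg hx.le
    simp only [hg]
    positivity
  have hgi : ∀ k, IntegrableOn (g k) (Ioi 1) := by
    intro k
    refine Integrable.mono (h.const_mul ((R' / r₀) ^ k)) ?_ ?_
    · refine (h.aesm.mul ?_).mul (Measurable.aestronglyMeasurable (by fun_prop))
      apply ContinuousOn.aestronglyMeasurable _ measurableSet_Ioi
      intro x hx
      exact (Real.continuousAt_rpow_const _ _ (Or.inl (by simp at hx; linarith))).continuousWithinAt
    · filter_upwards [ae_restrict_mem measurableSet_Ioi] with x hx
      simp only [mem_Ioi] at hx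
      have h1 := hN x hx
      have h2 := Real.log_nonneg hx.le
      rw [Real.norm_of_nonneg (hg0 k x hx), Real.norm_of_nonneg (by positivity)]
      simp only [hg]
      have h3 : (r₀ * Real.log x) ^ k / (k.factorial : ℝ) ≤ x ^ r₀ := by
        have := Real.pow_div_factorial_le_exp (r₀ * Real.log x) (by positivity) k
        rwa [mul_comm r₀, Real.exp_mul, Real.exp_log (by linarith), mul_comm (Real.log x)] at this
      have h4 : (R' * Real.log x) ^ k / (k.factorial : ℝ) = (R' / r₀) ^ k * ((r₀ * Real.log x) ^ k / (k.factorial : ℝ)) := by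
        rw [mul_div, ← mul_pow]
        congr 2
        field_simp
      rw [h4]
      have h5 : x ^ (-(c - r₀ + 1)) = x ^ (-(c + 1)) * x ^ r₀ := by
        rw [← Real.rpow_add (by linarith)]; congr 1; ring
      rw [h5]
      calc _ = (R' / r₀) ^ k * (N x * (x ^ (-(c + 1)) * ((r₀ * Real.log x) ^ k / (k.factorial : ℝ)))) := by ring
        _ ≤ _ := by gcongr
  have hs2 : Summable (fun k => ∫ x in Ioi (1:ℝ), g k x) := by
    rw [← Complex.summable_ofReal]
    refine hs.congr ?_
    intro k
    rw [FormalMultilinearSeries.ofScalars_apply_eq]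
    unfold tc
    rw [smul_eq_mul, mul_comm, ← integral_const_mul, ← integral_complex_ofReal]
    refine setIntegral_congr_fun measurableSet_Ioi ?_
    intro x hx
    simp only [mem_Ioi] at hx
    simp only [hg]
    push_cast
    rw [Complex.ofReal_cpow (by linarith), neg_pow (R':ℂ), neg_pow (Complex.ofReal (Real.log x)), mul_pow]
    push_cast
    have : ((-1:ℂ)^k) * (-1)^k = 1 := by rw [← mul_pow]; simp
    linear_combination (↑R' ^ k * (↑(N x) * (x:ℂ) ^ (-((c:ℂ) + 1)) * (↑(Real.log x) ^ k / ↑k.factorial))) * this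
  have hexp : ∀ x : ℝ, 1 < x → HasSum (fun k : ℕ => g k x) (N x * x ^ (-((c - R') + 1))) := by
    intro x hx
    have h1 := (NormedSpace.expSeries_div_hasSum_exp (𝔸 := ℝ) (R' * Real.log x)).mul_left (N x * x ^ (-(c + 1)))
    rw [← Real.exp_eq_exp_ℝ] at h1
    suffices e : N x * x ^ (-((c - R') + 1)) = N x * x ^ (-(c + 1)) * Real.exp (R' * Real.log x) by
      rw [e]; exact h1
    rw [mul_assoc]
    congr 1
    rw [mul_comm R', Real.exp_mul, Real.exp_log (by linarith), ← Real.rpow_add (by linarith)]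
    congr 1
    ring
  refine ⟨?_, ?_⟩
  · refine h.aesm.mul ?_
    apply ContinuousOn.aestronglyMeasurable _ measurableSet_Ioi
    intro x hx
    exact (Real.continuousAt_rpow_const _ _ (Or.inl (by simp at hx; linarith))).continuousWithinAt
  · rw [hasFiniteIntegral_iff_norm]
    have e1 : ∫⁻ x in Ioi (1:ℝ), ENNReal.ofReal ‖N x * x ^ (-((c - R') + 1))‖ =
        ∫⁻ x in Ioi (1:ℝ), ∑' k, ENNReal.ofReal (g k x) := by
      refine setLIntegral_congr_fun measurableSet_Ioi ?_
      intro x hx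
      simp only [mem_Ioi] at hx
      have := hN x hx
      simp only
      rw [Real.norm_of_nonneg (by positivity), ← (hexp x hx).tsum_eq,
        ENNReal.ofReal_tsum_of_nonneg (fun k => hg0 k x hx) (hexp x hx).summable]
    rw [e1, lintegral_tsum (fun k => (hgi k).aestronglyMeasurable.aemeasurable.ennreal_ofReal)]
    have e2 : ∀ k, ∫⁻ x in Ioi (1:ℝ), ENNReal.ofReal (g k x) = ENNReal.ofReal (∫ x in Ioi (1:ℝ), g k x) := by
      intro k
      rw [ofReal_integral_eq_lintegral_ofReal (hgi k)]
      filter_upwards [ae_restrict_mem measurableSet_Ioi] with x hx using hg0 k x hx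
    simp_rw [e2]
    rw [← ENNReal.ofReal_tsum_of_nonneg _ hs2]
    · exact ENNReal.ofReal_lt_top
    · intro k
      exact setIntegral_nonneg measurableSet_Ioi (fun x hx => hg0 k x hx)

lemma isOpen_re (a : ℝ) : IsOpen {s : ℂ | a < s.re} := isOpen_lt continuous_const continuous_re

lemma eq_on_half {F G : ℂ → ℂ} {a b : ℝ} (hF : DifferentiableOn ℂ F {s | a < s.re})
    (hG : DifferentiableOn ℂ G {s | a < s.re}) (h : ∀ s : ℂ, b < s.re → F s = G s) :
    ∀ s : ℂ, a < s.re → F s = G s := by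
  have h1 := (hF.analyticOnNhd (isOpen_re a)).eqOn_of_preconnected_of_eventuallyEq
    (hG.analyticOnNhd (isOpen_re a)) (convex_halfSpace_re_gt a).isPreconnected
    (z₀ := ((max a b + 1 : ℝ) : ℂ)) (by simp only [mem_ofPred_eq, ofReal_re]; linarith [le_max_left a b]) ?_
  · intro s hs; exact h1 hs
  · filter_upwards [(isOpen_re b).mem_nhds (show ((max a b + 1 : ℝ) : ℂ) ∈ {s : ℂ | b < s.re} by
      simp only [mem_ofPred_eq, ofReal_re]; linarith [le_max_right a b])] with s hs
    exact h s hs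

lemma landau_id {N : ℝ → ℝ} {a b : ℝ} {W Z : ℂ → ℂ} (hI : ∀ σ, a < σ → IntAt N σ)
    (hW : DifferentiableOn ℂ W {s | a < s.re}) (hZ : DifferentiableOn ℂ Z {s | a < s.re})
    (hWZ : ∀ s : ℂ, b < s.re → Z s * T N s = W s) :
    ∀ s : ℂ, a < s.re → Z s * T N s = W s :=
  eq_on_half (hZ.mul (T_diff hI)) hW hWZ

lemma landau {N : ℝ → ℝ} (hN : ∀ x, 1 < x → 0 ≤ N x) {a b : ℝ} {W Z : ℂ → ℂ}
    (hI : ∀ σ, b < σ → IntAt N σ)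
    (hW : DifferentiableOn ℂ W {s | a < s.re}) (hZ : DifferentiableOn ℂ Z {s | a < s.re})
    (hZr : ∀ σ : ℝ, a < σ → Z σ ≠ 0)
    (hWZ : ∀ s : ℂ, b < s.re → Z s * T N s = W s) :
    ∀ σ, a < σ → IntAt N σ := by
  by_contra! hcon
  obtain ⟨σ', hσ', hnot⟩ := hcon
  set S := {σ : ℝ | ¬ IntAt N σ} with hS
  have hbdd : BddAbove S := ⟨b, fun σ hσ => by
    by_contra! hlt
    exact hσ (hI σ hlt)⟩
  have hne : S.Nonempty := ⟨σ', hnot⟩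
  set t := sSup S with ht
  have hat : a < t := lt_of_lt_of_le hσ' (le_csSup hbdd hnot)
  have hIt : ∀ σ, t < σ → IntAt N σ := by
    intro σ hσ
    by_contra hc
    exact absurd (le_csSup hbdd hc) (not_le.2 hσ)
  have hsub : {s : ℂ | t < s.re} ⊆ {s : ℂ | a < s.re} := fun s hs => by
    simp only [mem_ofPred_eq] at hs ⊢; linarith
  have hid := landau_id hIt (hW.mono hsub) (hZ.mono hsub) hWZ
  -- a ball around t where Z ≠ 0
  have hta : (t : ℂ) ∈ {s : ℂ | a < s.re} := by simpa using hat
  have hev : ∀ᶠ s in 𝓝 (t:ℂ), a < s.re ∧ Z s ≠ 0 := by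
    have h1 : ∀ᶠ s : ℂ in 𝓝 (t:ℂ), a < s.re := (isOpen_re a).mem_nhds hta
    refine h1.and ?_
    have hc : ContinuousAt Z t := (hZ.differentiableAt ((isOpen_re a).mem_nhds hta)).continuousAt
    exact hc.eventually_ne (hZr t hat)
  obtain ⟨ε, hε, hball⟩ := Metric.eventually_nhds_iff_ball.1 hev
  obtain ⟨δ, hδ0, hδ⟩ : ∃ δ : ℝ, 0 < δ ∧ 2 * δ + δ ^ 2 < ε ^ 2 := by
    refine ⟨min 1 (ε ^ 2 / 4), by positivity, ?_⟩
    have h1 := min_le_left 1 (ε ^ 2 / 4)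
    have h2 := min_le_right 1 (ε ^ 2 / 4)
    have h3 : 0 < min 1 (ε ^ 2 / 4) := by positivity
    nlinarith
  classical
  set F : ℂ → ℂ := fun s => if t < s.re then T N s else W s / Z s with hF
  have hFd : DifferentiableOn ℂ F (Metric.closedBall ((t + 1 : ℝ) : ℂ) (1 + δ)) := by
    intro s hs
    by_cases hst : t < s.re
    · have : F =ᶠ[𝓝 s] T N := by
        filter_upwards [(isOpen_re t).mem_nhds hst] with z hz
        simp only [hF]
        exact if_pos hz
      exact (this.symm.differentiableAt_iff.1 ((T_diff hIt).differentiableAt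
        ((isOpen_re t).mem_nhds hst))).differentiableWithinAt
    · have hsb : s ∈ Metric.ball (t:ℂ) ε := by
        rw [Metric.mem_closedBall, Complex.dist_eq] at hs
        rw [Metric.mem_ball, Complex.dist_eq]
        have h1 : ‖s - ((t+1:ℝ):ℂ)‖ ^ 2 ≤ (1 + δ) ^ 2 := by gcongr
        rw [Complex.sq_norm, Complex.normSq_apply] at h1
        have h2 : ‖s - (t:ℂ)‖ ^ 2 < ε ^ 2 := by
          rw [Complex.sq_norm, Complex.normSq_apply]
          simp at h1 ⊢
          nlinarith
        exact lt_of_pow_lt_pow_left₀ 2 hε.le h2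
      have : F =ᶠ[𝓝 s] fun s => W s / Z s := by
        filter_upwards [Metric.isOpen_ball.mem_nhds hsb] with z hz
        simp only [hF]
        split_ifs with hzt
        · rw [← hid z hzt, mul_div_cancel_left₀ _ (hball z hz).2]
        · rfl
      have has := (isOpen_re a).mem_nhds (hball s hsb).1
      exact (this.symm.differentiableAt_iff.1 ((hW.differentiableAt has).div
        (hZ.differentiableAt has) (hball s hsb).2)).differentiableWithinAt
  have hFT : F =ᶠ[𝓝 ((t+1:ℝ):ℂ)] T N := by
    filter_upwards [(isOpen_re t).mem_nhds (show ((t+1:ℝ):ℂ) ∈ {s : ℂ | t < s.re} by simp)] with z hz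
    simp only [hF]
    exact if_pos hz
  have hfin := landau_core hN (c := t + 1) (r₀ := 1/2) (R' := 1 + δ / 2) (by norm_num) (hIt _ (by linarith))
    hFd hFT (by linarith) (by linarith)
  obtain ⟨τ, hτS, hτ⟩ := exists_lt_of_lt_csSup hne (show t - δ / 2 < sSup S by linarith)
  exact hτS (hfin.mono (by linarith))

end RHT


namespace RHT
open Set Complex Topology

lemma intAt_of_bound {N : ℝ → ℝ} (hm : AEStronglyMeasurable N (volume.restrict (Ioi 1))) {C a σ : ℝ}
    (hb : ∀ x, 1 < x → |N x| ≤ C * x ^ a) (hσ : a < σ) : IntAt N σ := by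
  have h1 : IntegrableOn (fun x : ℝ => C * x ^ (a - (σ + 1))) (Ioi 1) :=
    (integrableOn_Ioi_rpow_of_lt (by linarith) one_pos).const_mul C
  refine Integrable.mono' h1 ?_ ?_
  · refine hm.mul ?_
    apply ContinuousOn.aestronglyMeasurable _ measurableSet_Ioi
    intro x hx
    exact (Real.continuousAt_rpow_const _ _ (Or.inl (by simp at hx; linarith))).continuousWithinAt
  · filter_upwards [ae_restrict_mem measurableSet_Ioi] with x hx
    simp only [mem_Ioi] at hx
    rw [norm_mul, Real.norm_eq_abs, Real.norm_of_nonneg (by positivity), Real.rpow_sub (by linarith),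
      Real.rpow_neg (by linarith), ← div_eq_mul_inv, ← mul_div_assoc]
    gcongr
    exact hb x hx

lemma T_add {N M : ℝ → ℝ} {s : ℂ} (hN : IntAt N s.re) (hM : IntAt M s.re) :
    T (fun x => N x + M x) s = T N s + T M s := by
  unfold T
  rw [← integral_add hN.integrable hM.integrable]
  congr 1; ext x; push_cast; ring

lemma T_sub {N M : ℝ → ℝ} {s : ℂ} (hN : IntAt N s.re) (hM : IntAt M s.re) :
    T (fun x => N x - M x) s = T N s - T M s := by
  unfold T
  rw [← integral_sub hN.integrable hM.integrable]
  congr 1; ext x; push_cast; ring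

lemma T_const_mul {N : ℝ → ℝ} {s : ℂ} (c : ℝ) :
    T (fun x => c * N x) s = c * T N s := by
  unfold T
  rw [← integral_const_mul]
  congr 1; ext x; push_cast; ring

lemma IntAt.add {N M : ℝ → ℝ} {σ : ℝ} (hN : IntAt N σ) (hM : IntAt M σ) :
    IntAt (fun x => N x + M x) σ := by
  refine (Integrable.add hN hM).congr (Eventually.of_forall fun x => ?_)
  simp only [Pi.add_apply]; ring

lemma IntAt.sub {N M : ℝ → ℝ} {σ : ℝ} (hN : IntAt N σ) (hM : IntAt M σ) :
    IntAt (fun x => N x - M x) σ := by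
  refine (Integrable.sub hN hM).congr (Eventually.of_forall fun x => ?_)
  simp only [Pi.sub_apply]; ring

lemma IntAt.const_mul {N : ℝ → ℝ} {σ : ℝ} (hN : IntAt N σ) (c : ℝ) :
    IntAt (fun x => c * N x) σ := by
  refine (Integrable.const_mul hN c).congr (Eventually.of_forall fun x => ?_)
  simp only; ring

lemma T_congr {N M : ℝ → ℝ} {s : ℂ} (h : ∀ x, 1 < x → N x = M x) : T N s = T M s := by
  unfold T
  refine setIntegral_congr_fun measurableSet_Ioi ?_
  intro x hx
  simp only [h x hx]

lemma IntAt.congr {N M : ℝ → ℝ} {σ : ℝ} (hN : IntAt N σ) (h : ∀ x, 1 < x → N x = M x) : IntAt M σ := by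
  refine IntegrableOn.congr_fun hN ?_ measurableSet_Ioi
  intro x hx
  simp only [h x hx]

lemma T_rpow {a : ℝ} {s : ℂ} (h : a < s.re) : T (fun x => x ^ a) s = 1 / (s - a) := by
  unfold T
  have e : ∫ x in Ioi (1:ℝ), ((x ^ a : ℝ) : ℂ) * (x : ℂ) ^ (-(s + 1)) = ∫ x in Ioi (1:ℝ), (x : ℂ) ^ (a - (s + 1)) := by
    refine setIntegral_congr_fun measurableSet_Ioi ?_
    intro x hx
    simp only [mem_Ioi] at hx
    simp only
    rw [Complex.ofReal_cpow (by linarith), ← Complex.cpow_add _ _ (by exact_mod_cast (by linarith : x ≠ 0))]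
    rfl
  rw [e, integral_Ioi_cpow_of_lt (by simp; linarith) one_pos]
  have : s - a ≠ 0 := by
    intro h0
    have := congrArg Complex.re h0
    simp at this; linarith
  have h2 : (a:ℂ) - (s + 1) + 1 = -(s - a) := by ring
  rw [h2, Complex.ofReal_one, Complex.one_cpow, neg_div_neg_eq]

lemma intAt_rpow {a σ : ℝ} (h : a < σ) : IntAt (fun x => x ^ a) σ := by
  refine intAt_of_bound (C := 1) (a := a) ?_ ?_ h
  · exact Measurable.aestronglyMeasurable (by fun_prop)
  · intro x hx
    rw [abs_of_nonneg (by positivity), one_mul]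

lemma byparts_aux {φ : ℝ → ℝ} {s : ℂ} (hs : -1 < s.re) (h : IntAt φ s.re) :
    IntegrableOn (fun x : ℝ => ((∫ t in (1:ℝ)..x, φ t : ℝ) : ℂ) * (x:ℂ) ^ (-(s + 2))) (Ioi 1) ∧
    ∫ x in Ioi (1:ℝ), ((∫ t in (1:ℝ)..x, φ t : ℝ) : ℂ) * (x:ℂ) ^ (-(s + 2)) = T φ s / (s + 1) := by
  set μ := (volume : Measure ℝ).restrict (Ioi 1) with hμ
  set f : ℝ × ℝ → ℂ := fun p => if p.2 < p.1 then (φ p.2 : ℂ) * (p.1 : ℂ) ^ (-(s + 2)) else 0 with hf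
  have hs1 : s + 1 ≠ 0 := by
    intro h0
    have := congrArg Complex.re h0
    simp at this; linarith
  have hfm : AEStronglyMeasurable f (μ.prod μ) := by
    have h1 : AEStronglyMeasurable (fun p : ℝ × ℝ => (φ p.2 : ℂ) * (p.1 : ℂ) ^ (-(s + 2))) (μ.prod μ) := by
      refine AEStronglyMeasurable.mul ?_ ?_
      · exact continuous_ofReal.comp_aestronglyMeasurable (AEStronglyMeasurable.comp_snd h.aesm)
      · refine AEStronglyMeasurable.comp_fst (f := fun x : ℝ => (x : ℂ) ^ (-(s + 2))) ?_
        have e : -(s + 2) = -((s + 1) + 1) := by ring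
        rw [e]
        exact aesm_cpow (s + 1)
    have h2 : MeasurableSet {p : ℝ × ℝ | p.2 < p.1} := measurableSet_lt measurable_snd measurable_fst
    have := h1.indicator h2
    refine this.congr (Eventually.of_forall fun p => ?_)
    simp only [hf, indicator_apply, mem_ofPred_eq]
  have hinner : ∀ t : ℝ, 1 < t → (fun x => f (x, t)) =ᵐ[μ] (Ioi t).indicator (fun x : ℝ => (φ t : ℂ) * (x : ℂ) ^ (-(s + 2))) := by
    intro t ht
    refine Eventually.of_forall fun x => ?_
    simp only [hf, indicator_apply, mem_Ioi]
  have hres : ∀ t : ℝ, 1 < t → μ.restrict (Ioi t) = volume.restrict (Ioi t) := by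
    intro t ht
    rw [hμ, Measure.restrict_restrict measurableSet_Ioi]
    congr 1
    ext x; simp; intro h; linarith
  have hint1 : ∀ t : ℝ, 1 < t → Integrable (fun x => f (x, t)) μ := by
    intro t ht
    rw [integrable_congr (hinner t ht), integrable_indicator_iff measurableSet_Ioi, IntegrableOn, hres t ht]
    refine Integrable.const_mul ?_ _
    exact integrableOn_Ioi_cpow_of_lt (by simp; linarith) (by linarith)
  have hval : ∀ t : ℝ, 1 < t → ∫ x, f (x, t) ∂μ = (φ t : ℂ) * (t : ℂ) ^ (-(s + 1)) / (s + 1) := by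
    intro t ht
    rw [integral_congr_ae (hinner t ht), integral_indicator measurableSet_Ioi, hres t ht, integral_const_mul,
      integral_Ioi_cpow_of_lt (by simp; linarith) (by linarith)]
    have e : -(s + 2) + 1 = -(s + 1) := by ring
    rw [e, neg_div_neg_eq, mul_div_assoc]
  have hvaln : ∀ t : ℝ, 1 < t → ∫ x, ‖f (x, t)‖ ∂μ = |φ t| * t ^ (-(s.re + 1)) / (s.re + 1) := by
    intro t ht
    have : (fun x => ‖f (x, t)‖) =ᵐ[μ] (Ioi t).indicator (fun x : ℝ => |φ t| * x ^ (-(s.re + 2))) := by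
      filter_upwards [ae_restrict_mem measurableSet_Ioi] with x hx
      simp only [mem_Ioi] at hx
      simp only [hf, indicator_apply, mem_Ioi]
      split_ifs
      · rw [norm_mul, Complex.norm_cpow_eq_rpow_re_of_pos (by linarith), Complex.norm_real, Real.norm_eq_abs]
        simp
      · simp
    rw [integral_congr_ae this, integral_indicator measurableSet_Ioi, hres t ht, integral_const_mul,
      integral_Ioi_rpow_of_lt (by linarith) (by linarith)]
    have e : -(s.re + 2) + 1 = -(s.re + 1) := by ring
    rw [e, neg_div_neg_eq, mul_div_assoc]
  have hfi : Integrable f (μ.prod μ) := by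
    rw [integrable_prod_iff' hfm]
    refine ⟨?_, ?_⟩
    · filter_upwards [ae_restrict_mem measurableSet_Ioi] with t ht using hint1 t ht
    · have h3 : Integrable (fun t => |φ t| * t ^ (-(s.re + 1)) / (s.re + 1)) μ := by
        refine Integrable.div_const ?_ _
        refine (Integrable.abs h).congr ?_
        filter_upwards [ae_restrict_mem measurableSet_Ioi] with t ht
        simp only [mem_Ioi] at ht
        rw [abs_mul, abs_of_nonneg (a := t ^ (-(s.re + 1))) (by positivity)]
      refine h3.congr ?_
      filter_upwards [ae_restrict_mem measurableSet_Ioi] with t ht using (hvaln t ht).symm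
  have hleft : ∀ x : ℝ, 1 < x → ∫ t, f (x, t) ∂μ = ((∫ t in (1:ℝ)..x, φ t : ℝ) : ℂ) * (x:ℂ) ^ (-(s + 2)) := by
    intro x hx
    have h1 : (fun t => f (x, t)) = (Iio x).indicator (fun t : ℝ => (φ t : ℂ) * (x : ℂ) ^ (-(s + 2))) := by
      ext t
      simp only [hf, indicator_apply, mem_Iio]
    have hset : Iio x ∩ Ioi 1 = Ioo 1 x := by ext y; simp [and_comm]
    rw [h1, integral_indicator measurableSet_Iio, integral_mul_const, hμ,
      Measure.restrict_restrict measurableSet_Iio, intervalIntegral.integral_of_le hx.le,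
      integral_Ioc_eq_integral_Ioo, integral_complex_ofReal, hset]
  constructor
  · refine hfi.integral_prod_left.congr ?_
    filter_upwards [ae_restrict_mem measurableSet_Ioi] with x hx using hleft x hx
  · have h4 : ∫ x, ∫ t, f (x, t) ∂μ ∂μ = ∫ t, ∫ x, f (x, t) ∂μ ∂μ :=
      integral_integral_swap hfi
    have h5 : ∫ x, ∫ t, f (x, t) ∂μ ∂μ = ∫ x in Ioi (1:ℝ), ((∫ t in (1:ℝ)..x, φ t : ℝ) : ℂ) * (x:ℂ) ^ (-(s + 2)) :=
      setIntegral_congr_fun measurableSet_Ioi (fun x hx => hleft x hx)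
    have h6 : ∫ t, ∫ x, f (x, t) ∂μ ∂μ = ∫ t in Ioi (1:ℝ), (φ t : ℂ) * (t : ℂ) ^ (-(s + 1)) / (s + 1) :=
      setIntegral_congr_fun measurableSet_Ioi (fun t ht => hval t ht)
    rw [← h5, h4, h6, integral_div]
    rfl

lemma byparts_T {φ : ℝ → ℝ} {s : ℂ} (hs : -1 < s.re) (h : IntAt φ s.re) :
    T (fun x => (∫ t in (1:ℝ)..x, φ t) / x) s = T φ s / (s + 1) := by
  rw [← (byparts_aux hs h).2]
  unfold T
  refine setIntegral_congr_fun measurableSet_Ioi ?_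
  intro x hx
  simp only [mem_Ioi] at hx
  have hx0 : (x:ℂ) ≠ 0 := by exact_mod_cast (by linarith : x ≠ 0)
  simp only
  have : -(s + 2) = -(s+1) - 1 := by ring
  rw [this, Complex.cpow_sub _ _ hx0, Complex.cpow_one]
  push_cast
  ring

lemma byparts_int {φ : ℝ → ℝ} {σ : ℝ} (hs : -1 < σ) (h : IntAt φ σ) :
    IntAt (fun x => (∫ t in (1:ℝ)..x, φ t) / x) σ := by
  have := (byparts_aux (s := (σ:ℂ)) (by simpa using hs) (by simpa using h)).1.re
  refine IntegrableOn.congr_fun this ?_ measurableSet_Ioi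
  intro x hx
  simp only [mem_Ioi] at hx
  have e : -((σ:ℂ) + 2) = ((-(σ+2) : ℝ) : ℂ) := by push_cast; ring
  simp only [e]
  rw [← Complex.ofReal_cpow (by linarith), ← Complex.ofReal_mul]
  simp only [RCLike.re_to_complex, Complex.ofReal_re]
  have : -(σ + 2) = -(σ+1) - 1 := by ring
  rw [this, Real.rpow_sub (by linarith), Real.rpow_one]
  ring

end RHT


namespace RHT
open Set Complex Topology

/-- The entire even function `ξ`-type function `X z = s (s-1) Λ(s)` with `s = 1/2 + z`. -/
noncomputable def X (z : ℂ) : ℂ := 1 + (z ^ 2 - 1 / 4) * completedRiemannZeta₀ (1 / 2 + z)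

/-- `(s - 1) ζ(s)` extended through `s = 1`. -/
noncomputable def Zf (s : ℂ) : ℂ := X (s - 1 / 2) * (Gammaℝ s)⁻¹ * s⁻¹

lemma X_diff : Differentiable ℂ X := by
  unfold X
  have := differentiable_completedZeta₀
  fun_prop

lemma X_even (z : ℂ) : X (-z) = X z := by
  unfold X
  rw [← completedRiemannZeta₀_one_sub (1 / 2 + z)]
  have : 1 / 2 + -z = 1 - (1 / 2 + z) := by ring
  rw [this]; ring

lemma X_half : X (1 / 2) = 1 := by
  unfold X; norm_num

lemma X_eq {s : ℂ} (h0 : s ≠ 0) (h1 : s ≠ 1) :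
    X (s - 1 / 2) = s * (s - 1) * completedRiemannZeta s := by
  unfold X
  have h1' : (1 : ℂ) - s ≠ 0 := sub_ne_zero.mpr h1.symm
  have : (1 / 2 : ℂ) + (s - 1 / 2) = s := by ring
  rw [this, completedRiemannZeta_eq]
  field_simp
  ring

lemma Zf_eq {s : ℂ} (h0 : s ≠ 0) (h1 : s ≠ 1) : Zf s = (s - 1) * riemannZeta s := by
  unfold Zf
  rw [X_eq h0 h1, riemannZeta_def_of_ne_zero h0]
  field_simp

lemma Zf_one : Zf 1 = 1 := by
  unfold Zf
  have : (1 : ℂ) - 1 / 2 = 1 / 2 := by norm_num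
  rw [this, X_half, Gammaℝ_one]; simp

lemma Zf_diffAt {s : ℂ} (h0 : s ≠ 0) : DifferentiableAt ℂ Zf s := by
  unfold Zf
  have h1 := X_diff
  have h2 := differentiable_Gammaℝ_inv
  refine DifferentiableAt.mul (DifferentiableAt.mul ?_ h2.differentiableAt) (differentiableAt_inv h0)
  fun_prop

lemma ne_zero_of_re {s : ℂ} (h : 0 < s.re) : s ≠ 0 := by
  rintro rfl; simp at h

lemma X_eq_Zf {s : ℂ} (h : 0 < s.re) : X (s - 1 / 2) = Zf s * s * Gammaℝ s := by
  have h0 := ne_zero_of_re h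
  have h1 := Gammaℝ_ne_zero_of_re_pos h
  unfold Zf
  field_simp

lemma T_floor {s : ℂ} (h : 1 < s.re) : T (fun x => (⌊x⌋₊ : ℝ)) s = riemannZeta s / s := by
  have h0 : s ≠ 0 := ne_zero_of_re (by linarith)
  have := LSeries_eq_mul_integral_of_nonneg (fun _ => 1) (r := 1) zero_le_one h ?_ (by simp)
  · rw [eq_div_iff h0, mul_comm, ← LSeries_one_eq_riemannZeta h]
    have e : LSeries 1 s = LSeries (fun n ↦ ((1:ℝ):ℂ)) s := by
      congr 1
    rw [e, this]
    unfold T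
    simp
  · simp
    exact Asymptotics.isBigO_refl _ _

lemma intAt_fract {σ : ℝ} (h : 0 < σ) : IntAt (fun x => Int.fract x) σ := by
  refine intAt_of_bound (C := 1) (a := 0) ?_ ?_ h
  · exact measurable_fract.aestronglyMeasurable
  · intro x hx
    rw [abs_of_nonneg (Int.fract_nonneg x)]
    simp [(Int.fract_lt_one x).le]

lemma Zf_fract {s : ℂ} (h : 0 < s.re) : Zf s = s - s * (s - 1) * T (fun x => Int.fract x) s := by
  have hd := T_diff (a := 0) (N := fun x => Int.fract x) (fun σ hσ => intAt_fract hσ)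
  have key := eq_on_half (a := 0) (b := 1) (F := Zf) (G := fun s => s - s * (s - 1) * T (fun x => Int.fract x) s)
    (fun s hs => (Zf_diffAt (ne_zero_of_re hs)).differentiableWithinAt)
    (by
      have hid : DifferentiableOn ℂ (fun s : ℂ => s) {s : ℂ | 0 < s.re} := differentiableOn_id
      fun_prop)
    (by
      intro s hs
      have h0 : s ≠ 0 := ne_zero_of_re (by linarith)
      have h1 : s ≠ 1 := by rintro rfl; simp at hs
      have h1' : s - 1 ≠ 0 := sub_ne_zero.mpr h1
      have e1 : T (fun x => x ^ (1:ℝ) - Int.fract x) s = T (fun x => (⌊x⌋₊ : ℝ)) s := by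
        refine T_congr fun x hx => ?_
        rw [Real.rpow_one, natCast_floor_eq_intCast_floor (by linarith), Int.self_sub_fract]
      rw [T_sub (intAt_rpow hs) (intAt_fract (by linarith)), T_rpow hs, T_floor hs] at e1
      rw [Zf_eq h0 h1]
      push_cast at e1
      have e2 : T (fun x => Int.fract x) s = 1 / (s - 1) - riemannZeta s / s := by rw [← e1]; ring
      rw [e2]
      field_simp
      ring)
  exact key s h


lemma T_ofReal {N : ℝ → ℝ} (σ : ℝ) :
    T N (σ : ℂ) = ((∫ x in Ioi (1:ℝ), N x * x ^ (-(σ + 1)) : ℝ) : ℂ) := by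
  unfold T
  rw [← integral_complex_ofReal]
  refine setIntegral_congr_fun measurableSet_Ioi ?_
  intro x hx
  simp only [mem_Ioi] at hx
  simp only
  rw [Complex.ofReal_mul, Complex.ofReal_cpow (by linarith)]
  push_cast; rfl

lemma T_norm_le {N : ℝ → ℝ} {C a : ℝ} {s : ℂ} (hb : ∀ x, 1 < x → |N x| ≤ C * x ^ a) (h : a < s.re) :
    ‖T N s‖ ≤ C / (s.re - a) := by
  unfold T
  have h1 : IntegrableOn (fun x : ℝ => C * x ^ (a - (s.re + 1))) (Ioi 1) :=
    (integrableOn_Ioi_rpow_of_lt (by linarith) one_pos).const_mul C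
  have h2 : ∫ x in Ioi (1:ℝ), C * x ^ (a - (s.re + 1)) = C / (s.re - a) := by
    rw [integral_const_mul, integral_Ioi_rpow_of_lt (by linarith) one_pos, Real.one_rpow]
    have : a - (s.re + 1) + 1 = -(s.re - a) := by ring
    rw [this, neg_div_neg_eq, mul_one_div]
  rw [← h2]
  refine norm_integral_le_of_norm_le h1 ?_
  filter_upwards [ae_restrict_mem measurableSet_Ioi] with x hx
  simp only [mem_Ioi] at hx
  rw [norm_mul, Complex.norm_cpow_eq_rpow_re_of_pos (by linarith), Complex.norm_real, Real.norm_eq_abs]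
  have e : (-(s + 1)).re = - (s.re + 1) := by simp
  rw [e, Real.rpow_sub (by linarith), Real.rpow_neg (by linarith), ← div_eq_mul_inv, ← mul_div_assoc]
  gcongr
  exact hb x hx

lemma Zf_norm_le {s : ℂ} (h : 1 / 2 ≤ s.re) : ‖Zf s‖ ≤ ‖s‖ + 2 * (‖s‖ * (‖s‖ + 1)) := by
  rw [Zf_fract (by linarith)]
  have h1 : ‖T (fun x => Int.fract x) s‖ ≤ 1 / (s.re - 0) := by
    refine T_norm_le ?_ (by linarith)
    intro x hx
    rw [abs_of_nonneg (Int.fract_nonneg x)]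
    simp [(Int.fract_lt_one x).le]
  have h2 : ‖T (fun x => Int.fract x) s‖ ≤ 2 := by
    refine h1.trans ?_
    rw [sub_zero, div_le_iff₀ (by linarith)]; linarith
  have h3 : ‖s - 1‖ ≤ ‖s‖ + 1 := (norm_sub_le _ _).trans (by simp)
  calc _ ≤ ‖s‖ + ‖s * (s - 1) * T (fun x => Int.fract x) s‖ := norm_sub_le _ _
    _ = ‖s‖ + ‖s‖ * ‖s - 1‖ * ‖T (fun x => Int.fract x) s‖ := by rw [norm_mul, norm_mul]
    _ ≤ ‖s‖ + ‖s‖ * (‖s‖ + 1) * 2 := by gcongr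
    _ = _ := by ring

lemma Zf_real_ne {σ : ℝ} (h : 0 < σ) : Zf σ ≠ 0 := by
  rcases lt_trichotomy σ 1 with h1 | h1 | h1
  · rw [Zf_fract (by simpa using h), T_ofReal]
    have : 0 ≤ ∫ x in Ioi (1:ℝ), Int.fract x * x ^ (-(σ + 1)) := by
      refine setIntegral_nonneg measurableSet_Ioi fun x hx => ?_
      simp only [mem_Ioi] at hx
      have := Int.fract_nonneg x
      positivity
    set J := ∫ x in Ioi (1:ℝ), Int.fract x * x ^ (-(σ + 1))
    have h2 : 0 < σ - σ * (σ - 1) * J := by nlinarith [mul_nonneg (mul_nonneg h.le (sub_nonneg.mpr h1.le)) this]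
    have e : (σ : ℂ) - σ * (σ - 1) * J = ((σ - σ * (σ - 1) * J : ℝ) : ℂ) := by push_cast; ring
    rw [e]
    exact_mod_cast h2.ne'
  · subst h1; simp [Zf_one]
  · rw [Zf_eq (by exact_mod_cast h.ne') (by exact_mod_cast h1.ne')]
    refine mul_ne_zero (sub_ne_zero.mpr (by exact_mod_cast h1.ne')) ?_
    exact riemannZeta_ne_zero_of_one_le_re (by simpa using h1.le)

lemma Zf_ne_of_one_le {s : ℂ} (h : 1 ≤ s.re) : Zf s ≠ 0 := by
  by_cases h1 : s = 1
  · rw [h1, Zf_one]; simp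
  · rw [Zf_eq (ne_zero_of_re (by linarith)) h1]
    exact mul_ne_zero (sub_ne_zero.mpr h1) (riemannZeta_ne_zero_of_one_le_re h)

lemma X_zero_ne : X 0 ≠ 0 := by
  have h := X_eq_Zf (s := 1 / 2) (by norm_num)
  rw [sub_self] at h
  rw [h]
  have := Zf_real_ne (σ := 1 / 2) (by norm_num)
  push_cast at this
  exact mul_ne_zero (mul_ne_zero this (by norm_num)) (Gammaℝ_ne_zero_of_re_pos (by norm_num))

lemma deriv_zeta {s : ℂ} (h : 1 < s.re) : - deriv riemannZeta s / riemannZeta s = 1 / (s - 1) - deriv Zf s / Zf s := by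
  have h0 : s ≠ 0 := ne_zero_of_re (by linarith)
  have h1 : s ≠ 1 := by rintro rfl; simp at h
  have h1' : s - 1 ≠ 0 := sub_ne_zero.mpr h1
  have hz : riemannZeta s ≠ 0 := riemannZeta_ne_zero_of_one_le_re h.le
  have e : Zf =ᶠ[𝓝 s] fun s => (s - 1) * riemannZeta s := by
    filter_upwards [isOpen_ne.mem_nhds h0, isOpen_ne.mem_nhds h1] with w hw hw' using Zf_eq hw hw'
  have hd : HasDerivAt (fun s => (s - 1) * riemannZeta s) (1 * riemannZeta s + (s - 1) * deriv riemannZeta s) s :=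
    ((hasDerivAt_id s).sub_const 1).mul (differentiableAt_riemannZeta h1).hasDerivAt
  rw [e.deriv_eq, hd.deriv, Zf_eq h0 h1]
  field_simp
  ring

open Chebyshev in
lemma T_psi {s : ℂ} (h : 1 < s.re) : T Chebyshev.psi s = (1 / (s - 1) - deriv Zf s / Zf s) / s := by
  have h0 : s ≠ 0 := ne_zero_of_re (by linarith)
  have hsum : ∀ x : ℝ, ∑ k ∈ Finset.Icc 1 ⌊x⌋₊, ArithmeticFunction.vonMangoldt k = psi x := by
    intro x; rfl
  have := LSeries_eq_mul_integral_of_nonneg (fun n => ArithmeticFunction.vonMangoldt n) (r := 1) zero_le_one h ?_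
    (fun n => ArithmeticFunction.vonMangoldt_nonneg)
  · rw [← deriv_zeta h, ← ArithmeticFunction.LSeries_vonMangoldt_eq_deriv_riemannZeta_div h, this, mul_div_cancel_left₀ _ h0]
    unfold T
    congr 1
    ext x
    rw [← hsum]; push_cast; rfl
  · refine Asymptotics.IsBigO.of_bound (Real.log 4 + 4) (Eventually.of_forall fun n => ?_)
    have h1 := hsum (n : ℝ)
    rw [Nat.floor_natCast] at h1
    rw [h1, Real.rpow_one, Real.norm_of_nonneg (psi_nonneg _), Real.norm_of_nonneg (by positivity)]
    exact psi_le_const_mul_self (by positivity)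

lemma intAt_psi {σ : ℝ} (h : 1 < σ) : IntAt Chebyshev.psi σ := by
  refine intAt_of_bound (C := Real.log 4 + 4) (a := 1) ?_ ?_ h
  · exact Chebyshev.psi_mono.measurable.aestronglyMeasurable
  · intro x hx
    rw [abs_of_nonneg (Chebyshev.psi_nonneg _), Real.rpow_one]
    exact Chebyshev.psi_le_const_mul_self (by linarith)

lemma intAt_psi_sub_theta {σ : ℝ} (h : 1 / 2 < σ) :
    IntAt (fun x => Chebyshev.psi x - Chebyshev.theta x) σ := by
  obtain ⟨C, hC⟩ := Chebyshev.psi_sub_theta_le_mul_sqrt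
  refine intAt_of_bound (C := C) (a := 1 / 2) ?_ ?_ h
  · exact (Chebyshev.psi_mono.measurable.sub Chebyshev.theta_mono.measurable).aestronglyMeasurable
  · intro x hx
    rw [abs_of_nonneg (sub_nonneg.mpr (Chebyshev.theta_le_psi x)), ← Real.sqrt_eq_rpow]
    exact hC x

end RHT


namespace RHT
open Set Complex Topology

lemma zf_no_zero {U : Set ℂ} (hU : IsOpen U) (hc : IsPreconnected U) {f q : ℂ → ℂ}
    (hf : DifferentiableOn ℂ f U) (hq : DifferentiableOn ℂ q U)
    (h : ∀ s ∈ U, deriv f s = f s * q s) {s₁ : ℂ} (hs₁ : s₁ ∈ U) (h1 : f s₁ ≠ 0) :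
    ∀ s ∈ U, f s ≠ 0 := by
  intro s hs h0
  have hfa : AnalyticOnNhd ℂ f U := hf.analyticOnNhd hU
  have hqa : AnalyticOnNhd ℂ q U := hq.analyticOnNhd hU
  have hne : analyticOrderAt f s ≠ ⊤ := by
    intro htop
    rw [analyticOrderAt_eq_top] at htop
    have := hfa.eqOn_zero_of_preconnected_of_eventuallyEq_zero hc hs htop
    exact h1 (this hs₁)
  have h2 : deriv f =ᶠ[𝓝 s] f * q := by
    filter_upwards [hU.mem_nhds hs] with w hw using h w hw
  have h3 := analyticOrderAt_congr h2
  rw [analyticOrderAt_mul (hfa s hs) (hqa s hs)] at h3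
  have h4 := (hfa s hs).analyticOrderAt_deriv_add_one
  rw [h0] at h4
  simp only [sub_zero] at h4
  rw [h3] at h4
  obtain ⟨n, hn⟩ := ENat.ne_top_iff_exists.mp hne
  rw [← hn] at h4
  have h5 : (n : ℕ∞) + 1 ≤ n := by
    calc (n : ℕ∞) + 1 ≤ n + analyticOrderAt q s + 1 := by gcongr; exact le_self_add
      _ = n := h4
  have h6 : n + 1 ≤ n := by exact_mod_cast h5
  omega

lemma rh_of_zf (h : ∀ s : ℂ, 1 / 2 < s.re → Zf s ≠ 0) : RiemannHypothesis := by
  intro s hs htriv h1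
  have h0 : s ≠ 0 := by
    rintro rfl; rw [riemannZeta_zero] at hs; norm_num at hs
  have h1s : (1 : ℂ) - s ≠ 0 := sub_ne_zero.mpr (Ne.symm h1)
  by_contra hne
  rcases lt_or_gt_of_ne hne with hlt | hgt
  · have hG : Gammaℝ s ≠ 0 := by
      intro hG
      obtain ⟨n, hn⟩ := Gammaℝ_eq_zero_iff.mp hG
      rcases n with _ | n
      · apply h0; rw [hn]; simp
      · apply htriv; use n; rw [hn]; push_cast; ring
    have hL : completedRiemannZeta s = 0 := by
      rw [riemannZeta_def_of_ne_zero h0, div_eq_zero_iff] at hs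
      exact hs.resolve_right hG
    have := h (1 - s) (by simp; linarith)
    rw [Zf_eq h1s (by intro h; apply h0; simpa using h), riemannZeta_def_of_ne_zero h1s,
      completedRiemannZeta_one_sub, hL] at this
    simp at this
  · have := h s hgt
    rw [Zf_eq h0 h1, hs] at this
    simp at this

lemma psi_intervalIntegrable (a b : ℝ) : IntervalIntegrable Chebyshev.psi volume a b :=
  Chebyshev.psi_mono.intervalIntegrable

lemma theta_intervalIntegrable (a b : ℝ) : IntervalIntegrable Chebyshev.theta volume a b :=
  Chebyshev.theta_mono.intervalIntegrable

lemma int_one_two : ∀ x : ℝ, x ≤ 2 → 1 ≤ x → ∫ t in (1:ℝ)..x, (t - Chebyshev.theta t) = (x ^ 2 - 1) / 2 := by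
  intro x hx h1
  have : ∫ t in (1:ℝ)..x, (t - Chebyshev.theta t) = ∫ t in (1:ℝ)..x, t := by
    refine intervalIntegral.integral_congr_ae ?_
    have h2 : ∀ᵐ t : ℝ, t ≠ 2 := by simp [ae_iff]
    filter_upwards [h2] with t ht ht'
    rw [uIoc_of_le h1] at ht'
    rw [Chebyshev.theta_eq_zero_of_lt_two (lt_of_le_of_ne (ht'.2.trans hx) ht), sub_zero]
  rw [this, integral_id]; ring

lemma int_split (x : ℝ) : ∫ t in (1:ℝ)..x, (t - Chebyshev.theta t) =
    3 / 2 - ∫ t in (2:ℝ)..x, (Chebyshev.theta t - t) := by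
  have hi : ∀ a b : ℝ, IntervalIntegrable (fun t => t - Chebyshev.theta t) volume a b := fun a b =>
    intervalIntegral.intervalIntegrable_id.sub (theta_intervalIntegrable a b)
  rw [← intervalIntegral.integral_add_adjacent_intervals (hi 1 2) (hi 2 x), int_one_two 2 le_rfl (by norm_num)]
  have : ∫ t in (2:ℝ)..x, (t - Chebyshev.theta t) = -∫ t in (2:ℝ)..x, (Chebyshev.theta t - t) := by
    rw [← intervalIntegral.integral_neg]
    congr 1; ext t; ring
  rw [this]; ring

lemma rh_of_neg (h : ∀ x : ℝ, x > 2 → (∫ t in (2:ℝ)..x, (Chebyshev.theta t - t)) < 0) :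
    RiemannHypothesis := by
  set φ : ℝ → ℝ := fun t => t - Chebyshev.theta t with hφ
  set N : ℝ → ℝ := fun x => (∫ t in (1:ℝ)..x, φ t) / x with hN
  set D : ℂ → ℂ := T (fun x => Chebyshev.psi x - Chebyshev.theta x) with hD
  have hφe : ∀ x, 1 < x → (x ^ (1:ℝ) - Chebyshev.psi x) + (Chebyshev.psi x - Chebyshev.theta x) = φ x := by
    intro x hx; rw [Real.rpow_one, hφ]; ring
  have hφi : ∀ σ, 1 < σ → IntAt φ σ := fun σ hσ =>
    (((intAt_rpow hσ).sub (intAt_psi hσ)).add (intAt_psi_sub_theta (by linarith))).congr hφe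
  have hNn : ∀ x, 1 < x → 0 ≤ N x := by
    intro x hx
    refine div_nonneg ?_ (by linarith)
    rcases le_or_gt x 2 with h2 | h2
    · rw [int_one_two x h2 hx.le]; nlinarith
    · rw [int_split]; linarith [h x h2]
  have hNi : ∀ σ, 1 < σ → IntAt N σ := fun σ hσ => byparts_int (by linarith) (hφi σ hσ)
  have hDd : DifferentiableOn ℂ D {s | 1 / 2 < s.re} := T_diff (fun σ hσ => intAt_psi_sub_theta hσ)
  have hZd : DifferentiableOn ℂ Zf {s | 1 / 2 < s.re} := fun s hs =>
    (Zf_diffAt (ne_zero_of_re (by simp at hs; linarith))).differentiableWithinAt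
  have hZd' : DifferentiableOn ℂ (deriv Zf) {s | 1 / 2 < s.re} := hZd.deriv (isOpen_re _)
  set W : ℂ → ℂ := fun s => (Zf s + deriv Zf s + s * Zf s * D s) / (s * (s + 1)) with hW
  have hs0 : ∀ s : ℂ, 1 / 2 < s.re → s ≠ 0 ∧ s + 1 ≠ 0 := fun s hs =>
    ⟨ne_zero_of_re (by linarith), ne_zero_of_re (by simp; linarith)⟩
  have hid : DifferentiableOn ℂ (fun s : ℂ => s) {s : ℂ | 1 / 2 < s.re} := differentiableOn_id
  have hWd : DifferentiableOn ℂ W {s | 1 / 2 < s.re} := by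
    refine DifferentiableOn.div (by fun_prop) (by fun_prop) fun s hs => mul_ne_zero (hs0 s hs).1 (hs0 s hs).2
  have hTN : ∀ s : ℂ, 1 < s.re → Zf s * T N s = W s := by
    intro s hs
    obtain ⟨h0, h1⟩ := hs0 s (by linarith)
    have hs1 : s - 1 ≠ 0 := sub_ne_zero.mpr (by rintro rfl; simp at hs)
    have hz := Zf_ne_of_one_le hs.le
    have e := byparts_T (φ := φ) (by linarith) (hφi _ hs)
    rw [hN, e, ← T_congr hφe, T_add ((intAt_rpow hs).sub (intAt_psi hs)) (intAt_psi_sub_theta (by linarith)),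
      T_sub (intAt_rpow hs) (intAt_psi hs), T_rpow hs, T_psi hs, hW, ← hD]
    push_cast
    field_simp
    ring
  have hNi' := landau hNn hNi hWd hZd (fun σ hσ => Zf_real_ne (by linarith)) hTN
  have hid2 := landau_id hNi' hWd hZd hTN
  apply rh_of_zf
  refine zf_no_zero (U := {s | 1 / 2 < s.re}) (q := fun s => s * (s + 1) * T N s - 1 - s * D s)
    (isOpen_re _) (convex_halfSpace_re_gt _).isPreconnected hZd ?_ ?_ (s₁ := 1) (by simp; norm_num) (by simp [Zf_one])
  · have := T_diff hNi'
    fun_prop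
  · intro s hs
    obtain ⟨h0, h1⟩ := hs0 s hs
    have := hid2 s hs
    have e : Zf s * (s * (s + 1) * T N s - 1 - s * D s) = s * (s + 1) * (Zf s * T N s) - Zf s - s * Zf s * D s := by ring
    rw [e, this, hW]
    field_simp
    ring

end RHT


namespace RHT
open Set Complex Topology

lemma norm_Gamma_le {s : ℂ} (h : 0 < s.re) : ‖Complex.Gamma s‖ ≤ Real.Gamma s.re := by
  rw [Complex.Gamma_eq_integral h, Real.Gamma_eq_integral h, Complex.GammaIntegral]
  refine norm_integral_le_of_norm_le (Real.GammaIntegral_convergent h) ?_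
  filter_upwards [ae_restrict_mem measurableSet_Ioi] with x hx
  simp only [mem_Ioi] at hx
  rw [norm_mul, Complex.norm_cpow_eq_rpow_re_of_pos hx, Complex.norm_real, Real.norm_of_nonneg (Real.exp_pos _).le]
  simp

lemma real_Gamma_le {y : ℝ} (h : 1 / 4 ≤ y) : Real.Gamma y ≤ 16 * Real.exp (2 * (y + 2) ^ (3 / 2 : ℝ)) := by
  have h0 : 0 < y := by linarith
  set n := ⌈y⌉₊ with hn
  have hy : y ≤ n := Nat.le_ceil y
  have hny : (n : ℝ) + 1 ≤ y + 2 := by have := Nat.ceil_lt_add_one h0.le; linarith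
  have h1 : Real.Gamma (y + 1 + 1) ≤ (n + 1).factorial := by
    have : Real.Gamma (y + 1 + 1) ≤ Real.Gamma (((n + 1 : ℕ) : ℝ) + 1) := by
      apply Real.Gamma_strictMonoOn_Ici.monotoneOn
      · have : 0 < n := Nat.ceil_pos.mpr h0
        have : (1:ℝ) ≤ n := by exact_mod_cast this
        simp only [mem_Ici]
        by_cases hy1 : 0 ≤ y
        · linarith
        · linarith
      · simp
        have : 0 < n := Nat.ceil_pos.mpr h0
        have : (1:ℝ) ≤ n := by exact_mod_cast this
        linarith
      · push_cast; linarith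
    rwa [Real.Gamma_nat_eq_factorial] at this
  have h2 : Real.Gamma (y + 1 + 1) = (y + 1) * (y * Real.Gamma y) := by
    rw [Real.Gamma_add_one (by linarith), Real.Gamma_add_one (by linarith)]
  have hG := Real.Gamma_pos_of_pos h0
  have h3 : Real.Gamma y ≤ 16 * Real.Gamma (y + 1 + 1) := by
    rw [h2]
    have : 1 ≤ 16 * ((y + 1) * y) := by nlinarith
    nlinarith
  have h4 : ((n + 1).factorial : ℝ) ≤ Real.exp (2 * (y + 2) ^ (3 / 2 : ℝ)) := by
    have e1 : ((n + 1).factorial : ℝ) ≤ ((n:ℝ) + 1) ^ (n + 1) := by exact_mod_cast Nat.factorial_le_pow (n + 1)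
    have hp : (0:ℝ) < (n:ℝ) + 1 := by positivity
    have e2 : ((n:ℝ) + 1) ^ (n + 1) = Real.exp (((n:ℝ) + 1) * Real.log ((n:ℝ) + 1)) := by
      rw [mul_comm, Real.exp_mul, Real.exp_log hp]
      exact_mod_cast rfl
    have e3 : Real.log ((n:ℝ) + 1) ≤ 2 * ((n:ℝ) + 1) ^ (1 / 2 : ℝ) := by
      have := Real.log_le_rpow_div hp.le (ε := 1 / 2) (by norm_num)
      linarith
    rw [e2] at e1
    refine e1.trans (Real.exp_le_exp.mpr ?_)
    calc ((n:ℝ) + 1) * Real.log ((n:ℝ) + 1) ≤ ((n:ℝ) + 1) * (2 * ((n:ℝ) + 1) ^ (1 / 2 : ℝ)) := by gcongr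
      _ = 2 * ((n:ℝ) + 1) ^ (3 / 2 : ℝ) := by
        have : (3 / 2 : ℝ) = 1 + 1 / 2 := by norm_num
        rw [this, Real.rpow_add hp, Real.rpow_one]; ring
      _ ≤ 2 * (y + 2) ^ (3 / 2 : ℝ) := by gcongr
  linarith

lemma norm_Gammaℝ_le {s : ℂ} (h : 0 < s.re) : ‖Gammaℝ s‖ ≤ Real.Gamma (s.re / 2) := by
  rw [Gammaℝ_def, norm_mul, Complex.norm_cpow_eq_rpow_re_of_pos Real.pi_pos]
  have e : (s / 2).re = s.re / 2 := by simp
  have h1 := norm_Gamma_le (s := s / 2) (by rw [e]; linarith)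
  rw [e] at h1
  have h2 : Real.pi ^ (-s / 2).re ≤ 1 := by
    apply Real.rpow_le_one_of_one_le_of_nonpos
    · linarith [Real.pi_gt_three]
    · simp; linarith
  calc _ ≤ 1 * Real.Gamma (s.re / 2) := by gcongr
    _ = _ := one_mul _

lemma X_growth : ∃ C : ℝ, 0 < C ∧ ∀ R : ℝ, 1 ≤ R → ∀ z : ℂ, ‖z‖ ≤ R → ‖X z‖ ≤ Real.exp (C * R ^ (3 / 2 : ℝ)) := by
  refine ⟨10 + 2 * 3 ^ (3 / 2 : ℝ), by positivity, ?_⟩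
  intro R hR
  have main : ∀ z : ℂ, 0 ≤ z.re → ‖z‖ ≤ R → ‖X z‖ ≤ Real.exp ((10 + 2 * 3 ^ (3 / 2 : ℝ)) * R ^ (3 / 2 : ℝ)) := by
    intro z hz hzR
    set s : ℂ := z + 1 / 2 with hs
    have hsre : s.re = z.re + 1 / 2 := by simp [hs]
    have e : X z = Zf s * s * Gammaℝ s := by
      rw [← X_eq_Zf (by rw [hsre]; linarith), hs]; congr 1; ring
    have hsn : ‖s‖ ≤ 2 * R := by
      refine (norm_add_le _ _).trans ?_
      have : ‖(1 / 2 : ℂ)‖ = 1 / 2 := by norm_num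
      rw [this]; linarith
    have h1 := Zf_norm_le (s := s) (by rw [hsre]; linarith)
    have h1' : ‖Zf s‖ ≤ 14 * R ^ 2 := by
      refine h1.trans ?_
      have := norm_nonneg s
      nlinarith
    have h2 := norm_Gammaℝ_le (s := s) (by rw [hsre]; linarith)
    have h3 := real_Gamma_le (y := s.re / 2) (by rw [hsre]; linarith)
    have h4 : s.re / 2 + 2 ≤ 3 * R := by
      have : s.re ≤ ‖s‖ := Complex.re_le_norm s
      linarith
    have h5 : ‖Gammaℝ s‖ ≤ 16 * Real.exp (2 * (3 * R) ^ (3 / 2 : ℝ)) := by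
      refine h2.trans (h3.trans ?_)
      have : 0 ≤ s.re / 2 + 2 := by rw [hsre]; linarith
      gcongr
    have hR32 : R ≤ R ^ (3 / 2 : ℝ) := by
      conv_lhs => rw [← Real.rpow_one R]
      exact Real.rpow_le_rpow_of_exponent_le hR (by norm_num)
    have h6 : 448 * R ^ 3 ≤ Real.exp (10 * R ^ (3 / 2 : ℝ)) := by
      have e1 : (448 : ℝ) ≤ Real.exp 7 := by
        have := Real.exp_one_gt_d9
        have e7 : Real.exp 7 = Real.exp 1 ^ 7 := by rw [← Real.exp_nat_mul]; norm_num
        rw [e7]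
        calc (448:ℝ) ≤ 2.7 ^ 7 := by norm_num
          _ ≤ _ := by gcongr; linarith
      have e2 : R ^ 3 ≤ Real.exp (3 * R) := by
        have : R ≤ Real.exp R := by linarith [Real.add_one_le_exp R]
        calc R ^ 3 ≤ Real.exp R ^ 3 := by gcongr
          _ = _ := by rw [← Real.exp_nat_mul]; norm_num
      calc 448 * R ^ 3 ≤ Real.exp 7 * Real.exp (3 * R) := by gcongr
        _ = Real.exp (7 + 3 * R) := by rw [Real.exp_add]
        _ ≤ _ := by apply Real.exp_le_exp.mpr; linarith
    rw [e, norm_mul, norm_mul]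
    calc ‖Zf s‖ * ‖s‖ * ‖Gammaℝ s‖ ≤ (14 * R ^ 2) * (2 * R) * (16 * Real.exp (2 * (3 * R) ^ (3 / 2 : ℝ))) := by gcongr
      _ = 448 * R ^ 3 * Real.exp (2 * (3 * R) ^ (3 / 2 : ℝ)) := by ring
      _ ≤ Real.exp (10 * R ^ (3 / 2 : ℝ)) * Real.exp (2 * (3 * R) ^ (3 / 2 : ℝ)) := by gcongr
      _ = _ := by
        rw [← Real.exp_add, Real.mul_rpow (by norm_num) (by linarith)]; congr 1; ring
  intro z hz
  rcases le_or_gt 0 z.re with h | h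
  · exact main z h hz
  · rw [← X_even]; exact main (-z) (by simp; linarith) (by simpa using hz)

end RHT


namespace RHT
open Set Complex Topology Metric

lemma zeros_finite {f : ℂ → ℂ} (hf : Differentiable ℂ f) (h0 : f 0 ≠ 0) (R : ℝ) :
    {w : ℂ | ‖w‖ ≤ R ∧ f w = 0}.Finite := by
  by_contra hinf
  have hK : IsCompact (closedBall (0:ℂ) R) := isCompact_closedBall 0 R
  obtain ⟨z, hz, hacc⟩ := Set.Infinite.exists_accPt_of_subset_isCompact (K := closedBall (0:ℂ) R) hinf hK
    (fun w hw => by simpa using hw.1)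
  have hfr : ∃ᶠ w in 𝓝[≠] z, f w = 0 := by
    rw [accPt_iff_frequently_nhdsNE] at hacc
    exact hacc.mono fun w hw => hw.2
  have hfa : AnalyticOnNhd ℂ f univ := hf.differentiableOn.analyticOnNhd isOpen_univ
  have := hfa.eqOn_zero_of_preconnected_of_frequently_eq_zero isPreconnected_univ (mem_univ z) hfr
  exact h0 (this (mem_univ 0))

lemma order_ne_top {f : ℂ → ℂ} (hf : Differentiable ℂ f) (h0 : f 0 ≠ 0) (z : ℂ) : analyticOrderAt f z ≠ ⊤ := by
  intro htop
  rw [analyticOrderAt_eq_top] at htop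
  have hfa : AnalyticOnNhd ℂ f univ := hf.differentiableOn.analyticOnNhd isOpen_univ
  have := hfa.eqOn_zero_of_preconnected_of_eventuallyEq_zero isPreconnected_univ (mem_univ z) htop
  exact h0 (this (mem_univ 0))

lemma divide {g : ℂ → ℂ} (hg : Differentiable ℂ g) (h0 : g 0 ≠ 0) {ρ : ℂ} (hρ : ρ ≠ 0) :
    ∃ g' : ℂ → ℂ, Differentiable ℂ g' ∧ g' ρ ≠ 0 ∧
      ∀ w, g w = (1 - w / ρ) ^ (analyticOrderNatAt g ρ) * g' w := by
  have htop := order_ne_top hg h0 ρ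
  have han : AnalyticAt ℂ g ρ := hg.analyticAt ρ
  set n := analyticOrderNatAt g ρ with hn
  have hn' : analyticOrderAt g ρ = n := (Nat.cast_analyticOrderNatAt htop).symm
  obtain ⟨k, hka, hk0, hk⟩ := han.analyticOrderAt_eq_natCast.mp hn'
  have hfac : ∀ w : ℂ, (w - ρ) = (1 - w / ρ) * (-ρ) := by intro w; field_simp; ring
  have hnz : ∀ w : ℂ, w ≠ ρ → (1 - w / ρ) ^ n ≠ 0 := by
    intro w hw
    apply pow_ne_zero
    intro h
    have := hfac w
    rw [h, zero_mul, sub_eq_zero] at this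
    exact hw this
  set g' : ℂ → ℂ := fun w => if w = ρ then (-ρ) ^ n * k ρ else g w / (1 - w / ρ) ^ n with hg'
  have hev : g' =ᶠ[𝓝 ρ] fun w => (-ρ) ^ n * k w := by
    filter_upwards [hk] with w hw
    simp only [hg']
    split_ifs with h
    · rw [h]
    · rw [hw, hfac w, mul_pow, smul_eq_mul]
      have := hnz w h
      field_simp
  refine ⟨g', ?_, ?_, ?_⟩
  · intro w
    by_cases h : w = ρ
    · rw [h]
      exact ((hka.differentiableAt.const_mul _)).congr_of_eventuallyEq hev
    · have : g' =ᶠ[𝓝 w] fun w => g w / (1 - w / ρ) ^ n := by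
        filter_upwards [isOpen_ne.mem_nhds h] with v hv
        simp only [hg', if_neg hv]
      refine DifferentiableAt.congr_of_eventuallyEq ?_ this
      exact (hg w).div (by fun_prop) (hnz w h)
  · simp only [hg', if_true]
    exact mul_ne_zero (pow_ne_zero _ (neg_ne_zero.mpr hρ)) hk0
  · intro w
    by_cases h : w = ρ
    · rw [h]
      have := hk.self_of_nhds
      rw [this, hfac ρ]
      simp only [hg', if_true, smul_eq_mul, mul_pow]
      ring
    · simp only [hg', if_neg h]
      have := hnz w h
      field_simp

lemma extract {f : ℂ → ℂ} (hf : Differentiable ℂ f) (h0 : f 0 ≠ 0) (S : Finset ℂ) (hS : ∀ ρ ∈ S, ρ ≠ 0) :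
    ∃ g : ℂ → ℂ, Differentiable ℂ g ∧ (∀ ρ ∈ S, g ρ ≠ 0) ∧
      ∀ w, f w = (∏ ρ ∈ S, (1 - w / ρ) ^ (analyticOrderNatAt f ρ)) * g w := by
  induction S using Finset.cons_induction with
  | empty => exact ⟨f, hf, by simp, by simp⟩
  | cons ρ S hρS ih =>
    obtain ⟨g, hg, hgS, hfg⟩ := ih (fun r hr => hS r (Finset.mem_cons_of_mem hr))
    have hρ0 : ρ ≠ 0 := hS ρ (Finset.mem_cons_self ρ S)
    have hg0 : g 0 ≠ 0 := by
      intro h; apply h0; rw [hfg 0, h, mul_zero]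
    obtain ⟨g', hg'd, hg'ρ, hgg'⟩ := divide hg hg0 hρ0
    have hord : analyticOrderNatAt g ρ = analyticOrderNatAt f ρ := by
      have hP : AnalyticAt ℂ (fun w => ∏ ρ ∈ S, (1 - w / ρ) ^ (analyticOrderNatAt f ρ)) ρ := by
        apply Differentiable.analyticAt
        fun_prop
      have hP0 : analyticOrderAt (fun w => ∏ ρ ∈ S, (1 - w / ρ) ^ (analyticOrderNatAt f ρ)) ρ = 0 := by
        rw [hP.analyticOrderAt_eq_zero]
        refine Finset.prod_ne_zero_iff.mpr fun r hr => pow_ne_zero _ ?_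
        have hr0 := hS r (Finset.mem_cons_of_mem hr)
        intro h
        have : ρ = r := by
          field_simp at h
          rw [mul_zero] at h
          exact (sub_eq_zero.mp h).symm
        exact hρS (this ▸ hr)
      have e : f = (fun w => ∏ ρ ∈ S, (1 - w / ρ) ^ (analyticOrderNatAt f ρ)) * g := by
        ext w; exact hfg w
      have e2 : analyticOrderAt f ρ = analyticOrderAt g ρ := by
        conv_lhs => rw [e]
        rw [analyticOrderAt_mul hP (hg.analyticAt ρ), hP0, zero_add]
      unfold analyticOrderNatAt
      rw [e2]
    refine ⟨g', hg'd, ?_, ?_⟩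
    · intro r hr
      rcases Finset.mem_cons.mp hr with h | h
      · rw [h]; exact hg'ρ
      · intro h'
        apply hgS r h
        rw [hgg' r, h', mul_zero]
    · intro w
      rw [Finset.prod_cons, hfg w, hgg' w, hord]; ring

/-- Log-derivative oscillation bound for a zero-free function of bounded modulus. -/
lemma zero_free_bound {g : ℂ → ℂ} {R M : ℝ} (hR : 0 < R) (hM : 0 < M)
    (hg : Differentiable ℂ g) (hnz : ∀ w ∈ ball (0:ℂ) R, g w ≠ 0)
    (hb : ∀ w ∈ ball (0:ℂ) R, ‖g w‖ ≤ ‖g 0‖ * Real.exp M) {z : ℂ} (hz : ‖z‖ < R / 4) :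
    ‖logDeriv g z - logDeriv g 0‖ ≤ 64 * M * ‖z‖ / R ^ 2 := by
  have hg' : Differentiable ℂ (deriv g) := hg.deriv
  have hq : DifferentiableOn ℂ (logDeriv g) (ball 0 R) := fun w hw =>
    ((hg' w).div (hg w) (hnz w hw)).differentiableWithinAt
  obtain ⟨L, hL0, hL⟩ := hq.isExactOn_ball.with_val_at 0 0
  have h0m : (0:ℂ) ∈ ball (0:ℂ) R := mem_ball_self hR
  have hexp : ∀ w ∈ ball (0:ℂ) R, g w = g 0 * Complex.exp (L w) := by
    have hconst : ∀ w ∈ ball (0:ℂ) R, g w * Complex.exp (- L w) = g 0 * Complex.exp (- L 0) := by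
      intro w hw
      refine IsOpen.is_const_of_deriv_eq_zero (f := fun w => g w * Complex.exp (- L w)) isOpen_ball
        (convex_ball (0:ℂ) R).isPreconnected ?_ ?_ hw h0m
      · intro v hv
        exact ((hg v).mul ((hL v hv).differentiableAt.neg.cexp)).differentiableWithinAt
      · intro v hv
        have h1 : HasDerivAt (fun w => g w * Complex.exp (- L w))
            (deriv g v * Complex.exp (- L v) + g v * (Complex.exp (- L v) * (- logDeriv g v))) v :=
          (hg v).hasDerivAt.mul ((hL v hv).neg.cexp)
        rw [h1.deriv, logDeriv_apply]
        have := hnz v hv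
        simp only [Pi.zero_apply]
        field_simp
        ring
    intro w hw
    have := hconst w hw
    rw [hL0, neg_zero, Complex.exp_zero, mul_one] at this
    rw [← this, mul_assoc, ← Complex.exp_add]; simp
  have hre : MapsTo L (ball 0 R) {z | z.re ≤ M} := by
    intro w hw
    simp only [mem_ofPred_eq]
    have h1 := hb w hw
    rw [hexp w hw, norm_mul, Complex.norm_exp] at h1
    have h2 : 0 < ‖g 0‖ := norm_pos_iff.mpr (hnz 0 h0m)
    exact Real.exp_le_exp.mp (le_of_mul_le_mul_left h1 h2)
  have hLd : DifferentiableOn ℂ L (ball 0 R) := fun w hw => (hL w hw).differentiableAt.differentiableWithinAt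
  have hLb : ∀ w : ℂ, ‖w‖ ≤ R / 2 → ‖L w‖ ≤ 2 * M := by
    intro w hw
    have h1 := Complex.borelCaratheodory_zero hM hLd hre hR (z := w) (by simp; linarith) hL0
    refine h1.trans ?_
    rw [div_le_iff₀ (by linarith)]
    nlinarith
  have hqb : ∀ w : ℂ, ‖w‖ < R / 4 → ‖logDeriv g w‖ ≤ 2 * M / (R / 4) := by
    intro w hw
    have hwb : w ∈ ball (0:ℂ) R := by simp; linarith
    rw [← (hL w hwb).deriv]
    have hsub : closedBall w (R / 4) ⊆ closedBall 0 (R / 2) := by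
      apply closedBall_subset_closedBall'
      simp; linarith
    refine norm_deriv_le_of_forall_mem_sphere_norm_le (by linarith) ?_ ?_
    · apply DifferentiableOn.diffContOnCl
      rw [closure_ball _ (by linarith)]
      refine hLd.mono (hsub.trans ?_)
      exact closedBall_subset_ball (by linarith)
    · intro v hv
      have := hsub (sphere_subset_closedBall hv)
      exact hLb v (by simpa using this)
  have hmaps : MapsTo (logDeriv g) (ball 0 (R / 4)) (closedBall (logDeriv g 0) (16 * M / R)) := by
    intro w hw
    rw [mem_closedBall, dist_eq_norm]
    have h1 := hqb w (by simpa using hw)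
    have h2 := hqb 0 (by simp; linarith)
    have e : 16 * M / R = 2 * M / (R / 4) + 2 * M / (R / 4) := by field_simp; ring
    rw [e]
    exact (norm_sub_le _ _).trans (add_le_add h1 h2)
  have := dist_le_div_mul_dist_of_mapsTo_ball (hq.mono (ball_subset_ball (by linarith))) hmaps (z := z)
    (by simpa using hz)
  rw [dist_eq_norm, dist_zero_right] at this
  refine this.trans (le_of_eq ?_)
  field_simp
  ring

end RHT


namespace RHT
open Set Complex Topology Metric

/-- zeros of `f` in the closed disc of radius `R` -/
noncomputable def Zs (f : ℂ → ℂ) (R : ℝ) : Finset ℂ := by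
  classical
  exact if h : {w : ℂ | ‖w‖ ≤ R ∧ f w = 0}.Finite then h.toFinset else ∅

lemma mem_Zs {f : ℂ → ℂ} (hf : Differentiable ℂ f) (h0 : f 0 ≠ 0) {R : ℝ} {w : ℂ} :
    w ∈ Zs f R ↔ ‖w‖ ≤ R ∧ f w = 0 := by
  unfold Zs
  rw [dif_pos (zeros_finite hf h0 R)]
  simp

lemma one_le_prod_of_one_le {S : Finset ℂ} {u : ℂ → ℝ} (h : ∀ i ∈ S, 1 ≤ u i) : 1 ≤ ∏ i ∈ S, u i := by
  have := Finset.prod_le_prod (s := S) (f := fun _ => (1:ℝ)) (g := u) (fun _ _ => zero_le_one) h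
  simpa using this

lemma hadamard_bound {f : ℂ → ℂ} (hf : Differentiable ℂ f) (h0 : f 0 ≠ 0) (h0' : deriv f 0 = 0)
    {R B : ℝ} (hR : 0 < R) (hB : ∀ w : ℂ, ‖w‖ = 2 * R → ‖f w‖ ≤ Real.exp B) {M : ℝ} (hM : 0 < M)
    (hMB : B ≤ M + Real.log ‖f 0‖) {z : ℂ} (hz : ‖z‖ < R / 4) (hfz : f z ≠ 0) :
    ‖logDeriv f z - ∑ ρ ∈ Zs f R, (analyticOrderNatAt f ρ : ℂ) * (1 / (z - ρ) + 1 / ρ)‖ ≤ 64 * M * ‖z‖ / R ^ 2 := by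
  have hS0 : ∀ ρ ∈ Zs f R, ρ ≠ 0 := by
    intro ρ hρ h
    rw [mem_Zs hf h0, h] at hρ
    exact h0 hρ.2
  obtain ⟨g, hg, hgS, hfg⟩ := extract hf h0 (Zs f R) hS0
  set P : ℂ → ℂ := fun w => ∏ ρ ∈ Zs f R, (1 - w / ρ) ^ (analyticOrderNatAt f ρ) with hP
  have hPd : Differentiable ℂ P := by rw [hP]; fun_prop
  have hP0 : P 0 = 1 := by simp [hP]
  have hg0 : g 0 = f 0 := by rw [hfg 0]; simp
  have hgnz : ∀ w : ℂ, ‖w‖ ≤ R → g w ≠ 0 := by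
    intro w hw h
    have hf0 : f w = 0 := by rw [hfg w, h, mul_zero]
    exact hgS w ((mem_Zs hf h0).mpr ⟨hw, hf0⟩) h
  have hf0pos : 0 < ‖f 0‖ := norm_pos_iff.mpr h0
  have hgb : ∀ w ∈ closedBall (0:ℂ) (2 * R), ‖g w‖ ≤ Real.exp B := by
    intro w hw
    rw [← closure_ball (0:ℂ) (by linarith : 2 * R ≠ 0)] at hw
    refine norm_le_of_forall_mem_frontier_norm_le isBounded_ball hg.diffContOnCl ?_ hw
    intro v hv
    rw [frontier_ball (0:ℂ) (by linarith : 2 * R ≠ 0)] at hv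
    have hv' : ‖v‖ = 2 * R := by simpa using hv
    have h1 : 1 ≤ ‖P v‖ := by
      rw [hP]
      simp only [norm_prod, norm_pow]
      refine one_le_prod_of_one_le fun ρ hρ => ?_
      apply one_le_pow₀
      have hρR := ((mem_Zs hf h0).mp hρ).1
      have hρ0 : 0 < ‖ρ‖ := norm_pos_iff.mpr (hS0 ρ hρ)
      have h2 : 2 ≤ ‖v / ρ‖ := by
        rw [norm_div, le_div_iff₀ hρ0, hv']; linarith
      have h3 : ‖v / ρ‖ ≤ ‖(1:ℂ)‖ + ‖1 - v / ρ‖ := by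
        have := norm_sub_le (1:ℂ) (1 - v / ρ)
        simpa using this
      rw [norm_one] at h3
      linarith
    have h4 := hB v hv'
    rw [hfg v, norm_mul] at h4
    have h5 : ‖g v‖ ≤ ‖P v‖ * ‖g v‖ := le_mul_of_one_le_left (norm_nonneg _) h1
    exact h5.trans h4
  have hbound := zero_free_bound hR hM hg (fun w hw => hgnz w (by simpa using (mem_ball.mp hw).le))
    (fun w hw => by
      have hw' : ‖w‖ < R := by simpa using hw
      refine (hgb w (by simp; linarith)).trans ?_
      rw [hg0]
      calc Real.exp B ≤ Real.exp (M + Real.log ‖f 0‖) := Real.exp_le_exp.mpr hMB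
        _ = _ := by rw [Real.exp_add, Real.exp_log hf0pos, mul_comm]) hz
  have hlog : ∀ w : ℂ, f w ≠ 0 → ‖w‖ ≤ R → logDeriv f w = (∑ ρ ∈ Zs f R, (analyticOrderNatAt f ρ : ℂ) * (1 / (w - ρ))) + logDeriv g w := by
    intro w hw hwR
    have e : f = fun w => P w * g w := by ext w; exact hfg w
    have hPw : P w ≠ 0 := by
      intro h; apply hw; rw [hfg w]; simp only [hP] at h; rw [h, zero_mul]
    have e1 : logDeriv f w = logDeriv P w + logDeriv g w := by
      conv_lhs => rw [e]
      exact logDeriv_mul w hPw (hgnz w hwR) (hPd w) (hg w)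
    rw [e1, hP, logDeriv_prod]
    · congr 1
      refine Finset.sum_congr rfl fun ρ hρ => ?_
      rw [logDeriv_fun_pow (by fun_prop), logDeriv_apply]
      have hρ0 := hS0 ρ hρ
      have hd : HasDerivAt (fun w : ℂ => 1 - w / ρ) (-(1 / ρ)) w := by
        simpa using ((hasDerivAt_id w).div_const ρ).const_sub 1
      rw [hd.deriv]
      have hwρ : w - ρ ≠ 0 := by
        intro h
        rw [sub_eq_zero.mp h] at hw
        exact hw ((mem_Zs hf h0).mp hρ).2
      have : 1 - w / ρ = -(w - ρ) / ρ := by field_simp; ring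
      rw [this]
      field_simp
    · intro ρ hρ
      exact Finset.prod_ne_zero_iff.mp hPw ρ hρ
    · intro ρ hρ; fun_prop
  have hz1 := hlog z hfz (by linarith)
  have hz0 := hlog 0 h0 (by simp; linarith)
  have hd0 : logDeriv f 0 = 0 := by rw [logDeriv_apply, h0', zero_div]
  rw [hd0] at hz0
  have key : logDeriv f z - ∑ ρ ∈ Zs f R, (analyticOrderNatAt f ρ : ℂ) * (1 / (z - ρ) + 1 / ρ) = logDeriv g z - logDeriv g 0 := by
    have e2 : ∑ ρ ∈ Zs f R, (analyticOrderNatAt f ρ : ℂ) * (1 / (z - ρ) + 1 / ρ) =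
        ∑ ρ ∈ Zs f R, (analyticOrderNatAt f ρ : ℂ) * (1 / (z - ρ)) - ∑ ρ ∈ Zs f R, (analyticOrderNatAt f ρ : ℂ) * (1 / (0 - ρ)) := by
      rw [← Finset.sum_sub_distrib]
      refine Finset.sum_congr rfl fun ρ hρ => ?_
      rw [zero_sub, one_div_neg_eq_neg_one_div]; ring
    rw [e2, hz1]
    linear_combination -hz0
  rw [key]
  exact hbound

lemma hadamard {f : ℂ → ℂ} (hf : Differentiable ℂ f) (h0 : f 0 ≠ 0) (h0' : deriv f 0 = 0)
    (hgr : ∃ C : ℝ, 0 < C ∧ ∀ R : ℝ, 1 ≤ R → ∀ z : ℂ, ‖z‖ ≤ R → ‖f z‖ ≤ Real.exp (C * R ^ (3 / 2 : ℝ)))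
    {z : ℂ} (hfz : f z ≠ 0) :
    Tendsto (fun n : ℕ => ∑ ρ ∈ Zs f n, (analyticOrderNatAt f ρ : ℂ) * (1 / (z - ρ) + 1 / ρ)) atTop
      (𝓝 (logDeriv f z)) := by
  obtain ⟨C, hC, hgr⟩ := hgr
  set c := |Real.log ‖f 0‖| with hc
  have hlim : Tendsto (fun n : ℕ => 64 * (C * 2 ^ (3 / 2 : ℝ) * ((n:ℝ) ^ (3 / 2 : ℝ)) + c) * ‖z‖ / (n:ℝ) ^ 2) atTop (𝓝 0) := by
    have h1 : Tendsto (fun x : ℝ => x ^ (-(1 / 2) : ℝ)) atTop (𝓝 0) := tendsto_rpow_neg_atTop (by norm_num)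
    have h2 : Tendsto (fun x : ℝ => x ^ (-2 : ℝ)) atTop (𝓝 0) := tendsto_rpow_neg_atTop (by norm_num)
    have h3 := ((h1.const_mul (64 * ‖z‖ * (C * 2 ^ (3 / 2 : ℝ)))).add (h2.const_mul (64 * ‖z‖ * c))).comp (tendsto_natCast_atTop_atTop (R := ℝ))
    simp only [mul_zero, add_zero] at h3
    refine h3.congr' ?_
    filter_upwards [eventually_gt_atTop 0] with n hn
    have hn' : (0:ℝ) < n := by exact_mod_cast hn
    simp only [Function.comp]
    have e1 : (n:ℝ) ^ (-(1 / 2) : ℝ) = (n:ℝ) ^ (3 / 2 : ℝ) / (n:ℝ) ^ 2 := by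
      rw [← Real.rpow_natCast, ← Real.rpow_sub hn']; norm_num
    have e2 : (n:ℝ) ^ (-2 : ℝ) = 1 / (n:ℝ) ^ 2 := by
      rw [Real.rpow_neg hn'.le, ← Real.rpow_natCast, one_div]; norm_num
    rw [e1, e2]
    field_simp
  rw [tendsto_iff_norm_sub_tendsto_zero]
  refine squeeze_zero' (Eventually.of_forall fun n => norm_nonneg _) ?_ hlim
  obtain ⟨n₀, hn₀⟩ := exists_nat_gt (4 * ‖z‖)
  filter_upwards [eventually_ge_atTop n₀, eventually_gt_atTop 0] with n hn hn1
  have hn' : (1:ℝ) ≤ n := by exact_mod_cast hn1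
  have hnn : (n₀ : ℝ) ≤ n := by exact_mod_cast hn
  rw [norm_sub_rev]
  refine hadamard_bound hf h0 h0' (R := n) (B := C * (2 * n) ^ (3 / 2 : ℝ)) (by linarith) ?_ ?_ ?_ (by linarith) hfz
  · intro w hw
    exact hgr (2 * n) (by linarith) w hw.le
  · positivity
  · rw [Real.mul_rpow (by norm_num) (by linarith)]
    have : - Real.log ‖f 0‖ ≤ c := neg_le_abs _
    nlinarith

end RHT


namespace RHT
open Set Complex Topology

lemma X_deriv_zero : deriv X 0 = 0 := by
  have h1 : HasDerivAt X (deriv X 0) 0 := (X_diff 0).hasDerivAt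
  have h2 : HasDerivAt (fun z => X (-z)) (deriv X 0 * (-1)) 0 := by
    have h1' : HasDerivAt X (deriv X 0) (-0) := by simpa using h1
    exact h1'.comp (0:ℂ) (hasDerivAt_neg (0:ℂ))
  have h3 : (fun z => X (-z)) = X := funext X_even
  rw [h3] at h2
  have := h1.unique h2
  have h4 : 2 * deriv X 0 = 0 := by linear_combination this
  simpa using h4

lemma rh_zero_aux (hRH : RiemannHypothesis) {w : ℂ} (h : X w = 0) (hw : 0 ≤ w.re) : w.re = 0 := by
  have hs : 0 < (1 / 2 + w).re := by simp; positivity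
  have e := X_eq_Zf hs
  rw [show 1 / 2 + w - 1 / 2 = w by ring, h] at e
  have h0 := ne_zero_of_re hs
  have hG := Gammaℝ_ne_zero_of_re_pos hs
  have hZ : Zf (1 / 2 + w) = 0 := by
    by_contra hne
    exact (mul_ne_zero (mul_ne_zero hne h0) hG) e.symm
  have h1 : (1 / 2 + w) ≠ 1 := by
    intro h1; rw [h1, Zf_one] at hZ; exact one_ne_zero hZ
  rw [Zf_eq h0 h1] at hZ
  have hz : riemannZeta (1 / 2 + w) = 0 := by
    rcases mul_eq_zero.mp hZ with h2 | h2
    · exact absurd (sub_eq_zero.mp h2) h1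
    · exact h2
  have := hRH _ hz (by
    rintro ⟨n, hn⟩
    rw [hn] at hs
    have : ((-2 : ℂ) * (n + 1)).re = -2 * ((n:ℝ) + 1) := by simp
    rw [this] at hs
    have : (0:ℝ) ≤ n := n.cast_nonneg
    linarith) h1
  simpa using this

lemma rh_zero (hRH : RiemannHypothesis) {w : ℂ} (h : X w = 0) : w.re = 0 := by
  rcases le_total 0 w.re with hw | hw
  · exact rh_zero_aux hRH h hw
  · have := rh_zero_aux hRH (w := -w) (by rw [X_even, h]) (by simpa using hw)
    simpa using this

/-- the zeros -/
abbrev ZI := {w : ℂ // X w = 0}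

/-- multiplicity -/
noncomputable def mm (w : ZI) : ℝ := (analyticOrderNatAt X w.1 : ℝ)

/-- ordinates -/
noncomputable def ga (w : ZI) : ℝ := w.1.im

lemma mm_nonneg (w : ZI) : 0 ≤ mm w := Nat.cast_nonneg _

instance : Countable ZI := by
  have : {w : ℂ | X w = 0} ⊆ ⋃ n : ℕ, ((Zs X n : Finset ℂ) : Set ℂ) := by
    intro w hw
    obtain ⟨n, hn⟩ := exists_nat_ge ‖w‖
    exact mem_iUnion.mpr ⟨n, (mem_Zs X_diff X_zero_ne).mpr ⟨hn, hw⟩⟩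
  exact ((countable_iUnion fun n => (Finset.countable_toSet _)).mono this).to_subtype

lemma ZI_eq (hRH : RiemannHypothesis) (w : ZI) : w.1 = ga w * I := by
  apply Complex.ext <;> simp [ga, rh_zero hRH w.2]

lemma ga_ne (hRH : RiemannHypothesis) (w : ZI) : ga w ≠ 0 := by
  intro h
  have := ZI_eq hRH w
  rw [h] at this
  simp at this
  have h2 := w.2
  rw [this] at h2
  exact X_zero_ne h2

lemma term_re {z g : ℝ} (hz : 0 < z) :
    (1 / ((z:ℂ) - g * I) + 1 / (g * I)).re = z / (z ^ 2 + g ^ 2) := by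
  have h1 : (z:ℂ) - g * I ≠ 0 := by
    intro h; have := congrArg Complex.re h; simp at this; exact hz.ne' this
  simp [Complex.add_re, Complex.inv_re, Complex.normSq_apply]
  ring

lemma X_ne (hRH : RiemannHypothesis) {z : ℝ} (hz : 0 < z) : X z ≠ 0 := fun h => by
  have := rh_zero hRH h
  simp at this; exact hz.ne' this

lemma hasSum_zeros (hRH : RiemannHypothesis) {z : ℝ} (hz : 0 < z) :
    HasSum (fun w : ZI => mm w * (z / (z ^ 2 + ga w ^ 2))) (logDeriv X z).re := by
  have hT := hadamard X_diff X_zero_ne X_deriv_zero X_growth (X_ne hRH hz)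
  have hT2 := (Complex.continuous_re.tendsto _).comp hT
  set F : ZI → ℝ := fun w => mm w * (z / (z ^ 2 + ga w ^ 2)) with hF
  have hF0 : ∀ w, 0 ≤ F w := fun w => mul_nonneg (mm_nonneg w) (by positivity)
  let S : ℕ → Finset ZI := fun n => (Zs X n).subtype (fun w => X w = 0)
  have hmem : ∀ n w, w ∈ S n ↔ ‖w.1‖ ≤ n := by
    intro n w
    simp only [S, Finset.mem_subtype, mem_Zs X_diff X_zero_ne]
    exact ⟨fun h => h.1, fun h => ⟨h, w.2⟩⟩
  have hmono : Monotone S := by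
    intro a b hab w
    rw [hmem, hmem]
    intro h; exact h.trans (by exact_mod_cast hab)
  have hS : Tendsto S atTop atTop := by
    apply tendsto_atTop_finset_of_monotone hmono
    intro w
    obtain ⟨n, hn⟩ := exists_nat_ge ‖w.1‖
    exact ⟨n, (hmem n w).mpr hn⟩
  have hT3 : Tendsto (fun n => ∑ w ∈ S n, F w) atTop (𝓝 (logDeriv X z).re) := by
    refine hT2.congr fun n => ?_
    simp only [Function.comp]
    rw [Complex.re_sum]
    rw [← Finset.sum_subtype_of_mem (p := fun w => X w = 0)
      (fun ρ : ℂ => ((analyticOrderNatAt X ρ : ℂ) * (1 / ((z:ℂ) - ρ) + 1 / ρ)).re)]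
    · refine Finset.sum_congr rfl fun w _ => ?_
      have h1 := term_re (g := ga w) hz
      rw [← ZI_eq hRH w] at h1
      rw [hF]
      simp only [mm]
      rw [← h1, ← Complex.ofReal_natCast, Complex.re_ofReal_mul]
    · intro x hx
      exact ((mem_Zs X_diff X_zero_ne).mp hx).2
  have hlub : IsLUB (range fun s : Finset ZI => ∑ w ∈ s, F w) (logDeriv X z).re := by
    have hm2 : Monotone fun n => ∑ w ∈ S n, F w := by
      intro a b hab
      exact Finset.sum_le_sum_of_subset_of_nonneg (hmono hab) fun w _ _ => hF0 w
    have hl := isLUB_of_tendsto_atTop hm2 hT3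
    constructor
    · rintro _ ⟨s, rfl⟩
      obtain ⟨n, hn⟩ := (hS.eventually (eventually_ge_atTop s)).exists
      exact (Finset.sum_le_sum_of_subset_of_nonneg hn fun w _ _ => hF0 w).trans (hl.1 ⟨n, rfl⟩)
    · intro b hb
      apply hl.2
      rintro _ ⟨n, rfl⟩
      exact hb ⟨S n, rfl⟩
  exact hasSum_of_isLUB_of_nonneg _ hF0 hlub

lemma logDeriv_half : logDeriv X (1 / 2) = completedRiemannZeta₀ 1 := by
  have h : HasDerivAt X (completedRiemannZeta₀ 1) (1 / 2) := by
    have h1 : HasDerivAt (fun z : ℂ => completedRiemannZeta₀ (1 / 2 + z))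
        (deriv completedRiemannZeta₀ (1/2+1/2)) (1/2) := by
      have := (differentiable_completedZeta₀ (1/2+1/2)).hasDerivAt
      exact this.comp_const_add (1/2) (1/2)
    have h2 : HasDerivAt (fun z : ℂ => z ^ 2 - 1 / 4) (2 * (1/2)) (1/2) := by
      have := (hasDerivAt_pow 2 (1/2 : ℂ)).sub_const (1/4)
      simpa using this
    have := (h2.mul h1).const_add 1
    refine this.congr_deriv ?_
    norm_num
  rw [logDeriv_apply, h.deriv, X_half, div_one]

/-- the constant `B` -/
noncomputable def Bc : ℝ := 2 + Real.eulerMascheroniConstant - Real.log (4 * Real.pi)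

lemma logDeriv_half_eq : logDeriv X (1 / 2) = ((Bc / 2 : ℝ) : ℂ) := by
  rw [logDeriv_half, completedRiemannZeta₀_one]
  have : Complex.log (4 * (Real.pi : ℂ)) = ((Real.log (4 * Real.pi) : ℝ) : ℂ) := by
    rw [Complex.ofReal_log (by positivity)]; simp
  rw [this]
  simp only [Bc]
  push_cast
  ring

lemma hasSum_B (hRH : RiemannHypothesis) :
    HasSum (fun w : ZI => mm w * (1 / (1 / 4 + ga w ^ 2))) Bc := by
  have h := (hasSum_zeros hRH (z := 1/2) (by norm_num)).mul_left 2
  have e : (logDeriv X ((1/2 : ℝ) : ℂ)).re = Bc / 2 := by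
    rw [show (((1/2 : ℝ)) : ℂ) = 1/2 by push_cast; rfl, logDeriv_half_eq, Complex.ofReal_re]
  rw [e] at h
  have h2 : 2 * (Bc / 2) = Bc := by ring
  rw [h2] at h
  refine h.congr_fun ?_ 
  intro w
  norm_num
  ring

end RHT


namespace RHT
open Set Complex Topology

lemma inv_pow_integrable {n : ℕ} (hn : 2 ≤ n) : IntegrableOn (fun x : ℝ => (x⁻¹) ^ n) (Ioi 1) := by
  have h := integrableOn_Ioi_rpow_of_lt (a := -(n:ℝ)) (c := 1)
    (by have : (2:ℝ) ≤ n := by exact_mod_cast hn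
        linarith) one_pos
  refine h.congr_fun (fun x hx => ?_) measurableSet_Ioi
  have hx0 : (0:ℝ) < x := one_pos.trans hx
  simp only
  rw [Real.rpow_neg hx0.le, Real.rpow_natCast, inv_pow]

lemma bdd_integrable {E : ℝ → ℝ} (hE : ContinuousOn E (Ioi 1)) {D : ℝ}
    (hb : ∀ x, 1 < x → |E x| ≤ D * x ^ 2) {n : ℕ} (hn : 4 ≤ n) :
    IntegrableOn (fun x : ℝ => E x * (x⁻¹) ^ n) (Ioi 1) := by
  have h := (inv_pow_integrable (n := n - 2) (by omega)).const_mul D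
  refine Integrable.mono' h ?_ ?_
  · apply ContinuousOn.aestronglyMeasurable _ measurableSet_Ioi
    apply hE.mul
    exact (continuousOn_inv₀.mono (fun x hx => (one_pos.trans hx).ne')).pow n
  · refine (ae_restrict_mem measurableSet_Ioi).mono fun x hx => ?_
    have hx0 : (0:ℝ) < x := one_pos.trans hx
    rw [norm_mul, Real.norm_eq_abs, Real.norm_eq_abs, abs_of_pos (by positivity : 0 < (x⁻¹) ^ n)]
    calc |E x| * (x⁻¹) ^ n ≤ D * x ^ 2 * (x⁻¹) ^ n := by
          gcongr; exact hb x hx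
      _ = D * (x⁻¹) ^ (n - 2) := by
          obtain ⟨k, rfl⟩ : ∃ k, n = k + 2 := ⟨n - 2, by omega⟩
          simp only [Nat.add_sub_cancel, pow_add]
          field_simp

lemma moment_poly {E : ℝ → ℝ} (hE : ContinuousOn E (Ioi 1)) {D : ℝ}
    (hb : ∀ x, 1 < x → |E x| ≤ D * x ^ 2)
    (hm : ∀ j : ℕ, ∫ x in Ioi (1:ℝ), E x * (x⁻¹) ^ (6 + 2 * j) = 0) (p : Polynomial ℝ) :
    IntegrableOn (fun x : ℝ => E x * (x⁻¹) ^ 6 * p.eval ((x⁻¹) ^ 2)) (Ioi 1) ∧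
    ∫ x in Ioi (1:ℝ), E x * (x⁻¹) ^ 6 * p.eval ((x⁻¹) ^ 2) = 0 := by
  have e : (fun x : ℝ => E x * (x⁻¹) ^ 6 * p.eval ((x⁻¹) ^ 2)) =
      fun x => ∑ i ∈ Finset.range (p.natDegree + 1), p.coeff i * (E x * (x⁻¹) ^ (6 + 2 * i)) := by
    funext x
    rw [Polynomial.eval_eq_sum_range, Finset.mul_sum]
    refine Finset.sum_congr rfl fun i _ => ?_
    rw [pow_add, pow_mul]; ring
  have hi : ∀ i : ℕ, IntegrableOn (fun x : ℝ => p.coeff i * (E x * (x⁻¹) ^ (6 + 2 * i))) (Ioi 1) :=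
    fun i => (bdd_integrable hE hb (by omega)).const_mul _
  rw [e]
  refine ⟨integrable_finset_sum _ fun i _ => hi i, ?_⟩
  rw [integral_finset_sum _ fun i _ => hi i]
  refine Finset.sum_eq_zero fun i _ => ?_
  rw [integral_const_mul, hm i, mul_zero]

lemma moment_unique {E : ℝ → ℝ} (hE : ContinuousOn E (Ici 1)) {D : ℝ}
    (hb : ∀ x, 1 ≤ x → |E x| ≤ D * x ^ 2)
    (hm : ∀ j : ℕ, ∫ x in Ioi (1:ℝ), E x * (x⁻¹) ^ (6 + 2 * j) = 0) :
    ∀ x, 1 < x → E x = 0 := by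
  have hE' : ContinuousOn E (Ioi 1) := hE.mono Ioi_subset_Ici_self
  have hb' : ∀ x, 1 < x → |E x| ≤ D * x ^ 2 := fun x hx => hb x hx.le
  have hD : 0 ≤ D := by
    have := (abs_nonneg _).trans (hb 1 le_rfl)
    simpa using this
  -- the function on [0,1]
  let k : ℝ → ℝ := fun v => E ((Real.sqrt v)⁻¹) * (Real.sqrt v) ^ 3
  have hk : ContinuousOn k (Icc 0 1) := by
    intro v hv
    rcases eq_or_lt_of_le hv.1 with h0 | h0
    · rw [← h0]
      have hk0 : k 0 = 0 := by simp [k]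
      rw [ContinuousWithinAt, hk0]
      have hlim : Tendsto (fun v => D * Real.sqrt v) (𝓝[Icc 0 1] 0) (𝓝 0) := by
        have : Continuous fun v => D * Real.sqrt v := by fun_prop
        have := (this.tendsto 0).mono_left (nhdsWithin_le_nhds (s := Icc (0:ℝ) 1))
        simpa using this
      refine squeeze_zero_norm' ?_ hlim
      filter_upwards [self_mem_nhdsWithin] with u hu
      rcases eq_or_lt_of_le hu.1 with hu0 | hu0
      · rw [← hu0, hk0]; simp
      · have hs : 0 < Real.sqrt u := Real.sqrt_pos.mpr hu0
        have hs1 : Real.sqrt u ≤ 1 := Real.sqrt_le_one.mpr hu.2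
        have h1 : 1 ≤ (Real.sqrt u)⁻¹ := (one_le_inv₀ hs).mpr hs1
        rw [Real.norm_eq_abs, abs_mul, abs_of_pos (by positivity : 0 < Real.sqrt u ^ 3)]
        calc _ ≤ D * (Real.sqrt u)⁻¹ ^ 2 * Real.sqrt u ^ 3 := by gcongr; exact hb _ h1
          _ = D * Real.sqrt u := by field_simp
    · have hs : 0 < Real.sqrt v := Real.sqrt_pos.mpr h0
      have hin : ContinuousWithinAt (fun v => (Real.sqrt v)⁻¹) (Icc 0 1 ∩ Ioi 0) v :=
        (Real.continuous_sqrt.continuousAt.inv₀ hs.ne').continuousWithinAt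
      have hc : ContinuousWithinAt k (Icc 0 1 ∩ Ioi 0) v := by
        apply ContinuousWithinAt.mul
        · refine ContinuousWithinAt.comp (t := Ici 1) (hE _ ?_) hin ?_
          · exact (one_le_inv₀ hs).mpr (Real.sqrt_le_one.mpr hv.2)
          · intro u hu
            exact (one_le_inv₀ (Real.sqrt_pos.mpr hu.2)).mpr (Real.sqrt_le_one.mpr hu.1.2)
        · exact (Real.continuous_sqrt.pow 3).continuousWithinAt
      exact (continuousWithinAt_inter (Ioi_mem_nhds h0)).mp hc
  set W : ℝ := ∫ x in Ioi (1:ℝ), (x⁻¹) ^ 3 with hW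
  have hsqi : IntegrableOn (fun x : ℝ => E x ^ 2 * (x⁻¹) ^ 9) (Ioi 1) := by
    have h3 := (inv_pow_integrable (n := 3) (by norm_num)).const_mul (D ^ 2)
    refine Integrable.mono' h3 ?_ ?_
    · apply ContinuousOn.aestronglyMeasurable _ measurableSet_Ioi
      apply (hE'.pow 2).mul
      exact (continuousOn_inv₀.mono (fun x hx => (one_pos.trans hx).ne')).pow _
    · refine (ae_restrict_mem measurableSet_Ioi).mono fun x hx => ?_
      have hx1 : (1:ℝ) < x := hx
      have hx0 : (0:ℝ) < x := one_pos.trans hx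
      rw [Real.norm_eq_abs, abs_of_nonneg (by positivity), ← sq_abs]
      calc |E x| ^ 2 * (x⁻¹) ^ 9 ≤ (D * x ^ 2) ^ 2 * (x⁻¹) ^ 9 := by gcongr; exact hb' x hx
        _ = D ^ 2 * (x⁻¹) ^ 3 * (x⁻¹) ^ 2 := by field_simp
        _ ≤ D ^ 2 * (x⁻¹) ^ 3 * 1 := by
          gcongr
          exact pow_le_one₀ (by positivity) (inv_le_one_of_one_le₀ hx1.le)
        _ = _ := by ring
  have key : ∀ ε : ℝ, 0 < ε → ∫ x in Ioi (1:ℝ), E x ^ 2 * (x⁻¹) ^ 9 ≤ ε * (D * W) := by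
    intro ε hε
    obtain ⟨p, hp⟩ := exists_polynomial_near_of_continuousOn 0 1 k hk ε hε
    obtain ⟨hpi, hp0⟩ := moment_poly hE' hb' hm p
    have h1 : ∫ x in Ioi (1:ℝ), E x ^ 2 * (x⁻¹) ^ 9 =
        ∫ x in Ioi (1:ℝ), (E x ^ 2 * (x⁻¹) ^ 9 - E x * (x⁻¹) ^ 6 * p.eval ((x⁻¹) ^ 2)) := by
      rw [integral_sub hsqi hpi, hp0, sub_zero]
    rw [h1, hW, ← mul_assoc, ← integral_const_mul]
    refine setIntegral_mono_on (hsqi.sub hpi)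
      ((inv_pow_integrable (n := 3) (by norm_num)).const_mul _) measurableSet_Ioi fun x hx => ?_
    have hx1 : (1:ℝ) < x := hx
    have hx0 : (0:ℝ) < x := one_pos.trans hx
    have hv : (x⁻¹) ^ 2 ∈ Icc (0:ℝ) 1 :=
      ⟨by positivity, pow_le_one₀ (by positivity) (inv_le_one_of_one_le₀ hx1.le)⟩
    have h2 := hp _ hv
    have hkx : k ((x⁻¹) ^ 2) = E x * (x⁻¹) ^ 3 := by
      simp only [k]
      rw [Real.sqrt_sq (by positivity), inv_inv]
    rw [hkx] at h2
    calc E x ^ 2 * (x⁻¹) ^ 9 - E x * (x⁻¹) ^ 6 * p.eval ((x⁻¹) ^ 2)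
        = (E x * (x⁻¹) ^ 6) * -(p.eval ((x⁻¹) ^ 2) - E x * (x⁻¹) ^ 3) := by ring
      _ ≤ |(E x * (x⁻¹) ^ 6) * -(p.eval ((x⁻¹) ^ 2) - E x * (x⁻¹) ^ 3)| := le_abs_self _
      _ = |E x| * (x⁻¹) ^ 6 * |p.eval ((x⁻¹) ^ 2) - E x * (x⁻¹) ^ 3| := by
          rw [abs_mul, abs_mul, abs_neg, abs_of_pos (by positivity : 0 < (x⁻¹) ^ 6)]
      _ ≤ (D * x ^ 2) * (x⁻¹) ^ 6 * ε := by
          gcongr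
          exact hb' x hx
      _ = ε * D * (x⁻¹) ^ 3 * x⁻¹ := by field_simp
      _ ≤ ε * D * (x⁻¹) ^ 3 * 1 := by
          gcongr
          exact inv_le_one_of_one_le₀ hx1.le
      _ = _ := by ring
  have hle : ∫ x in Ioi (1:ℝ), E x ^ 2 * (x⁻¹) ^ 9 ≤ 0 := by
    have hW0 : 0 ≤ D * W := mul_nonneg hD (setIntegral_nonneg measurableSet_Ioi fun x hx => by
      have hx0 : (0:ℝ) < x := one_pos.trans hx
      positivity)
    apply le_of_forall_pos_le_add
    intro δ hδ
    have := key (δ / (D * W + 1)) (by positivity)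
    refine this.trans ?_
    rw [zero_add, div_mul_eq_mul_div, div_le_iff₀ (by positivity)]
    nlinarith
  have hnn : 0 ≤ᵐ[volume.restrict (Ioi (1:ℝ))] fun x => E x ^ 2 * (x⁻¹) ^ 9 := by
    refine (ae_restrict_mem measurableSet_Ioi).mono fun x hx => ?_
    have hx0 : (0:ℝ) < x := one_pos.trans hx
    simp only [Pi.zero_apply]; positivity
  have heq := le_antisymm hle (integral_nonneg_of_ae hnn)
  rw [integral_eq_zero_iff_of_nonneg_ae hnn hsqi] at heq
  have hon := Measure.eqOn_open_of_ae_eq (μ := volume) heq isOpen_Ioi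
    ((hE'.pow 2).mul ((continuousOn_inv₀.mono (fun x hx => (one_pos.trans hx).ne')).pow _)) continuousOn_const
  intro x hx
  have := hon hx
  have hx0 : (0:ℝ) < x := one_pos.trans hx
  simpa [hx0.ne'] using this

end RHT


namespace RHT
open Set Complex Topology

/-- the density of the trivial zeros -/
noncomputable def al (t : ℝ) : ℝ := -(1 / 2) * Real.log (1 - (t⁻¹) ^ 2)

lemma al_arg {t : ℝ} (ht : 1 < t) : 0 < 1 - (t⁻¹) ^ 2 ∧ 1 - (t⁻¹) ^ 2 ≤ 1 := by
  have h0 : 0 < t := by linarith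
  have h1 : t⁻¹ < 1 := inv_lt_one_of_one_lt₀ ht
  have h2 : 0 < t⁻¹ := by positivity
  constructor <;> nlinarith

lemma al_nonneg {t : ℝ} (ht : 1 ≤ t) : 0 ≤ al t := by
  unfold al
  rcases ht.eq_or_lt with rfl | ht
  · simp
  · have := Real.log_nonpos (al_arg ht).1.le (al_arg ht).2
    linarith

/-- primitive -/
noncomputable def Pm (n : ℕ) (v : ℝ) : ℝ :=
  ((∑ i ∈ Finset.range (n + 1), v ^ i) * ((1 - v) * Real.log (1 - v)) +
    ∑ i ∈ Finset.range (n + 1), v ^ (i + 1) / ((i:ℝ) + 1)) / ((n:ℝ) + 1)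

lemma Pm_cont (n : ℕ) : Continuous (Pm n) := by
  unfold Pm
  have h : Continuous fun v : ℝ => (1 - v) * Real.log (1 - v) :=
    Real.continuous_mul_log.comp (continuous_const.sub continuous_id)
  fun_prop

lemma Pm_deriv (n : ℕ) {v : ℝ} (hv : v < 1) :
    HasDerivAt (Pm n) (-(v ^ n * Real.log (1 - v))) v := by
  have e : Pm n = fun v => ((1 - v ^ (n + 1)) * Real.log (1 - v) +
    ∑ i ∈ Finset.range (n + 1), v ^ (i + 1) / ((i:ℝ) + 1)) / ((n:ℝ) + 1) := by
    funext v
    unfold Pm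
    rw [← mul_assoc, geom_sum_mul_neg]
  rw [e]
  have hv' : 1 - v ≠ 0 := by linarith
  have h1 : HasDerivAt (fun v : ℝ => Real.log (1 - v)) (-1 / (1 - v)) v :=
    ((hasDerivAt_id v).const_sub 1).log hv'
  have h2 : HasDerivAt (fun v : ℝ => 1 - v ^ (n + 1)) (-(((n + 1 : ℕ) : ℝ) * v ^ n)) v := by
    have := (hasDerivAt_pow (n + 1) v).const_sub 1
    simpa using this
  have h3 : HasDerivAt (fun v : ℝ => ∑ i ∈ Finset.range (n + 1), v ^ (i + 1) / ((i:ℝ) + 1))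
      (∑ i ∈ Finset.range (n + 1), v ^ i) v := by
    refine HasDerivAt.fun_sum fun i _ => ?_
    have := (hasDerivAt_pow (i + 1) v).div_const ((i:ℝ) + 1)
    refine this.congr_deriv ?_
    have : (i:ℝ) + 1 ≠ 0 := by positivity
    push_cast
    field_simp
  refine (((h2.mul h1).add h3).div_const _).congr_deriv ?_
  have hn : (n:ℝ) + 1 ≠ 0 := by positivity
  have hg : ∑ i ∈ Finset.range (n + 1), v ^ i = (1 - v ^ (n + 1)) / (1 - v) := by
    rw [eq_div_iff hv', geom_sum_mul_neg]
  rw [hg]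
  push_cast
  field_simp
  ring

lemma Pm_one (n : ℕ) : Pm n 1 = (harmonic (n + 1) : ℝ) / (n + 1) := by
  unfold Pm
  simp [harmonic]

lemma Pm_zero (n : ℕ) : Pm n 0 = 0 := by
  unfold Pm
  simp

lemma al_moment (n : ℕ) : IntAt al ((2 * (n + 1) : ℕ) : ℝ) ∧
    ∫ x in Ioi (1:ℝ), al x * x ^ (-(((2 * (n + 1) : ℕ) : ℝ) + 1)) =
      (harmonic (n + 1) : ℝ) / (4 * (n + 1)) := by
  let g : ℝ → ℝ := fun x => -Pm n ((x⁻¹) ^ 2) / 4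
  have hd : ∀ x ∈ Ioi (1:ℝ), HasDerivAt g (al x * x ^ (-(((2 * (n + 1) : ℕ) : ℝ) + 1))) x := by
    intro x hx
    have hx1 : (1:ℝ) < x := hx
    have hx0 : (0:ℝ) < x := by linarith
    have hv : (x⁻¹) ^ 2 < 1 := by linarith [(al_arg hx1).1]
    have h1 : HasDerivAt (fun x : ℝ => (x⁻¹) ^ 2) (2 * x⁻¹ * (-(x ^ 2)⁻¹)) x := by
      refine ((hasDerivAt_inv hx0.ne').fun_pow 2).congr_deriv ?_
      simp
    have h2 := (((Pm_deriv n hv).comp x h1).neg).div_const 4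
    refine h2.congr_deriv ?_
    have e : x ^ (-(((2 * (n + 1) : ℕ) : ℝ) + 1)) = (x⁻¹) ^ (2 * (n + 1) + 1) := by
      rw [Real.rpow_neg hx0.le, inv_pow, ← Real.rpow_natCast]
      push_cast; rfl
    rw [e]
    unfold al
    rw [← pow_mul]
    have : (x^2)⁻¹ = (x⁻¹) ^ 2 := by rw [inv_pow]
    rw [this]
    ring
  have hc : ContinuousWithinAt g (Ici 1) 1 := by
    have h1 : ContinuousAt (fun x : ℝ => (x⁻¹) ^ 2) 1 := (continuousAt_inv₀ one_ne_zero).pow 2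
    have h2 : ContinuousAt (fun x : ℝ => Pm n ((x⁻¹) ^ 2)) 1 :=
      ContinuousAt.comp (f := fun x : ℝ => (x⁻¹) ^ 2) (Pm_cont n).continuousAt h1
    exact (h2.neg.div_const 4).continuousWithinAt
  have hl : Tendsto g atTop (𝓝 0) := by
    have h1 : Tendsto (fun x : ℝ => (x⁻¹) ^ 2) atTop (𝓝 0) := by
      simpa using (tendsto_inv_atTop_zero (𝕜 := ℝ)).pow 2
    have := ((((Pm_cont n).tendsto 0).comp h1).neg).div_const 4
    rw [Pm_zero, neg_zero, zero_div] at this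
    exact this
  have hp : ∀ x ∈ Ioi (1:ℝ), 0 ≤ al x * x ^ (-(((2 * (n + 1) : ℕ) : ℝ) + 1)) := by
    intro x hx
    have hx1 : (1:ℝ) < x := hx
    have := al_nonneg hx1.le
    positivity
  refine ⟨integrableOn_Ioi_deriv_of_nonneg hc hd hp hl, ?_⟩
  rw [integral_Ioi_of_hasDerivAt_of_nonneg hc hd hp hl]
  simp only [g, inv_one, one_pow, Pm_one]
  have hn : (n:ℝ) + 1 ≠ 0 := by positivity
  field_simp
  ring

/-- the function A -/
noncomputable def Af (x : ℝ) : ℝ := ∫ t in (1:ℝ)..x, al t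

lemma Af_nonneg {x : ℝ} (hx : 1 ≤ x) : 0 ≤ Af x :=
  intervalIntegral.integral_nonneg hx fun _ ht => al_nonneg ht.1

/-- explicit form -/
noncomputable def Ae (x : ℝ) : ℝ := x * Real.log x - (1 / 2) * ((x - 1) * Real.log (x - 1)) -
  (1 / 2) * ((x + 1) * Real.log (x + 1))

lemma Ae_cont : Continuous Ae := by
  unfold Ae
  have h := Real.continuous_mul_log
  have h1 : Continuous fun v : ℝ => (v - 1) * Real.log (v - 1) :=
    h.comp (continuous_id.sub continuous_const)
  have h2 : Continuous fun v : ℝ => (v + 1) * Real.log (v + 1) :=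
    h.comp (continuous_id.add continuous_const)
  fun_prop

lemma Ae_deriv {x : ℝ} (hx : 1 < x) : HasDerivAt Ae (al x) x := by
  have h0 : x ≠ 0 := by linarith
  have h1 : x - 1 ≠ 0 := by linarith
  have h2 : x + 1 ≠ 0 := by linarith
  have d0 := Real.hasDerivAt_mul_log h0
  have d1 := (Real.hasDerivAt_mul_log h1).comp_sub_const x 1
  have d2 := (Real.hasDerivAt_mul_log h2).comp_add_const x 1
  refine ((d0.sub (d1.const_mul (1/2))).sub (d2.const_mul (1/2))).congr_deriv ?_
  unfold al
  have : 1 - (x⁻¹) ^ 2 = (x - 1) * (x + 1) / x ^ 2 := by field_simp; ring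
  rw [this, Real.log_div (by positivity) (by positivity), Real.log_mul h1 h2, Real.log_pow]
  push_cast
  ring

lemma al_intervalIntegrable (b : ℝ) (hb : 1 ≤ b) : IntervalIntegrable al volume 1 b := by
  rw [intervalIntegrable_iff_integrableOn_Ioc_of_le hb]
  refine intervalIntegral.integrableOn_deriv_of_nonneg Ae_cont.continuousOn (fun x hx => Ae_deriv hx.1) ?_
  exact fun x hx => al_nonneg hx.1.le

lemma Af_eq {x : ℝ} (hx : 1 ≤ x) : Af x = Ae x + Real.log 2 := by
  unfold Af
  rw [intervalIntegral.integral_eq_sub_of_hasDerivAt_of_le hx Ae_cont.continuousOn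
    (fun t ht => Ae_deriv ht.1) (al_intervalIntegrable x hx)]
  simp [Ae]
  norm_num
  ring

lemma Af_le {x : ℝ} (hx : 1 ≤ x) : Af x ≤ Real.log 2 := by
  rw [Af_eq hx]
  have h := Real.convexOn_mul_log.2 (show x - 1 ∈ Ici (0:ℝ) by simp; linarith)
    (show x + 1 ∈ Ici (0:ℝ) by simp; linarith)
    (show (0:ℝ) ≤ 1/2 by norm_num) (show (0:ℝ) ≤ 1/2 by norm_num) (by norm_num)
  have e : (1/2 : ℝ) • (x - 1) + (1/2 : ℝ) • (x + 1) = x := by simp; ring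
  rw [e] at h
  simp only [smul_eq_mul] at h
  unfold Ae
  linarith

lemma Af_cont : ContinuousOn Af (Ici 1) := by
  have : ContinuousOn (fun x => Ae x + Real.log 2) (Ici 1) := (Ae_cont.add continuous_const).continuousOn
  exact this.congr fun x hx => Af_eq hx

lemma gammaR_hasDeriv (n : ℕ) {s : ℂ} (hs : s / 2 = n + 1) : HasDerivAt Gammaℝ
    (Gammaℝ s * (-(Real.log Real.pi : ℂ) / 2 + (-(Real.eulerMascheroniConstant:ℂ) + harmonic n) / 2)) s := by
  have hG := Complex.hasDerivAt_Gamma_nat n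
  rw [← hs] at hG
  have h0 : HasDerivAt (fun s : ℂ => s / 2) (1 / 2) s := (hasDerivAt_id s).div_const 2
  have h1 : HasDerivAt (fun s : ℂ => Complex.Gamma (s / 2))
      (n.factorial * (-(Real.eulerMascheroniConstant:ℂ) + harmonic n) * (1 / 2)) s :=
    HasDerivAt.comp s hG h0
  have hpi : (Real.pi : ℂ) ≠ 0 := by exact_mod_cast Real.pi_ne_zero
  have h0' : HasDerivAt (fun s : ℂ => -s / 2) (-1 / 2) s := (hasDerivAt_id s).neg.div_const 2
  have h2 : HasDerivAt (fun s : ℂ => (Real.pi : ℂ) ^ (-s / 2))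
      ((Real.pi : ℂ) ^ (-s / 2) * Complex.log Real.pi * (-1 / 2)) s :=
    h0'.const_cpow (c := (Real.pi : ℂ)) (Or.inl hpi)
  have h3 := h2.fun_mul h1
  have e : Gammaℝ = (fun s : ℂ => (Real.pi : ℂ) ^ (-s / 2) * Complex.Gamma (s / 2)) := by
    funext s; rw [Gammaℝ_def]
  rw [← e] at h3
  refine h3.congr_deriv ?_
  rw [Gammaℝ_def, hs, Complex.Gamma_nat_eq_factorial, Complex.ofReal_log Real.pi_pos.le]
  ring

lemma zf_logDeriv (n : ℕ) : deriv Zf ((2 * (n + 1) : ℕ) : ℂ) / Zf ((2 * (n + 1) : ℕ) : ℂ) =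
    logDeriv X (((2 * (n + 1) : ℕ) : ℂ) - 1 / 2) + (Real.log Real.pi : ℂ) / 2
      + (Real.eulerMascheroniConstant : ℂ) / 2 - (harmonic (n + 1) : ℂ) / 2 := by
  set s : ℂ := ((2 * (n + 1) : ℕ) : ℂ) with hs
  have hre : s.re = 2 * ((n:ℝ) + 1) := by rw [hs, Complex.natCast_re]; push_cast; ring
  have hn : (0:ℝ) ≤ n := n.cast_nonneg
  have hs0 : 0 < s.re := by rw [hre]; positivity
  have hZ : Zf s ≠ 0 := Zf_ne_of_one_le (by rw [hre]; linarith)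
  have hsne : s ≠ 0 := ne_zero_of_re hs0
  have hGne := Gammaℝ_ne_zero_of_re_pos hs0
  have hs2 : s / 2 = n + 1 := by rw [hs]; push_cast; ring
  have hGd : DifferentiableAt ℂ Gammaℝ s := by
    exact (gammaR_hasDeriv n hs2).differentiableAt
  have hev : (fun u => X (u - 1 / 2)) =ᶠ[𝓝 s] fun u => Zf u * u * Gammaℝ u := by
    filter_upwards [(isOpen_re 0).mem_nhds hs0] with u hu
    exact X_eq_Zf hu
  have hX : logDeriv (fun u => X (u - 1 / 2)) s = logDeriv X (s - 1 / 2) := by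
    simp only [logDeriv_apply]
    rw [deriv_comp_sub_const]
  have h1 : logDeriv (fun u => X (u - 1 / 2)) s = logDeriv (fun u => Zf u * u * Gammaℝ u) s := by
    simp only [logDeriv_apply]
    rw [hev.deriv_eq, hev.eq_of_nhds]
  have h2 : HasDerivAt (fun u => Zf u * u * Gammaℝ u) _ s :=
    (((Zf_diffAt hsne).hasDerivAt.fun_mul (hasDerivAt_id' s)).fun_mul (gammaR_hasDeriv n hs2))
  have h3 : logDeriv (fun u => Zf u * u * Gammaℝ u) s = deriv Zf s / Zf s + 1 / s +
      (-(Real.log Real.pi : ℂ) / 2 + (-(Real.eulerMascheroniConstant:ℂ) + harmonic n) / 2) := by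
    rw [logDeriv_apply, h2.deriv]
    field_simp
  rw [h3] at h1
  rw [hX] at h1
  rw [h1, harmonic_succ]
  have hs3 : s = 2 * ((n:ℂ) + 1) := by rw [hs]; push_cast; ring
  rw [show 1 / s = 1 / (2 * ((n:ℂ) + 1)) by rw [hs3]]
  push_cast
  have : (n:ℂ) + 1 ≠ 0 := by exact_mod_cast n.succ_ne_zero
  field_simp
  ring

end RHT


namespace RHT
open Set Complex Topology

/-- denominators -/
noncomputable def De (g : ℝ) : ℂ := (1 / 2 + g * I) * (3 / 2 + g * I)

lemma De_norm (g : ℝ) : 1 / 4 + g ^ 2 ≤ ‖De g‖ := by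
  have h1 : ‖(1 / 2 + g * I : ℂ)‖ = Real.sqrt (1 / 4 + g ^ 2) := by
    rw [Complex.norm_def, Complex.normSq_apply]
    congr 1
    simp
    ring
  have h2 : ‖(3 / 2 + g * I : ℂ)‖ = Real.sqrt (9 / 4 + g ^ 2) := by
    rw [Complex.norm_def, Complex.normSq_apply]
    congr 1
    simp
    ring
  unfold De
  rw [norm_mul, h1, h2]
  calc 1 / 4 + g ^ 2 = Real.sqrt (1 / 4 + g ^ 2) * Real.sqrt (1 / 4 + g ^ 2) :=
        (Real.mul_self_sqrt (by positivity)).symm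
    _ ≤ _ := by gcongr; norm_num

lemma De_ne (g : ℝ) : De g ≠ 0 := by
  intro h
  have := De_norm g
  rw [h, norm_zero] at this
  have : 0 ≤ g ^ 2 := sq_nonneg g
  linarith

/-- contribution of a zero -/
noncomputable def Kf (g x : ℝ) : ℝ := (((x:ℂ) ^ (3 / 2 + g * I : ℂ) - 1) / De g).re

lemma Kf_bound (g : ℝ) {x : ℝ} (hx : 1 ≤ x) :
    |Kf g x| ≤ (x ^ (3 / 2 : ℝ) + 1) * (1 / (1 / 4 + g ^ 2)) := by
  unfold Kf
  refine (Complex.abs_re_le_norm _).trans ?_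
  rw [norm_div, div_eq_mul_one_div]
  have hg : 0 < 1 / 4 + g ^ 2 := by positivity
  gcongr
  · refine (norm_sub_le _ _).trans ?_
    rw [Complex.norm_cpow_eq_rpow_re_of_pos (by linarith), norm_one]
    simp
  · exact De_norm g

lemma Kf_cont (g : ℝ) : ContinuousOn (Kf g) (Ici 1) := by
  unfold Kf
  apply Complex.continuous_re.comp_continuousOn
  apply ContinuousOn.div_const
  apply ContinuousOn.sub _ continuousOn_const
  intro x hx
  have hx1 : (1:ℝ) ≤ x := hx
  apply ContinuousAt.continuousWithinAt
  exact ContinuousAt.cpow (f := fun x : ℝ => (x:ℂ)) Complex.continuous_ofReal.continuousAt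
    continuousAt_const (Complex.ofReal_mem_slitPlane.mpr (by linarith))

lemma alg_aux {r s : ℂ} (h1 : r ≠ 0) (h2 : r + 1 ≠ 0) (h3 : s - r ≠ 0) (h4 : s + 1 ≠ 0) (h5 : s ≠ 0) :
    (1 / (s - r) - 1 / (s + 1)) / (r * (r + 1)) = (1 / (s * (s + 1))) * (1 / r + 1 / (s - r)) := by
  field_simp
  ring

lemma Kf_alg {g σ : ℝ} (hσ : 2 < σ) :
    ((1 / ((σ:ℂ) - (1 / 2 + g * I)) - 1 / ((σ:ℂ) + 1)) / De g).re =
      1 / (σ * (σ + 1)) * ((1 / 2) * (1 / (1 / 4 + g ^ 2)) + (σ - 1 / 2) / ((σ - 1 / 2) ^ 2 + g ^ 2)) := by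
  have hne1 : (1 / 2 + g * I : ℂ) ≠ 0 := fun h => De_ne g (by rw [De, h, zero_mul])
  have hne2 : (3 / 2 + g * I : ℂ) ≠ 0 := fun h => De_ne g (by rw [De, h, mul_zero])
  have hne3 : (σ:ℂ) - (1 / 2 + g * I) ≠ 0 := by
    intro h
    have := congrArg Complex.re h
    simp at this
    linarith
  have hne4 : (σ:ℂ) + 1 ≠ 0 := by
    have : σ + 1 ≠ 0 := by linarith
    exact_mod_cast this
  have hne5 : (σ:ℂ) ≠ 0 := by
    have : σ ≠ 0 := by linarith
    exact_mod_cast this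
  have e : (1 / ((σ:ℂ) - (1 / 2 + g * I)) - 1 / ((σ:ℂ) + 1)) / De g =
      ((1 / (σ * (σ + 1)) : ℝ) : ℂ) * (1 / (1 / 2 + g * I) + 1 / (((σ - 1 / 2 : ℝ) : ℂ) - g * I)) := by
    have h6 : ((σ - 1 / 2 : ℝ) : ℂ) - g * I = (σ:ℂ) - (1 / 2 + g * I) := by push_cast; ring
    rw [h6]
    unfold De
    push_cast
    have h7 : (3 / 2 + g * I : ℂ) = (1 / 2 + g * I) + 1 := by ring
    rw [h7] at hne2 ⊢
    exact alg_aux hne1 hne2 hne3 hne4 hne5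
  rw [e, Complex.re_ofReal_mul]
  congr 1
  simp [Complex.add_re, Complex.inv_re, Complex.normSq_apply]
  ring

lemma Kf_moment (g : ℝ) {σ : ℝ} (hσ : 2 < σ) :
    ∫ x in Ioi (1:ℝ), (Kf g x / x) * x ^ (-(σ + 1)) =
      1 / (σ * (σ + 1)) * ((1 / 2) * (1 / (1 / 4 + g ^ 2)) + (σ - 1 / 2) / ((σ - 1 / 2) ^ 2 + g ^ 2)) := by
  set a : ℂ := (1 / 2 + g * I) - σ - 1 with ha
  set b : ℂ := -(σ:ℂ) - 2 with hb
  have hare : a.re < -1 := by simp [ha]; linarith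
  have hbre : b.re < -1 := by simp [hb]; linarith
  have ia : IntegrableOn (fun x : ℝ => (x:ℂ) ^ a) (Ioi 1) := integrableOn_Ioi_cpow_of_lt hare one_pos
  have ib : IntegrableOn (fun x : ℝ => (x:ℂ) ^ b) (Ioi 1) := integrableOn_Ioi_cpow_of_lt hbre one_pos
  have h1 : ∫ x in Ioi (1:ℝ), (Kf g x / x) * x ^ (-(σ + 1)) =
      ∫ x in Ioi (1:ℝ), Complex.reCLM (((x:ℂ) ^ a - (x:ℂ) ^ b) / De g) := by
    refine setIntegral_congr_fun measurableSet_Ioi fun x hx => ?_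
    have hx1 : (1:ℝ) < x := hx
    have hx0 : (0:ℝ) < x := by linarith
    have hxc : (x:ℂ) ≠ 0 := by exact_mod_cast hx0.ne'
    have e1 : x ^ (-(σ + 1)) / x = x ^ (-σ - 2) := by
      rw [show -σ - 2 = -(σ + 1) - 1 by ring, Real.rpow_sub_one hx0.ne']
    have e2 : ((x ^ (-σ - 2) : ℝ) : ℂ) = (x:ℂ) ^ b := by
      rw [Complex.ofReal_cpow hx0.le, hb]; push_cast; rfl
    have e3 : (x:ℂ) ^ a = (x:ℂ) ^ (3 / 2 + g * I : ℂ) * (x:ℂ) ^ b := by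
      rw [← Complex.cpow_add _ _ hxc, ha, hb]; congr 1; ring
    simp only [Complex.reCLM_apply]
    rw [e3, ← e2, ← e1]
    unfold Kf
    have e4 : ((x:ℂ) ^ (3 / 2 + g * I : ℂ) * ((x ^ (-(σ + 1)) / x : ℝ) : ℂ) - ((x ^ (-(σ + 1)) / x : ℝ) : ℂ)) / De g =
      ((x ^ (-(σ + 1)) / x : ℝ) : ℂ) * (((x:ℂ) ^ (3 / 2 + g * I : ℂ) - 1) / De g) := by ring
    rw [e4, Complex.re_ofReal_mul]
    ring
  have iab : Integrable (fun x : ℝ => ((x:ℂ) ^ a - (x:ℂ) ^ b) / De g) (volume.restrict (Ioi 1)) :=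
    (ia.sub ib).div_const _
  rw [h1, Complex.reCLM.integral_comp_comm iab, integral_div,
    integral_sub ia ib, integral_Ioi_cpow_of_lt hare one_pos, integral_Ioi_cpow_of_lt hbre one_pos,
    ← Kf_alg hσ]
  simp only [Complex.reCLM_apply, Complex.ofReal_one, Complex.one_cpow]
  congr 2
  have e1 : a + 1 = -((σ:ℂ) - (1 / 2 + g * I)) := by rw [ha]; ring
  have e2 : b + 1 = -((σ:ℂ) + 1) := by rw [hb]; ring
  rw [e1, e2, neg_div_neg_eq, neg_div_neg_eq]

/-- sum over zeros -/
noncomputable def Sf (x : ℝ) : ℝ := ∑' w : ZI, mm w * Kf (ga w) x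

lemma Sf_term (w : ZI) {x : ℝ} (hx : 1 ≤ x) :
    |mm w * Kf (ga w) x| ≤ (x ^ (3 / 2 : ℝ) + 1) * (mm w * (1 / (1 / 4 + ga w ^ 2))) := by
  rw [abs_mul, abs_of_nonneg (mm_nonneg w)]
  have := mul_le_mul_of_nonneg_left (Kf_bound (ga w) hx) (mm_nonneg w)
  linarith

lemma Sf_summable (hRH : RiemannHypothesis) {x : ℝ} (hx : 1 ≤ x) :
    Summable (fun w : ZI => mm w * Kf (ga w) x) :=
  Summable.of_norm_bounded ((hasSum_B hRH).summable.mul_left (x ^ (3 / 2 : ℝ) + 1)) fun w => by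
    rw [Real.norm_eq_abs]; exact Sf_term w hx

lemma Sf_bound (hRH : RiemannHypothesis) {x : ℝ} (hx : 1 ≤ x) :
    |Sf x| ≤ (x ^ (3 / 2 : ℝ) + 1) * Bc := by
  have h := (hasSum_B hRH).mul_left (x ^ (3 / 2 : ℝ) + 1)
  have := tsum_of_norm_bounded h fun w => by
    rw [Real.norm_eq_abs]; exact Sf_term w hx
  exact this

lemma Sf_cont (hRH : RiemannHypothesis) : ContinuousOn Sf (Ici 1) := by
  have h : ContinuousOn (fun x : ℝ => ∑' w : ZI, (mm w * Kf (ga w) x) * (x ^ (3 / 2 : ℝ))⁻¹) (Ici 1) := by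
    refine continuousOn_tsum (u := fun w => 2 * (mm w * (1 / (1 / 4 + ga w ^ 2)))) ?_
      ((hasSum_B hRH).summable.mul_left 2) ?_
    · intro w
      apply ContinuousOn.mul (continuousOn_const.mul (Kf_cont _))
      apply ContinuousOn.inv₀
      · exact (Real.continuous_rpow_const (by norm_num)).continuousOn
      · intro x hx
        have hx1 : (1:ℝ) ≤ x := hx
        positivity
    · intro w x hx
      have hx1 : (1:ℝ) ≤ x := hx
      have h1 : 1 ≤ x ^ (3 / 2 : ℝ) := Real.one_le_rpow hx1 (by norm_num)
      rw [Real.norm_eq_abs, abs_mul, abs_of_nonneg (by positivity : 0 ≤ (x ^ (3 / 2 : ℝ))⁻¹),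
        ← div_eq_mul_inv, div_le_iff₀ (by positivity)]
      refine (Sf_term w hx1).trans ?_
      have : 0 ≤ mm w * (1 / (1 / 4 + ga w ^ 2)) := mul_nonneg (mm_nonneg w) (by positivity)
      nlinarith
  have h2 : ContinuousOn (fun x : ℝ => x ^ (3 / 2 : ℝ)) (Ici 1) :=
    (Real.continuous_rpow_const (by norm_num)).continuousOn
  refine (h.mul h2).congr fun x hx => ?_
  have hx1 : (1:ℝ) ≤ x := hx
  simp only [Pi.mul_apply]
  rw [tsum_mul_right, Sf]
  have : x ^ (3 / 2 : ℝ) ≠ 0 := by positivity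
  field_simp

lemma x32_le {x : ℝ} (hx : 1 ≤ x) : x ^ (3 / 2 : ℝ) + 1 ≤ 2 * x ^ (3 / 2 : ℝ) := by
  have h1 : 1 ≤ x ^ (3 / 2 : ℝ) := Real.one_le_rpow hx (by norm_num)
  linarith

lemma Kf_div_bound (g : ℝ) {x : ℝ} (hx : 1 < x) :
    |Kf g x / x| ≤ (2 * (1 / (1 / 4 + g ^ 2))) * x ^ (1 / 2 : ℝ) := by
  have hx0 : 0 < x := by linarith
  rw [abs_div, abs_of_pos hx0, div_le_iff₀ hx0]
  refine (Kf_bound g hx.le).trans ?_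
  have e : x ^ (1 / 2 : ℝ) * x = x ^ (3 / 2 : ℝ) := by
    rw [← Real.rpow_add_one hx0.ne']; norm_num
  have : 0 ≤ 1 / (1 / 4 + g ^ 2) := by positivity
  calc _ ≤ (2 * x ^ (3 / 2 : ℝ)) * (1 / (1 / 4 + g ^ 2)) := by gcongr; exact x32_le hx.le
    _ = _ := by rw [← e]; ring

lemma Kf_intAt (g : ℝ) {σ : ℝ} (hσ : 2 < σ) : IntAt (fun x => Kf g x / x) σ := by
  refine intAt_of_bound (a := 1 / 2) ?_ (fun x hx => Kf_div_bound g hx) (by linarith)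
  apply ContinuousOn.aestronglyMeasurable _ measurableSet_Ioi
  exact ((Kf_cont g).mono Ioi_subset_Ici_self).div continuousOn_id (fun x hx => (one_pos.trans hx).ne')

lemma Sf_moment (hRH : RiemannHypothesis) {σ : ℝ} (hσ : 2 < σ) :
    ∫ x in Ioi (1:ℝ), (Sf x / x) * x ^ (-(σ + 1)) =
      1 / (σ * (σ + 1)) * (Bc / 2 + (logDeriv X ((σ - 1 / 2 : ℝ) : ℂ)).re) := by
  let F : ZI → ℝ → ℝ := fun w x => mm w * ((Kf (ga w) x / x) * x ^ (-(σ + 1)))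
  have hFi : ∀ w, Integrable (F w) (volume.restrict (Ioi 1)) := fun w =>
    Integrable.const_mul (Kf_intAt (ga w) hσ) (mm w)
  set J : ℝ := ∫ x in Ioi (1:ℝ), x ^ (1 / 2 : ℝ) * x ^ (-(σ + 1)) with hJ
  have hFs : Summable fun w => ∫ x in Ioi (1:ℝ), ‖F w x‖ := by
    refine Summable.of_nonneg_of_le (fun w => integral_nonneg fun _ => norm_nonneg _) ?_
      ((hasSum_B hRH).summable.mul_left (2 * J))
    intro w
    have e : 2 * J * (mm w * (1 / (1 / 4 + ga w ^ 2))) = ∫ x in Ioi (1:ℝ),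
      (2 * (mm w * (1 / (1 / 4 + ga w ^ 2)))) * (x ^ (1 / 2 : ℝ) * x ^ (-(σ + 1))) := by
      rw [integral_const_mul, ← hJ]; ring
    rw [e]
    refine setIntegral_mono_on (hFi w).norm (Integrable.const_mul (intAt_rpow (a := 1/2) (σ := σ) (by linarith)) _)
      measurableSet_Ioi fun x hx => ?_
    have hx1 : (1:ℝ) < x := hx
    simp only [F]
    rw [norm_mul, norm_mul, Real.norm_eq_abs, Real.norm_eq_abs, Real.norm_eq_abs,
      abs_of_nonneg (mm_nonneg w), abs_of_nonneg (by positivity : 0 ≤ x ^ (-(σ + 1)))]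
    calc _ ≤ mm w * (((2 * (1 / (1 / 4 + ga w ^ 2))) * x ^ (1 / 2 : ℝ)) * x ^ (-(σ + 1))) := by
          have := mm_nonneg w
          gcongr
          exact Kf_div_bound _ hx1
      _ = _ := by ring
  have hs := hasSum_integral_of_summable_integral_norm hFi hFs
  have e1 : ∫ x in Ioi (1:ℝ), ∑' w, F w x = ∫ x in Ioi (1:ℝ), (Sf x / x) * x ^ (-(σ + 1)) := by
    refine setIntegral_congr_fun measurableSet_Ioi fun x _ => ?_
    simp only [F, Sf]
    rw [div_eq_mul_inv, ← tsum_mul_right, ← tsum_mul_right]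
    congr 1
    funext w
    ring
  rw [e1] at hs
  have hs2 := (((hasSum_B hRH).mul_left (1/2)).add
    (hasSum_zeros hRH (z := σ - 1/2) (by linarith))).mul_left (1 / (σ * (σ + 1)))
  have e2 : (fun w => ∫ x in Ioi (1:ℝ), F w x) = fun w : ZI => 1 / (σ * (σ + 1)) *
      (1 / 2 * (mm w * (1 / (1 / 4 + ga w ^ 2))) +
        mm w * ((σ - 1 / 2) / ((σ - 1 / 2) ^ 2 + ga w ^ 2))) := by
    funext w
    simp only [F]
    rw [integral_const_mul, Kf_moment _ hσ]
    ring
  rw [e2] at hs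
  rw [hs.unique hs2]
  ring

end RHT


namespace RHT
open Set Complex Topology

/-- integrated psi -/
noncomputable def psi1 (x : ℝ) : ℝ := ∫ t in (1:ℝ)..x, Chebyshev.psi t

/-- error in the explicit formula -/
noncomputable def Er (x : ℝ) : ℝ :=
  psi1 x - (x ^ 2 - 1) / 2 + Sf x + Real.log (2 * Real.pi) * (x - 1) - Af x

lemma psi1_bound {x : ℝ} (hx : 1 ≤ x) : |psi1 x| ≤ (Real.log 4 + 4) * x ^ 2 := by
  have hc : 0 ≤ Real.log 4 + 4 := by
    have := Real.log_nonneg (show (1:ℝ) ≤ 4 by norm_num)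
    linarith
  have h1 : 0 ≤ psi1 x := intervalIntegral.integral_nonneg hx fun _ _ => Chebyshev.psi_nonneg _
  rw [abs_of_nonneg h1]
  have h2 : psi1 x ≤ ∫ t in (1:ℝ)..x, (Real.log 4 + 4) * x := by
    refine intervalIntegral.integral_mono_on hx (psi_intervalIntegrable _ _)
      intervalIntegrable_const fun t ht => ?_
    refine (Chebyshev.psi_le_const_mul_self (by linarith [ht.1])).trans ?_
    gcongr
    exact ht.2
  rw [intervalIntegral.integral_const, smul_eq_mul] at h2
  refine h2.trans ?_
  nlinarith [mul_nonneg hc (by linarith : 0 ≤ x)]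

lemma Er_cont (hRH : RiemannHypothesis) : ContinuousOn Er (Ici 1) := by
  unfold Er
  have h1 : Continuous psi1 := intervalIntegral.continuous_primitive psi_intervalIntegrable 1
  have h2 := Sf_cont hRH
  have h3 := Af_cont
  refine ContinuousOn.sub (ContinuousOn.add (ContinuousOn.add ?_ h2) ?_) h3
  · fun_prop
  · fun_prop

lemma Bc_nonneg (hRH : RiemannHypothesis) : 0 ≤ Bc :=
  (hasSum_B hRH).nonneg fun w => mul_nonneg (mm_nonneg w) (by positivity)

lemma Er_bound (hRH : RiemannHypothesis) : ∃ D : ℝ, ∀ x, 1 ≤ x → |Er x| ≤ D * x ^ 2 := by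
  refine ⟨(Real.log 4 + 4) + 1 + 2 * Bc + |Real.log (2 * Real.pi)| + Real.log 2, fun x hx => ?_⟩
  have h1 := psi1_bound hx
  have h2 := Sf_bound hRH hx
  have h3 := Af_nonneg hx
  have h4 := Af_le hx
  have hB := Bc_nonneg hRH
  have h5 : x ^ (3 / 2 : ℝ) ≤ x ^ 2 := by
    rw [← Real.rpow_two]
    exact Real.rpow_le_rpow_of_exponent_le hx (by norm_num)
  have hx2 : 1 ≤ x ^ 2 := one_le_pow₀ hx
  have hxx : x ≤ x ^ 2 := by nlinarith
  have h6 : |Sf x| ≤ 2 * Bc * x ^ 2 := by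
    refine h2.trans ?_
    nlinarith
  have h7 : |Real.log (2 * Real.pi) * (x - 1)| ≤ |Real.log (2 * Real.pi)| * x ^ 2 := by
    rw [abs_mul, abs_of_nonneg (by linarith : 0 ≤ x - 1)]
    gcongr
    linarith
  have h8 : |Af x| ≤ Real.log 2 * x ^ 2 := by
    rw [abs_of_nonneg h3]
    have := Real.log_nonneg (show (1:ℝ) ≤ 2 by norm_num)
    nlinarith
  have h9 : |(x ^ 2 - 1) / 2| ≤ 1 * x ^ 2 := by
    rw [abs_of_nonneg (by linarith)]
    linarith
  unfold Er
  rw [abs_le] at *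
  constructor <;> nlinarith [h1.1, h1.2, h6.1, h6.2, h7.1, h7.2, h8.1, h8.2, h9.1, h9.2]

lemma rpow_moment {a σ : ℝ} (h : a < σ) : ∫ x in Ioi (1:ℝ), x ^ a * x ^ (-(σ + 1)) = 1 / (σ - a) := by
  have h1 := T_rpow (a := a) (s := (σ:ℂ)) (by simpa using h)
  rw [T_ofReal] at h1
  have : (1:ℂ) / ((σ:ℂ) - a) = ((1 / (σ - a) : ℝ) : ℂ) := by push_cast; rfl
  rw [this] at h1
  exact_mod_cast h1

lemma prim_moment {φ : ℝ → ℝ} {σ : ℝ} (hs : -1 < σ) (h : IntAt φ σ) :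
    ∫ x in Ioi (1:ℝ), ((∫ t in (1:ℝ)..x, φ t) / x) * x ^ (-(σ + 1)) =
      (∫ x in Ioi (1:ℝ), φ x * x ^ (-(σ + 1))) / (σ + 1) := by
  have h1 := byparts_T (s := (σ:ℂ)) (by simpa using hs) (by simpa using h)
  rw [T_ofReal, T_ofReal] at h1
  rw [← Complex.ofReal_one, ← Complex.ofReal_add, ← Complex.ofReal_div] at h1
  exact_mod_cast h1

lemma psi_moment (n : ℕ) :
    ∫ x in Ioi (1:ℝ), Chebyshev.psi x * x ^ (-(((2 * (n + 1) : ℕ) : ℝ) + 1)) =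
      (1 / (((2 * (n + 1) : ℕ) : ℝ) - 1) - (logDeriv X ((((2 * (n + 1) : ℕ) : ℝ) - 1 / 2 : ℝ) : ℂ)).re
        - Real.log Real.pi / 2 - Real.eulerMascheroniConstant / 2 + (harmonic (n + 1) : ℝ) / 2) /
        ((2 * (n + 1) : ℕ) : ℝ) := by
  set σ : ℝ := ((2 * (n + 1) : ℕ) : ℝ) with hσ
  have hn : (0:ℝ) ≤ n := n.cast_nonneg
  have h1 : 1 < σ := by rw [hσ]; push_cast; linarith
  have hT := T_psi (s := (σ:ℂ)) (by simpa using h1)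
  rw [T_ofReal] at hT
  have hz := zf_logDeriv n
  rw [show (((2 * (n + 1) : ℕ)) : ℂ) = (σ:ℂ) by rw [hσ]; simp] at hz
  rw [hz] at hT
  have e : ((σ:ℂ) - 1 / 2) = ((σ - 1 / 2 : ℝ) : ℂ) := by push_cast; rfl
  rw [e] at hT
  have hre := congrArg Complex.re hT
  rw [Complex.ofReal_re, Complex.div_ofReal_re] at hre
  rw [hre]
  congr 1
  have e2 : (1:ℂ) / ((σ:ℂ) - 1) = ((1 / (σ - 1) : ℝ) : ℂ) := by push_cast; rfl
  have e3 : (Real.log Real.pi : ℂ) / 2 = ((Real.log Real.pi / 2 : ℝ) : ℂ) := by push_cast; rfl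
  have e4 : (Real.eulerMascheroniConstant : ℂ) / 2 = ((Real.eulerMascheroniConstant / 2 : ℝ) : ℂ) := by push_cast; rfl
  have e5 : (harmonic (n + 1) : ℂ) / 2 = (((harmonic (n + 1) : ℝ) / 2 : ℝ) : ℂ) := by push_cast; rfl
  rw [e2, e3, e4, e5]
  simp only [Complex.sub_re, Complex.add_re, Complex.ofReal_re]
  ring

lemma integral_comb {μ : Measure ℝ} {f1 f2 f3 f4 f5 f6 f7 : ℝ → ℝ} (i1 : Integrable f1 μ)
    (i2 : Integrable f2 μ) (i3 : Integrable f3 μ) (i4 : Integrable f4 μ) (i5 : Integrable f5 μ)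
    (i6 : Integrable f6 μ) (i7 : Integrable f7 μ) :
    ∫ x, ((f1 x - f2 x + f3 x + f4 x) + (f5 x - f6 x) - f7 x) ∂μ =
      ((∫ x, f1 x ∂μ) - (∫ x, f2 x ∂μ) + (∫ x, f3 x ∂μ) + (∫ x, f4 x ∂μ)) +
        ((∫ x, f5 x ∂μ) - ∫ x, f6 x ∂μ) - ∫ x, f7 x ∂μ := by
  rw [← integral_sub i1 i2, ← integral_sub i5 i6]
  have j1 : Integrable (fun x => f1 x - f2 x) μ := i1.sub i2
  have j2 : Integrable (fun x => f5 x - f6 x) μ := i5.sub i6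
  rw [← integral_add j1 i3]
  have j3 : Integrable (fun x => f1 x - f2 x + f3 x) μ := j1.add i3
  rw [← integral_add j3 i4]
  have j4 : Integrable (fun x => f1 x - f2 x + f3 x + f4 x) μ := j3.add i4
  rw [← integral_add j4 j2]
  have j5 : Integrable (fun x => f1 x - f2 x + f3 x + f4 x + (f5 x - f6 x)) μ := j4.add j2
  rw [← integral_sub j5 i7]

lemma Er_moment (hRH : RiemannHypothesis) (j : ℕ) :
    ∫ x in Ioi (1:ℝ), Er x * (x⁻¹) ^ (6 + 2 * j) = 0 := by
  set σ : ℝ := ((2 * (j + 1 + 1) : ℕ) : ℝ) with hσ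
  have hj : (0:ℝ) ≤ j := j.cast_nonneg
  have h4 : 4 ≤ σ := by rw [hσ]; push_cast; linarith
  have e1 : ∫ x in Ioi (1:ℝ), Er x * (x⁻¹) ^ (6 + 2 * j) =
      ∫ x in Ioi (1:ℝ), ((psi1 x / x * x ^ (-(σ + 1))
        - (1 / 2) * (x ^ (1:ℝ) * x ^ (-(σ + 1))) + (1 / 2) * (x ^ (-1:ℝ) * x ^ (-(σ + 1)))
        + Sf x / x * x ^ (-(σ + 1)))
        + (Real.log (2 * Real.pi) * (x ^ (0:ℝ) * x ^ (-(σ + 1))) -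
          Real.log (2 * Real.pi) * (x ^ (-1:ℝ) * x ^ (-(σ + 1))))
        - Af x / x * x ^ (-(σ + 1))) := by
    refine setIntegral_congr_fun measurableSet_Ioi fun x hx => ?_
    have hx1 : (1:ℝ) < x := hx
    have hx0 : (0:ℝ) < x := by linarith
    have e2 : (x⁻¹) ^ (6 + 2 * j) = x⁻¹ * x ^ (-(σ + 1)) := by
      rw [Real.rpow_neg hx0.le, show σ + 1 = ((2 * (j + 1 + 1) + 1 : ℕ) : ℝ) by rw [hσ]; push_cast; rfl,
        Real.rpow_natCast, ← inv_pow, ← pow_succ']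
      congr 1
      ring
    simp only [e2, Real.rpow_one, Real.rpow_zero, Real.rpow_neg_one, Er]
    field_simp
    ring
  have hpsi := byparts_int (σ := σ) (by linarith) (intAt_psi (σ := σ) (by linarith))
  have i1 : IntegrableOn (fun x => psi1 x / x * x ^ (-(σ + 1))) (Ioi 1) := hpsi
  have i2 : IntegrableOn (fun x : ℝ => (1 / 2) * (x ^ (1:ℝ) * x ^ (-(σ + 1)))) (Ioi 1) :=
    Integrable.const_mul (intAt_rpow (a := 1) (σ := σ) (by linarith)) _
  have i3 : IntegrableOn (fun x : ℝ => (1 / 2) * (x ^ (-1:ℝ) * x ^ (-(σ + 1)))) (Ioi 1) :=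
    Integrable.const_mul (intAt_rpow (a := -1) (σ := σ) (by linarith)) _
  have i4 : IntegrableOn (fun x : ℝ => Sf x / x * x ^ (-(σ + 1))) (Ioi 1) := by
    have : IntAt (fun x => Sf x / x) σ := by
      refine intAt_of_bound (a := 1) (C := 2 * Bc) ?_ (fun x hx => ?_) (by linarith)
      · apply ContinuousOn.aestronglyMeasurable _ measurableSet_Ioi
        exact ((Sf_cont hRH).mono Ioi_subset_Ici_self).div continuousOn_id
          (fun x hx => (one_pos.trans hx).ne')
      · have hx0 : 0 < x := by linarith
        rw [abs_div, abs_of_pos hx0, div_le_iff₀ hx0, Real.rpow_one]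
        refine (Sf_bound hRH hx.le).trans ?_
        have h5 : x ^ (3 / 2 : ℝ) ≤ x ^ 2 := by
          rw [← Real.rpow_two]
          exact Real.rpow_le_rpow_of_exponent_le hx.le (by norm_num)
        have hx2 : 1 ≤ x ^ 2 := one_le_pow₀ hx.le
        have := Bc_nonneg hRH
        nlinarith
    exact this
  have i5 : IntegrableOn (fun x : ℝ => Real.log (2 * Real.pi) * (x ^ (0:ℝ) * x ^ (-(σ + 1)))) (Ioi 1) :=
    Integrable.const_mul (intAt_rpow (a := 0) (σ := σ) (by linarith)) _
  have i6 : IntegrableOn (fun x : ℝ => Real.log (2 * Real.pi) * (x ^ (-1:ℝ) * x ^ (-(σ + 1)))) (Ioi 1) :=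
    Integrable.const_mul (intAt_rpow (a := -1) (σ := σ) (by linarith)) _
  have hal := al_moment (j + 1)
  have i7 : IntegrableOn (fun x : ℝ => Af x / x * x ^ (-(σ + 1))) (Ioi 1) :=
    byparts_int (σ := σ) (by linarith) hal.1
  have v1 : ∫ x in Ioi (1:ℝ), psi1 x / x * x ^ (-(σ + 1)) = _ :=
    prim_moment (σ := σ) (by linarith) (intAt_psi (σ := σ) (by linarith))
  have v7 : ∫ x in Ioi (1:ℝ), Af x / x * x ^ (-(σ + 1)) = _ :=
    prim_moment (σ := σ) (by linarith) hal.1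
  rw [psi_moment (j + 1), ← hσ] at v1
  rw [hal.2] at v7
  rw [e1, integral_comb i1 i2 i3 i4 i5 i6 i7,
    integral_const_mul, integral_const_mul, integral_const_mul, integral_const_mul,
    rpow_moment (by linarith), rpow_moment (by linarith), rpow_moment (by linarith),
    Sf_moment hRH (by linarith), v1, v7]
  have hlog : Real.log (4 * Real.pi) = 2 * Real.log 2 + Real.log Real.pi := by
    rw [Real.log_mul (by norm_num) Real.pi_ne_zero, show (4:ℝ) = 2 ^ 2 by norm_num, Real.log_pow]
    push_cast; ring
  have hlog2 : Real.log (2 * Real.pi) = Real.log 2 + Real.log Real.pi :=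
    Real.log_mul (by norm_num) Real.pi_ne_zero
  have hσ4 : 4 * (((j + 1 : ℕ) : ℝ) + 1) = 2 * σ := by rw [hσ]; push_cast; ring
  rw [hσ4, hlog2, Bc, hlog]
  generalize (logDeriv X ((σ - 1 / 2 : ℝ) : ℂ)).re = h
  generalize (harmonic (j + 1 + 1) : ℝ) = H
  have n1 : σ ≠ 0 := by linarith
  have n2 : σ + 1 ≠ 0 := by linarith
  have n3 : σ - 1 ≠ 0 := by linarith
  rw [show σ - -1 = σ + 1 by ring, sub_zero]
  field_simp
  ring

/-- the explicit formula -/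
lemma explicit (hRH : RiemannHypothesis) {x : ℝ} (hx : 1 < x) :
    psi1 x = (x ^ 2 - 1) / 2 - Sf x - Real.log (2 * Real.pi) * (x - 1) + Af x := by
  obtain ⟨D, hD⟩ := Er_bound hRH
  have := moment_unique (Er_cont hRH) hD (Er_moment hRH) x hx
  unfold Er at this
  linarith

end RHT


namespace RHT
open Set Complex Topology

lemma log_pi_ge : (1.14:ℝ) ≤ Real.log Real.pi := by
  rw [Real.le_log_iff_exp_le Real.pi_pos]
  have h1 : Real.exp 0.035 ≤ 1 / 0.965 := by
    have h := Real.add_one_le_exp (-0.035)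
    rw [Real.exp_neg] at h
    have hp := Real.exp_pos 0.035
    rw [le_div_iff₀ (by norm_num)]
    have h2 : (Real.exp 0.035)⁻¹ * Real.exp 0.035 = 1 := inv_mul_cancel₀ hp.ne'
    nlinarith
  have h2 : Real.exp 1.14 = Real.exp 1 * Real.exp 0.035 ^ 4 := by
    rw [← Real.exp_nat_mul, ← Real.exp_add]; norm_num
  have h3 := Real.exp_one_lt_d9
  have h4 := Real.pi_gt_d2
  rw [h2]
  calc _ ≤ 2.7182818286 * (1 / 0.965 : ℝ) ^ 4 := by gcongr
    _ ≤ 3.14 := by norm_num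
    _ ≤ _ := h4.le

lemma Bc_le : Bc ≤ 0.1405 := by
  have h1 := log_pi_ge
  have h2 := Real.log_two_gt_d9
  have h3 := Real.eulerMascheroniConstant_lt_two_thirds
  have hlog : Real.log (4 * Real.pi) = 2 * Real.log 2 + Real.log Real.pi := by
    rw [Real.log_mul (by norm_num) Real.pi_ne_zero, show (4:ℝ) = 2 ^ 2 by norm_num, Real.log_pow]
    push_cast; ring
  unfold Bc
  rw [hlog]
  linarith

lemma psi_lower {u : ℝ} (hu : 10 ≤ u) : 0.3 * u ≤ Chebyshev.psi u := by
  have h := Chebyshev.psi_ge' (x := u) (by linarith)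
  have h2 := Real.log_two_gt_d9
  have h3 := Real.log_two_lt_d9
  have h4 : Real.log (u + 2) ≤ 4 * Real.log 2 + ((u + 2) / 16 - 1) := by
    have e : u + 2 = 2 ^ 4 * ((u + 2) / 16) := by ring
    have h5 : Real.log (u + 2) = 4 * Real.log 2 + Real.log ((u + 2) / 16) := by
      conv_lhs => rw [e]
      rw [Real.log_mul (by norm_num) (by linarith), Real.log_pow]
      push_cast; ring
    rw [h5]
    have := Real.log_le_sub_one_of_pos (show 0 < (u + 2) / 16 by linarith)
    linarith
  nlinarith

lemma psi_sub_theta_nonneg (t : ℝ) : 0 ≤ Chebyshev.psi t - Chebyshev.theta t :=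
  sub_nonneg.mpr (Chebyshev.theta_le_psi t)

lemma diff_intervalIntegrable (a b : ℝ) :
    IntervalIntegrable (fun t => Chebyshev.psi t - Chebyshev.theta t) volume a b :=
  (psi_intervalIntegrable a b).sub (theta_intervalIntegrable a b)

lemma I_nonneg {x : ℝ} (hx : 2 ≤ x) : 0 ≤ ∫ t in (2:ℝ)..x, (Chebyshev.psi t - Chebyshev.theta t) :=
  intervalIntegral.integral_nonneg hx fun t _ => psi_sub_theta_nonneg t

lemma I_lower {x : ℝ} (hx : 100 ≤ x) :
    0.2 * (x ^ (3 / 2 : ℝ) - 1000) ≤ ∫ t in (2:ℝ)..x, (Chebyshev.psi t - Chebyshev.theta t) := by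
  rw [← intervalIntegral.integral_add_adjacent_intervals (diff_intervalIntegrable 2 100)
    (diff_intervalIntegrable 100 x)]
  have h1 := I_nonneg (x := 100) (by norm_num)
  have h2 : ∫ t in (100:ℝ)..x, 0.3 * t ^ (1 / 2 : ℝ) ≤
      ∫ t in (100:ℝ)..x, (Chebyshev.psi t - Chebyshev.theta t) := by
    refine intervalIntegral.integral_mono_on hx ?_ (diff_intervalIntegrable 100 x) fun t ht => ?_
    · exact ((Real.continuous_rpow_const (by norm_num)).const_mul _).intervalIntegrable _ _
    · have ht1 : 100 ≤ t := ht.1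
      have h3 := Chebyshev.psi_sub_theta_ge_psi_add_psi_add_psi (x := t) (by linarith)
      have h4 := Chebyshev.psi_nonneg (t ^ (3 : ℝ)⁻¹)
      have h5 := Chebyshev.psi_nonneg (t ^ (7 : ℝ)⁻¹)
      have h6 : 10 ≤ t ^ (2 : ℝ)⁻¹ := by
        rw [← one_div, ← Real.sqrt_eq_rpow]
        exact Real.le_sqrt_of_sq_le (by linarith)
      have h7 := psi_lower h6
      rw [one_div]
      linarith
  rw [intervalIntegral.integral_const_mul, integral_rpow (Or.inl (by norm_num))] at h2
  have e1 : (1 / 2 : ℝ) + 1 = 3 / 2 := by norm_num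
  have e2 : (100:ℝ) ^ (3 / 2 : ℝ) = 1000 := by
    rw [show (100:ℝ) = 10 ^ (2:ℝ) by norm_num, ← Real.rpow_mul (by norm_num)]
    norm_num
  rw [e1, e2] at h2
  linarith

lemma psi1_eq {x : ℝ} : psi1 x = ∫ t in (2:ℝ)..x, Chebyshev.psi t := by
  unfold psi1
  rw [← intervalIntegral.integral_add_adjacent_intervals (psi_intervalIntegrable 1 2)
    (psi_intervalIntegrable 2 x)]
  have : ∫ t in (1:ℝ)..2, Chebyshev.psi t = 0 := by
    rw [intervalIntegral.integral_of_le (by norm_num), integral_Ioc_eq_integral_Ioo]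
    have := setIntegral_congr_fun (μ := volume) (f := Chebyshev.psi) (g := fun _ => (0:ℝ))
      (measurableSet_Ioo (a := (1:ℝ)) (b := 2)) fun t ht => Chebyshev.psi_eq_zero_of_lt_two ht.2
    rw [this]; simp
  rw [this, zero_add]

lemma G_eq (x : ℝ) : ∫ t in (2:ℝ)..x, (Chebyshev.theta t - t) =
    psi1 x - (∫ t in (2:ℝ)..x, (Chebyshev.psi t - Chebyshev.theta t)) - (x ^ 2 / 2 - 2) := by
  rw [psi1_eq, intervalIntegral.integral_sub (psi_intervalIntegrable 2 x) (theta_intervalIntegrable 2 x),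
    intervalIntegral.integral_sub (theta_intervalIntegrable 2 x) intervalIntegral.intervalIntegrable_id,
    integral_id]
  ring

lemma G_small {x : ℝ} (h2 : 2 < x) (h3 : x ≤ 3) : ∫ t in (2:ℝ)..x, (Chebyshev.theta t - t) < 0 := by
  have hle : ∫ t in (2:ℝ)..x, (Chebyshev.theta t - t) ≤ ∫ t in (2:ℝ)..x, (Real.log 2 - 2) := by
    refine intervalIntegral.integral_mono_on_of_le_Ioo h2.le
      ((theta_intervalIntegrable 2 x).sub intervalIntegral.intervalIntegrable_id)
      intervalIntegrable_const fun t ht => ?_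
    have hf : ⌊t⌋₊ = 2 := by
      rw [Nat.floor_eq_iff (by linarith [ht.1])]
      constructor
      · exact_mod_cast ht.1.le
      · push_cast; linarith [ht.2]
    have : Chebyshev.theta t = Real.log 2 := by
      rw [Chebyshev.theta_eq_sum_Icc, hf]
      have : (Finset.Icc 0 2).filter Nat.Prime = {2} := by decide
      rw [this]; simp
    rw [this]
    linarith [ht.1]
  rw [intervalIntegral.integral_const, smul_eq_mul] at hle
  have := Real.log_two_lt_d9
  nlinarith

lemma neg_of_rh (hRH : RiemannHypothesis) {x : ℝ} (hx : 2 < x) :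
    ∫ t in (2:ℝ)..x, (Chebyshev.theta t - t) < 0 := by
  rcases le_total x 3 with h3 | h3
  · exact G_small hx h3
  rw [G_eq, explicit hRH (by linarith)]
  have hS := (abs_le.mp (Sf_bound hRH (x := x) (by linarith))).1
  have hA := Af_le (x := x) (by linarith)
  have hB := Bc_le
  have l2 := Real.log_two_lt_d9
  have l2' := Real.log_two_gt_d9
  have lp := log_pi_ge
  have hC : 1.8331 ≤ Real.log (2 * Real.pi) := by
    rw [Real.log_mul (by norm_num) Real.pi_ne_zero]
    linarith
  have hx0 : 0 < x := by linarith
  obtain ⟨u, hu0, hux⟩ : ∃ u : ℝ, 0 < u ∧ u ^ 2 = x := ⟨Real.sqrt x, Real.sqrt_pos.mpr hx0, Real.sq_sqrt hx0.le⟩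
  have hx32 : x ^ (3 / 2 : ℝ) = u ^ 3 := by
    rw [← hux, ← Real.rpow_natCast, ← Real.rpow_mul hu0.le, ← Real.rpow_natCast]
    norm_num
  have hS2 : -Sf x ≤ (u ^ 3 + 1) * 0.1405 := by
    rw [hx32] at hS
    have : 0 ≤ u ^ 3 + 1 := by positivity
    nlinarith
  have hC2 : 1.8331 * (x - 1) ≤ Real.log (2 * Real.pi) * (x - 1) :=
    mul_le_mul_of_nonneg_right hC (by linarith)
  have main : ∀ I : ℝ, 4.1669 - 1.8331 * u ^ 2 + 0.1405 * u ^ 3 < I →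
      (x ^ 2 - 1) / 2 - Sf x - Real.log (2 * Real.pi) * (x - 1) + Af x - I - (x ^ 2 / 2 - 2) < 0 := by
    intro I hI
    rw [hux] at hI
    linarith
  apply main
  rcases le_total u 12 with h12 | h12
  · refine lt_of_lt_of_le ?_ (I_nonneg hx.le)
    have key : ∀ a b : ℝ, a ^ 2 ≤ u ^ 2 → u ≤ b → 0.1405 * b - 1.8331 ≤ 0 →
        4.1669 + (0.1405 * b - 1.8331) * a ^ 2 < 0 →
        4.1669 - 1.8331 * u ^ 2 + 0.1405 * u ^ 3 < 0 := by
      intro a b ha hb h1 h2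
      have h3 : 0.1405 * u ^ 3 ≤ 0.1405 * b * u ^ 2 := by
        have : u ^ 2 * u ≤ u ^ 2 * b := by gcongr
        nlinarith
      nlinarith
    rcases le_total u 2 with h | h
    · exact key 1.73 2 (by rw [hux]; norm_num; linarith) h (by norm_num) (by norm_num)
    rcases le_total u 5 with h' | h'
    · exact key 2 5 (by gcongr) h' (by norm_num) (by norm_num)
    rcases le_total u 11.5 with h'' | h''
    · exact key 5 11.5 (by gcongr) h'' (by norm_num) (by norm_num)
    · exact key 11.5 12 (by gcongr) h12 (by norm_num) (by norm_num)
  · refine lt_of_lt_of_le ?_ (I_lower (by nlinarith))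
    rw [hx32]
    have h1 : 144 ≤ u ^ 2 := by nlinarith
    have h2 : 0 ≤ u ^ 3 := by positivity
    nlinarith

end RHT

theorem RHT.theta_bridge (t : ℝ) : theta t = Chebyshev.theta t := by
  rw [Chebyshev.theta_eq_sum_Icc, theta]
  congr 1
  ext p
  simp only [Finset.mem_filter, Finset.mem_range, Finset.mem_Icc]
  constructor
  · rintro ⟨h1, h2⟩
    exact ⟨⟨Nat.zero_le _, by omega⟩, h2⟩
  · rintro ⟨h1, h2⟩
    exact ⟨by omega, h2⟩

theorem riemannHypothesis_iff_integral_theta_sub_id_neg :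
    RiemannHypothesis ↔
      ∀ x : ℝ, x > 2 → (∫ t in (2:ℝ)..x, (theta t - t)) < 0 := by
  simp only [RHT.theta_bridge]
  exact ⟨fun h x hx => RHT.neg_of_rh h hx, fun h => RHT.rh_of_neg h⟩
end

section
/- Unconditionally, for every real x > 2, ∫_2^x (π(t) − li(t))/t² dt < 0. -/
open MeasureTheory Filter

/-- `primePi x` is the number of primes `p ≤ x`. -/
noncomputable def primePi (x : ℝ) : ℝ := Nat.primeCounting ⌊x⌋₊

/-- `li x` is the logarithmic integral, defined for `x > 1` as the Cauchy principal value
`lim_{ε→0⁺} (∫_0^{1-ε} du/log u + ∫_{1+ε}^x du/log u)`. -/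
noncomputable def li (x : ℝ) : ℝ :=
  limUnder (nhdsWithin (0:ℝ) (Set.Ioi 0)) (fun ε =>
    (∫ u in (0:ℝ)..(1 - ε), 1 / Real.log u) + ∫ u in (1 + ε)..x, 1 / Real.log u)


/-- `mertA n` is the sum of `log p / p` over the primes `p ≤ n`. -/
noncomputable def mertA (n : ℕ) : ℝ :=
  ∑ k ∈ Finset.Icc 0 n, if k.Prime then Real.log k / k else 0

lemma prod_pow_dvd_factorial (n : ℕ) :
    (∏ p ∈ (Finset.Icc 0 n).filter Nat.Prime, p ^ (n / p)) ∣ n.factorial := by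
  apply Finset.prod_dvd_of_isRelPrime
  · intro p hp q hq hpq
    simp only [Finset.coe_filter, Set.mem_ofPred_eq] at hp hq
    exact Nat.coprime_iff_isRelPrime.1 (Nat.Coprime.pow _ _ ((Nat.coprime_primes hp.2 hq.2).2 hpq))
  · intro p hp
    simp only [Finset.mem_filter] at hp
    rw [Nat.Prime.pow_dvd_factorial_iff hp.2 (Nat.lt_succ_self _)]
    have hle : p ≤ n := (Finset.mem_Icc.1 hp.1).2
    have : 1 ≤ Nat.log p n := Nat.log_pos hp.2.one_lt hle
    have h := Finset.single_le_sum (f := fun i => n / p ^ i) (s := Finset.Ico 1 (Nat.log p n).succ)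
      (fun i _ => Nat.zero_le _) (a := 1) (Finset.mem_Ico.2 ⟨le_rfl, by omega⟩)
    simpa using h

lemma log_factorial_le (n : ℕ) (hn : 1 ≤ n) :
    Real.log n.factorial ≤ (n + 1) * Real.log n - n + 1 := by
  induction n, hn using Nat.le_induction with
  | base => simp
  | succ n hn ih =>
    have hn0 : (0:ℝ) < n := by exact_mod_cast hn
    rw [Nat.factorial_succ]
    push_cast
    rw [Real.log_mul (by positivity) (by positivity)]
    have h := Real.one_sub_inv_le_log_of_pos (x := ((n:ℝ) + 1) / n) (by positivity)
    rw [Real.log_div (by positivity) (by positivity)] at h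
    have h2 : (1 - (((n:ℝ) + 1) / n)⁻¹) * (n + 1) = 1 := by field_simp; ring
    nlinarith

lemma mertA_le (n : ℕ) (hn : 16 ≤ n) :
    mertA n ≤ Real.log n + (2 * Real.log 2 - 1 + (2 - 2 * Real.log 2) / 17) := by
  have h1 : ∑ p ∈ (Finset.Icc 0 n).filter Nat.Prime, ((n / p : ℕ) : ℝ) * Real.log p
      ≤ Real.log n.factorial := by
    have h := Nat.le_of_dvd (Nat.factorial_pos n) (prod_pow_dvd_factorial n)
    have h' : ((∏ p ∈ (Finset.Icc 0 n).filter Nat.Prime, p ^ (n / p) : ℕ) : ℝ) ≤ n.factorial := by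
      exact_mod_cast h
    have h3 := Real.log_le_log (by
      norm_cast
      apply Finset.prod_pos
      intro p hp
      exact pow_pos (Finset.mem_filter.1 hp).2.pos _) h'
    push_cast at h3
    rw [Real.log_prod] at h3
    · simpa [Real.log_pow] using h3
    · intro p hp
      have := (Finset.mem_filter.1 hp).2.pos
      positivity
  have h2 : ∑ p ∈ (Finset.Icc 0 n).filter Nat.Prime, Real.log p ≤ Real.log 4 * n := by
    have := Chebyshev.theta_le_log4_mul_x (x := n) (by positivity)
    rw [Chebyshev.theta_eq_sum_Icc] at this
    simpa using this
  have h3 : (n + 1) * mertA n ≤ ∑ p ∈ (Finset.Icc 0 n).filter Nat.Prime,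
      (((n / p : ℕ) : ℝ) * Real.log p + Real.log p) := by
    unfold mertA
    rw [← Finset.sum_filter, Finset.mul_sum]
    apply Finset.sum_le_sum
    intro p hp
    have hp' := (Finset.mem_filter.1 hp).2
    have hp0 : (0:ℝ) < p := by exact_mod_cast hp'.pos
    have hl : 0 ≤ Real.log p := Real.log_natCast_nonneg p
    have hd : n + 1 ≤ (n / p + 1) * p := by
      have := Nat.lt_div_mul_add (a := n) hp'.pos
      nlinarith
    have hd' : (n:ℝ) + 1 ≤ (((n / p : ℕ) : ℝ) + 1) * p := by exact_mod_cast hd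
    have : ((n:ℝ) + 1) / p ≤ ((n / p : ℕ) : ℝ) + 1 := by rwa [div_le_iff₀ hp0]
    calc ((n:ℝ) + 1) * (Real.log p / p) = ((n:ℝ) + 1) / p * Real.log p := by ring
      _ ≤ (((n / p : ℕ) : ℝ) + 1) * Real.log p := by gcongr
      _ = _ := by ring
  rw [Finset.sum_add_distrib] at h3
  have h4 := log_factorial_le n (by omega)
  have h5 : Real.log 4 = 2 * Real.log 2 := by
    rw [show (4:ℝ) = 2 ^ 2 by norm_num, Real.log_pow]; norm_num
  rw [h5] at h2
  have hn' : (16:ℝ) ≤ n := by exact_mod_cast hn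
  have hl2 : Real.log 2 < 1 := by linarith [Real.log_two_lt_d9]
  have h6 : (n + 1) * mertA n ≤ (n + 1) * (Real.log n +
      (2 * Real.log 2 - 1 + (2 - 2 * Real.log 2) / 17)) := by
    nlinarith
  exact le_of_mul_le_mul_left h6 (by positivity)

/-- The symmetrized integrand of the principal value. -/
noncomputable def symH (s : ℝ) : ℝ := 1 / Real.log (1 - s) + 1 / Real.log (1 + s)

lemma symK_nonneg (s : ℝ) (h0 : 0 ≤ s) (h1 : s < 1) :
    0 ≤ 2 * s - (1 + s) * Real.log (1 + s) + (1 - s) * Real.log (1 - s) := by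
  set k : ℝ → ℝ := fun s => 2 * s - (1 + s) * Real.log (1 + s) + (1 - s) * Real.log (1 - s) with hk
  have hd : ∀ t ∈ Set.Ico (0:ℝ) 1, HasDerivAt k (-Real.log (1 + t) - Real.log (1 - t)) t := by
    intro t ht
    have e1 : HasDerivAt (fun t : ℝ => 1 + t) 1 t := (hasDerivAt_id t).const_add 1
    have e2 : HasDerivAt (fun t : ℝ => 1 - t) (-1) t := (hasDerivAt_id t).const_sub 1
    have a1 : (1 + t) ≠ 0 := by have := ht.1; positivity
    have a2 : (1 - t) ≠ 0 := by have := ht.2; linarith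
    have := (((hasDerivAt_id t).const_mul 2).sub (e1.mul (e1.log a1))).add (e2.mul (e2.log a2))
    convert! this using 1
    field_simp
    ring
  have hmono : MonotoneOn k (Set.Ico 0 1) := by
    apply monotoneOn_of_deriv_nonneg (convex_Ico 0 1)
    · exact fun t ht => (hd t ht).continuousAt.continuousWithinAt
    · rw [interior_Ico]
      exact fun t ht => (hd t ⟨ht.1.le, ht.2⟩).differentiableAt.differentiableWithinAt
    · rw [interior_Ico]
      intro t ht
      rw [(hd t ⟨ht.1.le, ht.2⟩).deriv]
      have : Real.log ((1 + t) * (1 - t)) ≤ 0 :=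
        Real.log_nonpos (by nlinarith [ht.1, ht.2]) (by nlinarith [ht.1])
      rw [Real.log_mul (by linarith [ht.1]) (by linarith [ht.2])] at this
      linarith
  have := hmono (a := 0) (b := s) ⟨le_rfl, one_pos⟩ ⟨h0, h1⟩ h0
  simpa [hk] using this

lemma sym_ineq (s : ℝ) (h0 : 0 ≤ s) (h1 : s < 1) :
    0 ≤ -Real.log (1 - s) - Real.log (1 + s) + Real.log (1 + s) * Real.log (1 - s) := by
  set k : ℝ → ℝ := fun s =>
    -Real.log (1 - s) - Real.log (1 + s) + Real.log (1 + s) * Real.log (1 - s) with hk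
  have hd : ∀ t ∈ Set.Ico (0:ℝ) 1, HasDerivAt k
      ((2 * t - (1 + t) * Real.log (1 + t) + (1 - t) * Real.log (1 - t)) / ((1 - t) * (1 + t))) t := by
    intro t ht
    have e1 : HasDerivAt (fun t : ℝ => 1 + t) 1 t := (hasDerivAt_id t).const_add 1
    have e2 : HasDerivAt (fun t : ℝ => 1 - t) (-1) t := (hasDerivAt_id t).const_sub 1
    have a1 : (1 + t) ≠ 0 := by have := ht.1; positivity
    have a2 : (1 - t) ≠ 0 := by have := ht.2; linarith
    have := (((e2.log a2).neg).sub (e1.log a1)).add ((e1.log a1).mul (e2.log a2))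
    convert! this using 1
    field_simp
    ring
  have hmono : MonotoneOn k (Set.Ico 0 1) := by
    apply monotoneOn_of_deriv_nonneg (convex_Ico 0 1)
    · exact fun t ht => (hd t ht).continuousAt.continuousWithinAt
    · rw [interior_Ico]
      exact fun t ht => (hd t ⟨ht.1.le, ht.2⟩).differentiableAt.differentiableWithinAt
    · rw [interior_Ico]
      intro t ht
      rw [(hd t ⟨ht.1.le, ht.2⟩).deriv]
      apply div_nonneg (symK_nonneg t ht.1.le ht.2)
      nlinarith [ht.1, ht.2]
  have := hmono (a := 0) (b := s) ⟨le_rfl, one_pos⟩ ⟨h0, h1⟩ h0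
  simpa [hk] using this

lemma one_le_symH (s : ℝ) (h0 : 0 < s) (h1 : s < 1) : 1 ≤ symH s := by
  have h := sym_ineq s h0.le h1
  have ha : 0 < Real.log (1 + s) := Real.log_pos (by linarith)
  have hb : Real.log (1 - s) < 0 := Real.log_neg (by linarith) (by linarith)
  unfold symH
  rw [div_add_div _ _ hb.ne ha.ne', le_div_iff_of_neg (by nlinarith)]
  nlinarith

lemma symH_le (s : ℝ) (h0 : 0 < s) (h1 : s < 1) : symH s ≤ 2 := by
  have ha : s / (1 + s / 2) ≤ Real.log (1 + s) := by
    have := Real.le_log_one_add_of_nonneg h0.le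
    refine le_trans (le_of_eq ?_) this
    field_simp
    ring
  have hb : Real.log (1 - s) < 0 := Real.log_neg (by linarith) (by linarith)
  have hb' : 1 - (1 - s)⁻¹ ≤ Real.log (1 - s) := Real.one_sub_inv_le_log_of_pos (by linarith)
  have e1 : 1 / Real.log (1 + s) ≤ 1 / s + 1 / 2 := by
    calc _ ≤ 1 / (s / (1 + s / 2)) := one_div_le_one_div_of_le (by positivity) ha
      _ = _ := by field_simp
  have e2 : 1 / Real.log (1 - s) ≤ 1 - 1 / s := by
    have h1s : 0 < 1 - s := by linarith
    have e : 1 - (1 - s)⁻¹ = - s / (1 - s) := by field_simp; ring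
    rw [e] at hb'
    have : 1 / Real.log (1 - s) ≤ 1 / (- s / (1 - s)) := one_div_le_one_div_of_neg_of_le hb hb'
    refine this.trans (le_of_eq ?_)
    field_simp
    ring
  unfold symH
  linarith

lemma symH_int : IntervalIntegrable symH volume 0 1 := by
  rw [intervalIntegrable_iff_integrableOn_Ioo_of_le zero_le_one]
  have hm : Measurable symH := by
    unfold symH
    fun_prop
  refine Measure.integrableOn_of_bounded (M := 2) (by simp) hm.aestronglyMeasurable ?_
  filter_upwards [ae_restrict_mem measurableSet_Ioo] with s hs
  rw [Real.norm_eq_abs, abs_le]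
  constructor <;> linarith [one_le_symH s hs.1 hs.2, symH_le s hs.1 hs.2]

/-- The value of `li 2`. -/
noncomputable def liTwo : ℝ := ∫ s in (0:ℝ)..1, symH s

lemma one_le_liTwo : 1 ≤ liTwo := by
  have := intervalIntegral.integral_mono_on_of_le_Ioo (a := 0) (b := 1) (f := fun _ => (1:ℝ))
    (g := symH) (μ := volume) zero_le_one (by simp) symH_int
    (fun s hs => one_le_symH s hs.1 hs.2)
  simpa [liTwo] using this

lemma invlog_int (a b : ℝ) (ha : 1 < a) (hb : 1 < b) :
    IntervalIntegrable (fun u => 1 / Real.log u) volume a b := by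
  apply ContinuousOn.intervalIntegrable
  have hsub : ∀ u ∈ Set.uIcc a b, 1 < u := fun u hu =>
    lt_of_lt_of_le (lt_min ha hb) hu.1
  apply ContinuousOn.div continuousOn_const
  · exact Real.continuousOn_log.mono fun u hu => by
      have := hsub u hu
      simp; linarith
  · exact fun u hu => (Real.log_pos (hsub u hu)).ne'

lemma li_eq (x : ℝ) (hx : 1 < x) : li x = liTwo + ∫ u in (2:ℝ)..x, 1 / Real.log u := by
  apply Tendsto.limUnder_eq
  have h1 : Tendsto (fun ε => (∫ s in ε..(1:ℝ), symH s) + ∫ u in (2:ℝ)..x, 1 / Real.log u)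
      (nhdsWithin (0:ℝ) (Set.Ioi 0)) (nhds (liTwo + ∫ u in (2:ℝ)..x, 1 / Real.log u)) := by
    apply Tendsto.add_const
    have hc := intervalIntegral.continuousOn_primitive_interval_left (μ := volume) (f := symH)
      (a := 0) (b := 1) (by
        rw [Set.uIcc_of_le zero_le_one, integrableOn_Icc_iff_integrableOn_Ioo]
        exact (intervalIntegrable_iff_integrableOn_Ioo_of_le zero_le_one).1 symH_int)
    have := hc 0 (by simp)
    refine Tendsto.mono_left this ?_
    rw [Set.uIcc_of_le zero_le_one, ← nhdsWithin_Ioc_eq_nhdsGT zero_lt_one]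
    exact nhdsWithin_mono _ Set.Ioc_subset_Icc_self
  refine h1.congr' ?_
  filter_upwards [Ioo_mem_nhdsGT (zero_lt_one' ℝ)] with ε hε
  have hI : IntervalIntegrable symH volume ε 1 := symH_int.mono_set (by
    rw [Set.uIcc_of_le hε.2.le, Set.uIcc_of_le zero_le_one]
    exact Set.Icc_subset_Icc_left hε.1.le)
  have hJ0 := invlog_int (1 + ε) 2 (by linarith [hε.1]) (by norm_num)
  have hJ : IntervalIntegrable (fun s => 1 / Real.log (1 + s)) volume ε 1 := by
    have := hJ0.comp_add_left 1
    convert! this using 1 <;> norm_num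
  have hK : IntervalIntegrable (fun s => 1 / Real.log (1 - s)) volume ε 1 := by
    have := hI.sub hJ
    convert! this using 1
    ext s; simp [symH]
  have e1 : ∫ s in ε..(1:ℝ), symH s = (∫ s in ε..(1:ℝ), 1 / Real.log (1 - s)) +
      ∫ s in ε..(1:ℝ), 1 / Real.log (1 + s) := intervalIntegral.integral_add hK hJ
  have e2 : (∫ s in ε..(1:ℝ), 1 / Real.log (1 - s)) = ∫ u in (0:ℝ)..(1 - ε), 1 / Real.log u := by
    have := intervalIntegral.integral_comp_sub_left (a := ε) (b := 1)
      (fun u => 1 / Real.log u) 1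
    simpa using this
  have e3 : (∫ s in ε..(1:ℝ), 1 / Real.log (1 + s)) = ∫ u in (1 + ε)..2, 1 / Real.log u := by
    have := intervalIntegral.integral_comp_add_left (a := ε) (b := 1)
      (fun u => 1 / Real.log u) 1
    rw [this]; norm_num
  have e4 := intervalIntegral.integral_add_adjacent_intervals hJ0
    (invlog_int 2 x (by norm_num) hx)
  rw [e1, e2, e3, ← e4]
  ring

/-- The integral of `1 / log` from `2`. -/
noncomputable def liJ (x : ℝ) : ℝ := ∫ u in (2:ℝ)..x, 1 / Real.log u

lemma li_eq' (x : ℝ) (hx : 1 < x) : li x = liTwo + liJ x := li_eq x hx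

lemma liJ_step (a b : ℝ) (ha : 2 ≤ a) (hab : a ≤ b) :
    liJ a + (b - a) / Real.log b ≤ liJ b := by
  have h := intervalIntegral.integral_add_adjacent_intervals
    (invlog_int 2 a (by norm_num) (by linarith)) (invlog_int a b (by linarith) (by linarith))
  have h2 := intervalIntegral.integral_mono_on (a := a) (b := b) (μ := volume)
    (f := fun _ => 1 / Real.log b) (g := fun u => 1 / Real.log u) hab (by simp)
    (invlog_int a b (by linarith) (by linarith)) (by
      intro u hu
      exact one_div_le_one_div_of_le (Real.log_pos (by linarith [hu.1]))
        (Real.log_le_log (by linarith [hu.1]) hu.2))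
  unfold liJ
  rw [← h]
  simp only [intervalIntegral.integral_const, smul_eq_mul] at h2
  have : (b - a) / Real.log b = (b - a) * (1 / Real.log b) := by ring
  linarith

lemma liJ_mono (a b : ℝ) (ha : 2 ≤ a) (hab : a ≤ b) : liJ a ≤ liJ b := by
  have h := liJ_step a b ha hab
  have : 0 ≤ (b - a) / Real.log b :=
    div_nonneg (by linarith) (Real.log_nonneg (by linarith))
  linarith

lemma liJ_two : liJ 2 = 0 := by simp [liJ]

lemma liJ_three : 1 < liJ 3 := by
  have h2 := intervalIntegral.integral_mono_on (a := 2) (b := 3) (μ := volume)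
    (f := fun u => (2.7:ℝ) * u⁻¹) (g := fun u => 1 / Real.log u) (by norm_num)
    (by
      apply ContinuousOn.intervalIntegrable
      apply ContinuousOn.mul continuousOn_const
      apply continuousOn_inv₀.mono
      intro u hu
      rw [Set.uIcc_of_le (by norm_num)] at hu
      have := hu.1
      simp; linarith)
    (invlog_int 2 3 (by norm_num) (by norm_num)) (by
      intro u hu
      have hu0 : 0 < u := by linarith [hu.1]
      have hlog : 0 < Real.log u := Real.log_pos (by linarith [hu.1])
      have h := Real.log_le_sub_one_of_pos (x := u / Real.exp 1) (by positivity)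
      rw [Real.log_div hu0.ne' (Real.exp_pos 1).ne', Real.log_exp] at h
      have h3 : Real.log u ≤ u / Real.exp 1 := by linarith
      have h4 : u / Real.exp 1 ≤ u / 2.7 := by
        gcongr
        linarith [Real.exp_one_gt_d9]
      rw [← div_eq_mul_inv, div_le_div_iff₀ hu0 hlog]
      have := h3.trans h4
      rw [le_div_iff₀ (by norm_num)] at this
      linarith)
  rw [intervalIntegral.integral_const_mul, integral_inv_of_pos (by norm_num) (by norm_num)] at h2
  have h5 := Real.le_log_one_add_of_nonneg (x := 1 / 2) (by norm_num)
  norm_num at h5 h2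
  unfold liJ
  norm_num
  linarith

lemma log_lt_nat (a : ℝ) (k : ℕ) (ha : 0 < a) (h : a < 2.7 ^ k) : Real.log a < k := by
  rw [Real.log_lt_iff_lt_exp ha]
  have : Real.exp k = Real.exp 1 ^ k := by rw [← Real.exp_nat_mul]; simp
  rw [this]
  refine h.trans_le ?_
  gcongr
  linarith [Real.exp_one_gt_d9]

lemma primePi_le (t : ℝ) (m k : ℕ) (h : t < m + 1) (hk : Nat.primeCounting m = k) :
    primePi t ≤ k := by
  unfold primePi
  rw [← hk]
  have : ⌊t⌋₊ ≤ m := by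
    have : ⌊t⌋₊ < m + 1 := (Nat.floor_lt' (by omega)).2 (by push_cast; exact h)
    omega
  exact_mod_cast Nat.monotone_primeCounting this

lemma liJ_next (a b : ℝ) (k : ℕ) (c : ℝ) (ha : 2 ≤ a) (hab : a < b) (h : b < 2.7 ^ k)
    (hc : c * k ≤ b - a) (hc0 : 0 < c) : liJ a + c < liJ b := by
  have h1 := liJ_step a b ha hab.le
  have h2 := log_lt_nat b k (by linarith) h
  have h3 : 0 < Real.log b := Real.log_pos (by linarith)
  have : c < (b - a) / Real.log b := by
    rw [lt_div_iff₀ h3]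
    nlinarith
  linarith

lemma primePi_lt_li (t : ℝ) (h2 : 2 < t) (h16 : t ≤ 16) : primePi t < li t := by
  rw [li_eq' t (by linarith)]
  have hL := one_le_liTwo
  have h3 := liJ_three
  have h5 := liJ_next 3 5 2 1 (by norm_num) (by norm_num) (by norm_num) (by norm_num) (by norm_num)
  have h7 := liJ_next 5 7 2 1 (by norm_num) (by norm_num) (by norm_num) (by norm_num) (by norm_num)
  have h11 := liJ_next 7 11 4 1 (by norm_num) (by norm_num) (by norm_num) (by norm_num)
    (by norm_num)
  have h13 := liJ_next 7 13 3 2 (by norm_num) (by norm_num) (by norm_num) (by norm_num)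
    (by norm_num)
  rcases lt_or_ge t 3 with h | h
  · have hp := primePi_le t 2 1 (by norm_num; linarith) (by decide)
    have hj := liJ_step 2 t le_rfl h2.le
    have : 0 < (t - 2) / Real.log t := div_pos (by linarith) (Real.log_pos (by linarith))
    rw [liJ_two] at hj
    push_cast at hp
    linarith
  rcases lt_or_ge t 5 with hge5 | hge5
  · have hp := primePi_le t 4 2 (by norm_num; linarith) (by decide)
    have hj := liJ_mono 3 t (by norm_num) h
    push_cast at hp
    linarith
  rcases lt_or_ge t 7 with hge7 | hge7
  · have hp := primePi_le t 6 3 (by norm_num; linarith) (by decide)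
    have hj := liJ_mono 5 t (by norm_num) hge5
    push_cast at hp
    linarith
  rcases lt_or_ge t 11 with hge11 | hge11
  · have hp := primePi_le t 10 4 (by norm_num; linarith) (by decide)
    have hj := liJ_mono 7 t (by norm_num) hge7
    push_cast at hp
    linarith
  rcases lt_or_ge t 13 with h4 | h4
  · have hp := primePi_le t 12 5 (by norm_num; linarith) (by decide)
    have hj := liJ_mono 11 t (by norm_num) hge11
    push_cast at hp
    linarith
  · have hp := primePi_le t 16 6 (by norm_num; linarith) (by decide)
    have hj := liJ_mono 13 t (by norm_num) h4
    push_cast at hp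
    linarith

lemma liJ_hasDerivAt (t : ℝ) (ht : 1 < t) : HasDerivAt liJ (1 / Real.log t) t := by
  unfold liJ
  apply intervalIntegral.integral_hasDerivAt_right (invlog_int 2 t (by norm_num) ht)
  · apply Measurable.stronglyMeasurable _ |>.stronglyMeasurableAtFilter
    fun_prop
  · exact continuousAt_const.div (Real.continuousAt_log (by linarith)) (Real.log_pos ht).ne'

lemma primePi_eq (t : ℝ) :
    primePi t = ∑ k ∈ Finset.Icc 0 ⌊t⌋₊, (if k.Prime then (1:ℝ) else 0) := by
  rw [← Finset.sum_filter, Finset.sum_const, nsmul_eq_mul, mul_one]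
  unfold primePi
  rw [← Nat.primesLE_card_eq_primeCounting, Nat.primesLE_eq_filter_Icc_zero]

lemma pi_int (x : ℝ) (hx : 2 ≤ x) :
    IntervalIntegrable (fun t => primePi t / t ^ 2) volume 2 x := by
  rw [intervalIntegrable_iff_integrableOn_Icc_of_le hx]
  have h := integrableOn_mul_sum_Icc (a := 2) (b := x) (m := 0)
    (fun k => if k.Prime then (1:ℝ) else 0) (by norm_num) (g := fun t : ℝ => (t ^ 2)⁻¹) (by
      apply ContinuousOn.integrableOn_Icc
      apply ContinuousOn.inv₀ (by fun_prop)
      intro t ht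
      have := ht.1
      positivity)
  refine h.congr_fun (fun t _ => ?_) measurableSet_Icc
  simp only
  rw [primePi_eq, div_eq_inv_mul]

lemma li_div_cont (x : ℝ) (hx : 2 ≤ x) :
    ContinuousOn (fun t => (liTwo + liJ t) / t ^ 2) (Set.uIcc 2 x) := by
  rw [Set.uIcc_of_le hx]
  intro t ht
  have h1 : 1 < t := by linarith [ht.1]
  exact (((liJ_hasDerivAt t h1).continuousAt.const_add _).div (by fun_prop)
    (by positivity)).continuousWithinAt

lemma li_int (x : ℝ) (hx : 2 ≤ x) :
    IntervalIntegrable (fun t => li t / t ^ 2) volume 2 x := by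
  refine (li_div_cont x hx).intervalIntegrable.congr (fun t ht => ?_)
  rw [Set.uIoc_of_le hx] at ht
  rw [li_eq' t (by linarith [ht.1])]

lemma small_case (x : ℝ) (hx : 2 < x) (h16 : x ≤ 16) :
    (∫ t in (2:ℝ)..x, (primePi t - li t) / t ^ 2) < 0 := by
  have hI : IntervalIntegrable (fun t => (li t - primePi t) / t ^ 2) volume 2 x := by
    convert! (li_int x hx.le).sub (pi_int x hx.le) using 1
    ext t; simp [sub_div]
  have h := intervalIntegral.intervalIntegral_pos_of_pos_on hI (fun t ht => by
    have := primePi_lt_li t ht.1 (by linarith [ht.2])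
    have h0 : 0 < t := by linarith [ht.1]
    apply div_pos (by linarith) (by positivity)) hx
  have e : (∫ t in (2:ℝ)..x, (primePi t - li t) / t ^ 2) =
      - ∫ t in (2:ℝ)..x, (li t - primePi t) / t ^ 2 := by
    rw [← intervalIntegral.integral_neg]
    congr 1
    ext t
    ring
  linarith

lemma li_integral (x : ℝ) (hx : 2 ≤ x) : ∫ t in (2:ℝ)..x, li t / t ^ 2 =
    liTwo / 2 - (liTwo + liJ x) / x + Real.log (Real.log x) - Real.log (Real.log 2) := by
  have e : ∫ t in (2:ℝ)..x, li t / t ^ 2 = ∫ t in (2:ℝ)..x, (liTwo + liJ t) / t ^ 2 := by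
    apply intervalIntegral.integral_congr
    intro t ht
    rw [Set.uIcc_of_le hx] at ht
    simp only
    rw [li_eq' t (by linarith [ht.1])]
  rw [e, intervalIntegral.integral_eq_sub_of_hasDerivAt
    (f := fun t => Real.log (Real.log t) - (liTwo + liJ t) / t) _
    (li_div_cont x hx).intervalIntegrable]
  · rw [liJ_two]; ring
  · intro t ht
    rw [Set.uIcc_of_le hx] at ht
    have h1 : 1 < t := by linarith [ht.1]
    have h0 : t ≠ 0 := by linarith
    have hl := (Real.log_pos h1).ne'
    have := ((Real.hasDerivAt_log h0).log hl).sub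
      (((liJ_hasDerivAt t h1).const_add liTwo).div (hasDerivAt_id t) h0)
    convert! this using 1
    simp only [id]
    field_simp
    ring

lemma pi_integral (x : ℝ) (hx : 2 ≤ x) : ∫ t in (2:ℝ)..x, primePi t / t ^ 2 =
    ∑ k ∈ Finset.Icc 0 ⌊x⌋₊, (if k.Prime then (1:ℝ) / k - 1 / x else 0) := by
  have h := sum_mul_eq_sub_integral_mul₁ (fun k => if k.Prime then (1:ℝ) else 0)
    (by simp [Nat.not_prime_zero]) (by simp [Nat.not_prime_one]) x (f := fun t : ℝ => t⁻¹) (by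
      intro t ht
      exact differentiableAt_inv (by linarith [ht.1])) (by
      apply ContinuousOn.integrableOn_Icc
      simp only [deriv_inv']
      apply ContinuousOn.neg
      apply ContinuousOn.inv₀ (by fun_prop)
      intro t ht
      have := ht.1
      positivity)
  rw [← intervalIntegral.integral_of_le hx] at h
  have e : ∫ t in (2:ℝ)..x, primePi t / t ^ 2 = - ∫ t in (2:ℝ)..x, deriv (fun t : ℝ => t⁻¹) t *
      ∑ k ∈ Finset.Icc 0 ⌊t⌋₊, (if k.Prime then (1:ℝ) else 0) := by
    rw [← intervalIntegral.integral_neg]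
    congr 1
    ext t
    rw [← primePi_eq, deriv_inv]
    ring
  have e2 : ∑ k ∈ Finset.Icc 0 ⌊x⌋₊, (if k.Prime then (1:ℝ) / k - 1 / x else 0) =
      ∑ k ∈ Finset.Icc 0 ⌊x⌋₊, (k:ℝ)⁻¹ * (if k.Prime then (1:ℝ) else 0) -
      x⁻¹ * ∑ k ∈ Finset.Icc 0 ⌊x⌋₊, (if k.Prime then (1:ℝ) else 0) := by
    rw [Finset.mul_sum, ← Finset.sum_sub_distrib]
    apply Finset.sum_congr rfl
    intro k _
    split_ifs <;> simp
  rw [e, e2, h]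
  ring

/-- The weight `(1 - t / x) / log t`. -/
noncomputable def wt (x t : ℝ) : ℝ := (1 - t / x) / Real.log t

lemma wt_hasDerivAt (x t : ℝ) (ht : 1 < t) : HasDerivAt (wt x)
    ((-(1 / x) * Real.log t - (1 - t / x) * t⁻¹) / Real.log t ^ 2) t := by
  have h0 : t ≠ 0 := by linarith
  exact (((hasDerivAt_id t).div_const x).const_sub 1).div (Real.hasDerivAt_log h0)
    (Real.log_pos ht).ne'

lemma wt_deriv_cont (x : ℝ) : ContinuousOn (deriv (wt x)) (Set.Icc 16 x) := by
  have : ContinuousOn (fun t => (-(1 / x) * Real.log t - (1 - t / x) * t⁻¹) / Real.log t ^ 2)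
      (Set.Icc 16 x) := by
    have h0 : ∀ t ∈ Set.Icc 16 x, t ≠ 0 := fun t ht => by linarith [ht.1]
    have hl : ContinuousOn Real.log (Set.Icc 16 x) := Real.continuousOn_log.mono h0
    have hi : ContinuousOn (fun t : ℝ => t⁻¹) (Set.Icc 16 x) := continuousOn_id.inv₀ h0
    apply ContinuousOn.div (by fun_prop) (by fun_prop)
    intro t ht
    have := Real.log_pos (show 1 < t by linarith [ht.1])
    positivity
  refine this.congr fun t ht => ?_
  exact (wt_hasDerivAt x t (by linarith [ht.1])).deriv

lemma wt_deriv_nonpos (x t : ℝ) (ht : 1 < t) (htx : t ≤ x) : deriv (wt x) t ≤ 0 := by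
  rw [(wt_hasDerivAt x t ht).deriv]
  have hl := Real.log_pos ht
  have hx : 0 < x := by linarith
  have h1 : t / x ≤ 1 := by rw [div_le_one hx]; exact htx
  apply div_nonpos_of_nonpos_of_nonneg _ (by positivity)
  have : 0 ≤ 1 / x * Real.log t := by positivity
  have : 0 ≤ (1 - t / x) * t⁻¹ := mul_nonneg (by linarith) (by positivity)
  linarith

lemma tail_bound (x c : ℝ) (hx : 16 ≤ x)
    (hc : ∀ n : ℕ, 16 ≤ n → mertA n ≤ Real.log n + c) :
    ∑ k ∈ Finset.Ioc 16 ⌊x⌋₊, (if k.Prime then (1:ℝ) / k - 1 / x else 0) ≤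
      wt x 16 * (Real.log 16 + c - mertA 16) + Real.log (Real.log x) - Real.log (Real.log 16)
        - (liJ x - liJ 16) / x := by
  have hx0 : 0 < x := by linarith
  have h := sum_mul_eq_sub_sub_integral_mul (a := 16) (b := x)
    (fun k => if k.Prime then Real.log k / k else 0) (by norm_num) hx (f := wt x) (by
      intro t ht
      exact (wt_hasDerivAt x t (by linarith [ht.1])).differentiableAt)
      (wt_deriv_cont x).integrableOn_Icc
  have hfl : ⌊(16:ℝ)⌋₊ = 16 := Nat.floor_ofNat 16
  have hwx : wt x x = 0 := by simp [wt, hx0.ne']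
  rw [hfl, hwx, zero_mul, ← intervalIntegral.integral_of_le hx] at h
  have e : ∑ k ∈ Finset.Ioc 16 ⌊x⌋₊, (if k.Prime then (1:ℝ) / k - 1 / x else 0) =
      ∑ k ∈ Finset.Ioc 16 ⌊x⌋₊, wt x k * (if k.Prime then Real.log k / k else 0) := by
    apply Finset.sum_congr rfl
    intro k hk
    have hk : 16 < k := (Finset.mem_Ioc.1 hk).1
    have hk' : (16:ℝ) < k := by exact_mod_cast hk
    have := (Real.log_pos (show (1:ℝ) < k by linarith)).ne'
    split_ifs
    · unfold wt
      field_simp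
    · simp
  rw [e, h]
  have hd : ∫ t in (16:ℝ)..x, deriv (wt x) t * (Real.log t + c) =
      (wt x x * (Real.log x + c) - (Real.log (Real.log x) - liJ x / x)) -
      (wt x 16 * (Real.log 16 + c) - (Real.log (Real.log 16) - liJ 16 / x)) := by
    apply intervalIntegral.integral_eq_sub_of_hasDerivAt
      (f := fun t => wt x t * (Real.log t + c) - (Real.log (Real.log t) - liJ t / x))
    · intro t ht
      rw [Set.uIcc_of_le hx] at ht
      have h1 : 1 < t := by linarith [ht.1]
      have h0 : t ≠ 0 := by linarith
      have hl := (Real.log_pos h1).ne'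
      have hw := wt_hasDerivAt x t h1
      have := (hw.differentiableAt.hasDerivAt.mul ((Real.hasDerivAt_log h0).add_const c)).sub
        (((Real.hasDerivAt_log h0).log hl).sub ((liJ_hasDerivAt t h1).div_const x))
      convert! this using 1
      unfold wt
      field_simp
      ring
    · apply ContinuousOn.intervalIntegrable
      rw [Set.uIcc_of_le hx]
      apply (wt_deriv_cont x).mul
      apply ContinuousOn.add _ continuousOn_const
      exact Real.continuousOn_log.mono fun t ht => by
        have := ht.1
        simp; linarith
  have hle : ∫ t in (16:ℝ)..x, deriv (wt x) t * (Real.log t + c) ≤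
      ∫ t in (16:ℝ)..x, deriv (wt x) t *
        ∑ k ∈ Finset.Icc 0 ⌊t⌋₊, (if k.Prime then Real.log k / k else 0) := by
    apply intervalIntegral.integral_mono_on hx
    · apply ContinuousOn.intervalIntegrable
      rw [Set.uIcc_of_le hx]
      apply (wt_deriv_cont x).mul
      apply ContinuousOn.add _ continuousOn_const
      exact Real.continuousOn_log.mono fun t ht => by
        have := ht.1
        simp; linarith
    · rw [intervalIntegrable_iff_integrableOn_Icc_of_le hx]
      exact integrableOn_mul_sum_Icc _ (by norm_num) (wt_deriv_cont x).integrableOn_Icc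
    · intro t ht
      apply mul_le_mul_of_nonpos_left _ (wt_deriv_nonpos x t (by linarith [ht.1]) ht.2)
      have hn : 16 ≤ ⌊t⌋₊ := Nat.le_floor (by exact_mod_cast ht.1)
      have h1 := hc ⌊t⌋₊ hn
      have h2 : Real.log ⌊t⌋₊ ≤ Real.log t := by
        apply Real.log_le_log
        · have : (16:ℝ) ≤ ⌊t⌋₊ := by exact_mod_cast hn
          linarith
        · exact Nat.floor_le (by linarith [ht.1])
      unfold mertA at h1
      linarith
  rw [hwx] at hd
  rw [hd] at hle
  unfold mertA
  have : (liJ x - liJ 16) / x = liJ x / x - liJ 16 / x := by ring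
  rw [this]
  linarith

lemma sum16 (f : ℕ → ℝ) : ∑ k ∈ Finset.Icc 0 16, (if k.Prime then f k else 0) =
    f 2 + f 3 + f 5 + f 7 + f 11 + f 13 := by
  rw [← Finset.sum_filter]
  have : (Finset.Icc 0 16).filter Nat.Prime = {2, 3, 5, 7, 11, 13} := by decide
  rw [this]
  simp [Finset.sum_insert]
  ring

lemma log_ge (a : ℝ) (m n : ℕ) (hm : 0 < m) (h : (2:ℝ) ^ n ≤ a ^ m) :
    (n / m : ℝ) * Real.log 2 ≤ Real.log a := by
  have := Real.log_le_log (by positivity) h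
  rw [Real.log_pow, Real.log_pow] at this
  have hm' : (0:ℝ) < m := by exact_mod_cast hm
  rw [div_mul_eq_mul_div, div_le_iff₀ hm']
  linarith

lemma const_bound : (1 / 2 + 1 / 3 + 1 / 5 + 1 / 7 + 1 / 11 + 1 / 13 : ℝ) - liTwo / 2
    - 2 * Real.log 2 + (4 * Real.log 2 + (2 * Real.log 2 - 1 + (2 - 2 * Real.log 2) / 17)
      - mertA 16) / (4 * Real.log 2) < 0 := by
  have hL := one_le_liTwo
  have hA : mertA 16 = Real.log 2 / 2 + Real.log 3 / 3 + Real.log 5 / 5 + Real.log 7 / 7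
      + Real.log 11 / 11 + Real.log 13 / 13 := by
    unfold mertA
    rw [sum16 (fun k => Real.log k / k)]
    norm_num
  have h3 := log_ge 3 12 19 (by norm_num) (by norm_num)
  have h5 := log_ge 5 7 16 (by norm_num) (by norm_num)
  have h7 := log_ge 7 5 14 (by norm_num) (by norm_num)
  have h11 := log_ge 11 5 17 (by norm_num) (by norm_num)
  have h13 := log_ge 13 10 37 (by norm_num) (by norm_num)
  have l1 := Real.log_two_gt_d9
  have l2 := Real.log_two_lt_d9
  push_cast at h3 h5 h7 h11 h13
  have : (4 * Real.log 2 + (2 * Real.log 2 - 1 + (2 - 2 * Real.log 2) / 17)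
      - mertA 16) / (4 * Real.log 2) ≤ 0.5345 := by
    rw [div_le_iff₀ (by linarith), hA]
    linarith
  linarith

lemma sum_split (f : ℕ → ℝ) (n : ℕ) (hn : 16 ≤ n) :
    ∑ k ∈ Finset.Icc 0 n, f k = ∑ k ∈ Finset.Icc 0 16, f k + ∑ k ∈ Finset.Ioc 16 n, f k := by
  have e : Finset.Icc 0 n = Finset.Icc 0 16 ∪ Finset.Ioc 16 n := by
    ext k
    simp only [Finset.mem_union, Finset.mem_Icc, Finset.mem_Ioc]
    omega
  rw [e, Finset.sum_union]
  rw [Finset.disjoint_left]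
  intro k hk hk'
  simp only [Finset.mem_Icc, Finset.mem_Ioc] at hk hk'
  omega

lemma big_case (x : ℝ) (hx : 16 ≤ x) :
    (∫ t in (2:ℝ)..x, (primePi t - li t) / t ^ 2) < 0 := by
  have split : ∀ y : ℝ, 2 ≤ y → (∫ t in (2:ℝ)..y, (primePi t - li t) / t ^ 2) =
      ∑ k ∈ Finset.Icc 0 ⌊y⌋₊, (if k.Prime then (1:ℝ) / k - 1 / y else 0) -
      (liTwo / 2 - (liTwo + liJ y) / y + Real.log (Real.log y) - Real.log (Real.log 2)) := by
    intro y hy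
    rw [← pi_integral y hy, ← li_integral y hy,
      ← intervalIntegral.integral_sub (pi_int y hy) (li_int y hy)]
    congr 1
    ext t
    ring
  have h16 := small_case 16 (by norm_num) le_rfl
  rw [split 16 (by norm_num)] at h16
  rw [split x (by linarith)]
  have hfl : ⌊(16:ℝ)⌋₊ = 16 := Nat.floor_ofNat 16
  have hfx : 16 ≤ ⌊x⌋₊ := Nat.le_floor (by exact_mod_cast hx)
  have hs : ∑ k ∈ Finset.Icc 0 ⌊x⌋₊, (if k.Prime then (1:ℝ) / k - 1 / x else 0) =
      ∑ k ∈ Finset.Icc (0:ℕ) 16, (if k.Prime then (1:ℝ) / k - 1 / x else 0) +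
      ∑ k ∈ Finset.Ioc 16 ⌊x⌋₊, (if k.Prime then (1:ℝ) / k - 1 / x else 0) :=
      sum_split _ _ hfx
  have ht := tail_bound x _ hx mertA_le
  have hcb := const_bound
  have hl2 : 0 < Real.log 2 := Real.log_pos (by norm_num)
  have hl16 : Real.log 16 = 4 * Real.log 2 := by
    rw [show (16:ℝ) = 2 ^ 4 by norm_num, Real.log_pow]; norm_num
  have hll : Real.log (Real.log 16) = 2 * Real.log 2 + Real.log (Real.log 2) := by
    rw [hl16, Real.log_mul (by norm_num) hl2.ne', show (4:ℝ) = 2 ^ 2 by norm_num, Real.log_pow]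
    norm_num
  rw [hs, sum16 (fun k => (1:ℝ) / k - 1 / x)]
  rw [hfl, sum16 (fun k => (1:ℝ) / k - 1 / 16), hll] at h16
  rw [hll] at ht
  unfold wt at ht
  rw [hl16] at ht
  push_cast at h16 ⊢
  set c := 2 * Real.log 2 - 1 + (2 - 2 * Real.log 2) / 17 with hcdef
  set D := (4 * Real.log 2 + c - mertA 16) / (4 * Real.log 2) with hD
  have e1 : (1 - 16 / x) / (4 * Real.log 2) * (4 * Real.log 2 + c - mertA 16)
      = (1 - 16 * (1 / x)) * D := by rw [hD]; ring
  rw [e1] at ht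
  have hq0 : 0 < 1 / x := by positivity
  have hq1 : 0 ≤ 1 - 16 * (1 / x) := by
    have : 1 / x ≤ 1 / 16 := one_div_le_one_div_of_le (by norm_num) hx
    linarith
  have e2 : (liTwo + liJ x) / x = liTwo * (1 / x) + liJ x * (1 / x) := by ring
  have e3 : (liJ x - liJ 16) / x = liJ x * (1 / x) - liJ 16 * (1 / x) := by ring
  rw [e3] at ht
  rw [e2]
  generalize 1 / x = q at *
  have p1 := mul_nonpos_of_nonneg_of_nonpos hq1 hcb.le
  have p2 := mul_neg_of_pos_of_neg hq0 h16
  linarith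

theorem integral_pi_sub_li_div_sq_neg (x : ℝ) (hx : x > 2) :
    (∫ t in (2:ℝ)..x, (primePi t - li t) / t ^ 2) < 0 := by
  rcases le_total x 16 with h | h
  · exact small_case x hx h
  · exact big_case x h
end
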